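/- Suppose the interior curve C is good, i.e. there exists a > 0 such that for every λ > 0 and every Neumann eigenfunction φ of Ω with eigenvalue λ² one has ∫₀^ℓ φ(q(s))² ds ≤ e^{2aλ} · ∫₀^L φ(c(s))² ds. Then there exists C' > 0 such that for every λ > 0 and every Neumann eigenfunction φ of Ω with eigenvalue λ², the set {s ∈ [0, L) : φ(c(s)) = 0} of intersection points of the nodal set of φ with C is finite and has cardinality at most C'·λ. -/

import Mathlib

open MeasureTheory Real
open scoped RealInnerProductSpace

noncomputable section

abbrev E2 : Type := EuclideanSpace ℝ (Fin 2)

/-- The Euclidean Laplacian `∂²/∂x₁² + ∂²/∂x₂²` on `ℝ²`. -/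
def lap (φ : E2 → ℝ) (x : E2) : ℝ :=
  ∑ i : Fin 2,
    fderiv ℝ (fun y => fderiv ℝ φ y (EuclideanSpace.single i 1)) x (EuclideanSpace.single i 1)

/-- A bounded open connected planar domain. -/
structure IsPlaneDomain (Ω : Set E2) : Prop where
  isOpen : IsOpen Ω
  isBounded : Bornology.IsBounded Ω
  isConnected : IsConnected Ω

/-- An arc-length parametrization `q` of the boundary of `Ω` (periodic with period `len`,
injective on `[0, len)`, unit speed, image equal to the frontier of `Ω`), together with the
unit normal `ν` along the boundary, pointing into `Ω`. -/
structure BoundaryParam (Ω : Set E2) where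
  len : ℝ
  len_pos : 0 < len
  q : ℝ → E2
  qd : ℝ → E2
  hasDerivAt : ∀ s, HasDerivAt q (qd s) s
  periodic : Function.Periodic q len
  injOn : Set.InjOn q (Set.Ico 0 len)
  unitSpeed : ∀ s, ‖qd s‖ = 1
  range_eq : Set.range q = frontier Ω
  ν : ℝ → E2
  ν_unit : ∀ s, ‖ν s‖ = 1
  ν_orth : ∀ s, ⟪ν s, qd s⟫ = 0
  ν_inward : ∀ s, ∃ δ > 0, ∀ t ∈ Set.Ioo (0 : ℝ) δ, q s + t • ν s ∈ Ω

/-- The boundary parametrization is `C^∞`-smooth. -/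
def BoundaryParam.IsSmooth {Ω : Set E2} (B : BoundaryParam Ω) : Prop :=
  ContDiff ℝ (⊤ : ℕ∞) B.q

/-- An interior closed real-analytic curve in `Ω`: an arc-length parametrization `c`,
real-analytic, periodic with period `len`, injective on `[0, len)`, with image contained
in `Ω`, together with a unit normal `n` along the curve. -/
structure InteriorCurve (Ω : Set E2) where
  len : ℝ
  len_pos : 0 < len
  c : ℝ → E2
  cd : ℝ → E2
  hasDerivAt : ∀ s, HasDerivAt c (cd s) s
  analytic : AnalyticOnNhd ℝ c Set.univ
  periodic : Function.Periodic c len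
  injOn : Set.InjOn c (Set.Ico 0 len)
  unitSpeed : ∀ s, ‖cd s‖ = 1
  mem : ∀ s, c s ∈ Ω
  n : ℝ → E2
  n_unit : ∀ s, ‖n s‖ = 1
  n_orth : ∀ s, ⟪n s, cd s⟫ = 0

/-- `φ` is a Neumann eigenfunction of `Ω` with eigenvalue `lam²`: it is `C^∞` on an open
neighborhood of the closure of `Ω`, not identically zero on `Ω`, satisfies `Δφ = -lam² φ`
on `Ω` and has vanishing normal derivative along the boundary. -/
structure IsNeumannEigenfunction {Ω : Set E2} (B : BoundaryParam Ω) (lam : ℝ)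
    (φ : E2 → ℝ) : Prop where
  smooth : ∃ U : Set E2, IsOpen U ∧ closure Ω ⊆ U ∧ ContDiffOn ℝ (⊤ : ℕ∞) φ U
  nontrivial : ∃ x ∈ Ω, φ x ≠ 0
  eigen : ∀ x ∈ Ω, lap φ x = -lam ^ 2 * φ x
  neumann : ∀ s : ℝ, ⟪gradient φ (B.q s), B.ν s⟫ = 0

/-! ### Zeros of bounded holomorphic functions on a strip -/

lemma normSq_csinh (w : ℂ) :
    Complex.normSq (Complex.sinh w) = Real.sinh w.re ^ 2 + Real.sin w.im ^ 2 := by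
  have h : Complex.sinh w = ⟨Real.sinh w.re * Real.cos w.im, Real.cosh w.re * Real.sin w.im⟩ := by
    conv_lhs => rw [← Complex.re_add_im w, Complex.sinh_add, Complex.sinh_mul_I,
      Complex.cosh_mul_I]
    apply Complex.ext <;>
    simp [← Complex.ofReal_sinh, ← Complex.ofReal_cosh, ← Complex.ofReal_sin, ← Complex.ofReal_cos]
  rw [h, Complex.normSq_mk]
  have h1 := Real.cosh_sq w.re
  have h2 := Real.sin_sq_add_cos_sq w.im
  linear_combination (Real.sinh w.re ^ 2) * h2 + (Real.sin w.im ^ 2) * h1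

lemma normSq_ccosh (w : ℂ) :
    Complex.normSq (Complex.cosh w) = Real.sinh w.re ^ 2 + Real.cos w.im ^ 2 := by
  have h : Complex.cosh w = ⟨Real.cosh w.re * Real.cos w.im, Real.sinh w.re * Real.sin w.im⟩ := by
    conv_lhs => rw [← Complex.re_add_im w, Complex.cosh_add, Complex.sinh_mul_I,
      Complex.cosh_mul_I]
    apply Complex.ext <;>
    simp [← Complex.ofReal_sinh, ← Complex.ofReal_cosh, ← Complex.ofReal_sin, ← Complex.ofReal_cos]
  rw [h, Complex.normSq_mk]
  have h1 := Real.cosh_sq w.re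
  have h2 := Real.sin_sq_add_cos_sq w.im
  linear_combination (Real.sinh w.re ^ 2) * h2 + (Real.cos w.im ^ 2) * h1

lemma ccosh_ne_zero {w : ℂ} (h : |w.im| < π / 2) : Complex.cosh w ≠ 0 := by
  intro h0
  have h1 := normSq_ccosh w
  rw [h0, map_zero] at h1
  have h2 : 0 < Real.cos w.im := Real.cos_pos_of_mem_Ioo (abs_lt.1 h)
  nlinarith [sq_nonneg (Real.sinh w.re)]

lemma ctanh_ne_zero {w : ℂ} (h : |w.im| < π / 2) (h0 : w ≠ 0) : Complex.tanh w ≠ 0 := by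
  rw [Complex.tanh_eq_sinh_div_cosh]
  refine div_ne_zero (fun hs => h0 ?_) (ccosh_ne_zero h)
  have h1 := normSq_csinh w
  rw [hs, map_zero] at h1
  have h2 : Real.sinh w.re = 0 := by nlinarith [sq_nonneg (Real.sinh w.re), sq_nonneg (Real.sin w.im)]
  have h3 : Real.sin w.im = 0 := by nlinarith [sq_nonneg (Real.sinh w.re), sq_nonneg (Real.sin w.im)]
  have h4 := abs_lt.1 h
  rw [Real.sin_eq_zero_iff_of_lt_of_lt (by linarith [pi_pos]) (by linarith [pi_pos])] at h3
  exact Complex.ext (Real.sinh_eq_zero.1 h2) h3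

lemma norm_ctanh_eq_one {w : ℂ} (h : |w.im| = π / 4) : ‖Complex.tanh w‖ = 1 := by
  have hc : Complex.cosh w ≠ 0 := ccosh_ne_zero (by rw [h]; linarith [pi_pos])
  rw [Complex.tanh_eq_sinh_div_cosh, norm_div, div_eq_one_iff_eq (norm_ne_zero_iff.2 hc)]
  have h2 : Real.sin w.im ^ 2 = Real.cos w.im ^ 2 := by
    rw [← sq_abs (Real.cos _), ← sq_abs (Real.sin _), Real.abs_sin_eq_sqrt_one_sub_cos_sq,
      ← Real.cos_abs w.im, h, Real.sq_sqrt, sq_abs, Real.cos_pi_div_four]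
    · rw [div_pow, Real.sq_sqrt] <;> norm_num
    · nlinarith [Real.cos_sq_le_one (π / 4)]
  have := normSq_csinh w
  rw [h2, ← normSq_ccosh w, Complex.normSq_eq_norm_sq, Complex.normSq_eq_norm_sq] at this
  exact (sq_eq_sq₀ (norm_nonneg _) (norm_nonneg _)).1 this

lemma half_le_norm_ctanh {w : ℂ} (h : |w.im| < π / 2) (h1 : 1 ≤ |w.re|) :
    1 / 2 ≤ ‖Complex.tanh w‖ := by
  have hc : Complex.cosh w ≠ 0 := ccosh_ne_zero h
  rw [Complex.tanh_eq_sinh_div_cosh, norm_div, le_div_iff₀ (norm_pos_iff.2 hc)]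
  have hs : 1 ≤ Real.sinh w.re ^ 2 := by
    rw [← sq_abs, Real.abs_sinh]
    have := Real.self_le_sinh_iff.2 (zero_le_one.trans h1)
    nlinarith
  have e1 := normSq_csinh w
  have e2 := normSq_ccosh w
  rw [Complex.normSq_eq_norm_sq] at e1 e2
  have := Real.cos_sq_le_one w.im
  refine (sq_le_sq₀ (by positivity) (norm_nonneg _)).1 ?_
  nlinarith [sq_nonneg (Real.sin w.im)]

lemma exists_eq_tanh_mul {F : ℂ → ℂ} {δ M : ℝ} (hδ : 0 < δ)
    (hF : DifferentiableOn ℂ F {z | |z.im| < 2 * δ})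
    (hM : ∀ z : ℂ, |z.im| ≤ δ → ‖F z‖ ≤ M) {a : ℝ} (ha : F a = 0) :
    ∃ G : ℂ → ℂ, DifferentiableOn ℂ G {z | |z.im| < 2 * δ} ∧
      (∀ z : ℂ, |z.im| ≤ δ → ‖G z‖ ≤ M) ∧
      ∀ z : ℂ, |z.im| < 2 * δ → F z = Complex.tanh ((π / (4 * δ) : ℝ) * (z - a)) * G z := by
  set κ : ℝ := π / (4 * δ) with hκ
  have hκ0 : 0 < κ := by positivity
  have hκδ : κ * δ = π / 4 := by rw [hκ]; field_simp
  set U : Set ℂ := {z | |z.im| < 2 * δ} with hU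
  have hUo : IsOpen U := isOpen_lt (by fun_prop) continuous_const
  have him : ∀ z : ℂ, |((κ : ℂ) * (z - a)).im| = κ * |z.im| := by
    intro z; simp [abs_mul, abs_of_pos hκ0]
  have hre : ∀ z : ℂ, ((κ : ℂ) * (z - a)).re = κ * (z.re - a) := by intro z; simp
  have hlt : ∀ z ∈ U, |((κ : ℂ) * (z - a)).im| < π / 2 := by
    intro z hz
    rw [him]
    have : κ * |z.im| < κ * (2 * δ) := mul_lt_mul_of_pos_left hz hκ0
    linarith
  set T : ℂ → ℂ := fun z => Complex.tanh (κ * (z - a)) with hT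
  have hTd : ∀ z ∈ U, HasDerivAt T (κ / Complex.cosh (κ * (z - a)) ^ 2) z := by
    intro z hz
    have hc := ccosh_ne_zero (hlt z hz)
    have h1 : HasDerivAt (fun z : ℂ => (κ : ℂ) * (z - a)) κ z := by
      simpa using ((hasDerivAt_id z).sub_const (a : ℂ)).const_mul (κ : ℂ)
    have h2 := (h1.csinh).div h1.ccosh hc
    have h3 : T = (fun z : ℂ => Complex.sinh (κ * (z - a))) / fun z => Complex.cosh (κ * (z - a)) := by
      funext z; simp [hT, Complex.tanh_eq_sinh_div_cosh]
    rw [h3]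
    refine h2.congr_deriv ?_
    have h4 := Complex.cosh_sq ((κ : ℂ) * (z - a))
    congr 1
    linear_combination (κ : ℂ) * h4
  have haU : (a : ℂ) ∈ U := by simp [hU, hδ]
  have hTdiff : DifferentiableOn ℂ T U :=
    fun z hz => (hTd z hz).differentiableAt.differentiableWithinAt
  have hTa : T a = 0 := by simp [hT]
  have hTne : ∀ z ∈ U, z ≠ a → T z ≠ 0 := by
    intro z hz hza
    refine ctanh_ne_zero (hlt z hz) (mul_ne_zero (by exact_mod_cast hκ0.ne') (sub_ne_zero.2 hza))
  have hds : ∀ z ∈ U, dslope T a z ≠ 0 := by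
    intro z hz
    by_cases hza : z = a
    · rw [hza, dslope_same, (hTd a haU).deriv]
      simp [hκ0.ne']
    · rw [dslope_of_ne _ hza, slope_def_field, hTa, sub_zero]
      exact div_ne_zero (hTne z hz hza) (sub_ne_zero.2 hza)
  have hUn : U ∈ nhds (a : ℂ) := hUo.mem_nhds haU
  let G : ℂ → ℂ := fun z => dslope F a z / dslope T a z
  have hGF : ∀ z ∈ U, F z = T z * G z := by
    intro z hz
    by_cases hza : z = a
    · rw [hza, ha, hTa, zero_mul]
    · simp only [G]
      rw [dslope_of_ne _ hza, dslope_of_ne _ hza, slope_def_field, slope_def_field, hTa, ha,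
        sub_zero, sub_zero]
      have := hTne z hz hza
      have := sub_ne_zero.2 hza
      field_simp
  have hGd : DifferentiableOn ℂ G U :=
    ((Complex.differentiableOn_dslope hUn).2 hF).div
      ((Complex.differentiableOn_dslope hUn).2 hTdiff) hds
  refine ⟨G, hGd, ?_, hGF⟩
  have hcl : ∀ z : ℂ, |z.im| ≤ δ → z ∈ U := fun z hz => by
    simp only [hU, Set.mem_ofPred_eq]; linarith
  have hedge : ∀ z : ℂ, |z.im| = δ → ‖G z‖ ≤ M := by
    intro z hz
    have h1 : ‖T z‖ = 1 := norm_ctanh_eq_one (by rw [him, hz, hκδ])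
    have h2 := hM z hz.le
    rwa [hGF z (hcl z hz.le), norm_mul, h1, one_mul] at h2
  intro z hz
  have hz' := abs_le.1 hz
  refine PhragmenLindelof.horizontal_strip (a := -δ) (b := δ) ?_ ?_ ?_ ?_ hz'.1 hz'.2
  · refine DifferentiableOn.diffContOnCl (hGd.mono ?_)
    refine (closure_minimal (t := {z : ℂ | |z.im| ≤ δ}) ?_ ?_).trans hcl
    · intro w hw
      exact abs_le.2 ⟨hw.1.le, hw.2.le⟩
    · exact isClosed_le (by fun_prop) continuous_const
  · refine ⟨0, by rw [sub_neg_eq_add]; positivity, 0, ?_⟩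
    simp only [zero_mul, Real.exp_zero]
    refine Asymptotics.IsBigO.of_bound (2 * M) ?_
    rw [Filter.eventually_inf_principal, Filter.eventually_comap]
    filter_upwards [Filter.eventually_ge_atTop (|a| + 1 / κ)] with r hr w hw hwm
    have hwδ : |w.im| ≤ δ := abs_le.2 ⟨hwm.1.le, hwm.2.le⟩
    have h1 : 1 ≤ |((κ : ℂ) * (w - a)).re| := by
      rw [hre, abs_mul, abs_of_pos hκ0]
      have : 1 / κ ≤ |w.re - a| := by
        have := abs_sub_abs_le_abs_sub w.re a
        simp only [Function.comp] at hw
        linarith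
      rwa [div_le_iff₀' hκ0] at this
    have h2 := half_le_norm_ctanh (hlt w (hcl w hwδ)) h1
    have h3 := hM w hwδ
    rw [hGF w (hcl w hwδ), norm_mul] at h3
    simp only [norm_one, mul_one]
    have : 1 / 2 * ‖G w‖ ≤ ‖T w‖ * ‖G w‖ := mul_le_mul_of_nonneg_right h2 (norm_nonneg _)
    linarith
  · intro w hw
    exact hedge w (by rw [hw, abs_neg, abs_of_pos hδ])
  · intro w hw
    exact hedge w (by rw [hw, abs_of_pos hδ])

lemma tanh_monotone : Monotone Real.tanh := by
  intro x y hxy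
  rw [Real.tanh_eq_sinh_div_cosh, Real.tanh_eq_sinh_div_cosh,
    div_le_div_iff₀ (Real.cosh_pos x) (Real.cosh_pos y)]
  have h := Real.sinh_nonneg_iff.2 (sub_nonneg.2 hxy)
  rw [Real.sinh_sub] at h
  linarith

lemma norm_le_tanh_pow_card {δ M L : ℝ} (hδ : 0 < δ) {x : ℝ} (hx : x ∈ Set.Icc 0 L)
    (S : Finset ℝ) (hS : ∀ s ∈ S, s ∈ Set.Icc 0 L) (F : ℂ → ℂ)
    (hF : DifferentiableOn ℂ F {z | |z.im| < 2 * δ})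
    (hM : ∀ z : ℂ, |z.im| ≤ δ → ‖F z‖ ≤ M) (h0 : ∀ s ∈ S, F (s : ℂ) = 0) :
    ‖F x‖ ≤ M * Real.tanh (π / (4 * δ) * L) ^ S.card := by
  induction S using Finset.induction_on generalizing F with
  | empty => simpa using hM x (by simp [hδ.le])
  | insert a S haS ih =>
    obtain ⟨G, hG, hGM, hFG⟩ := exists_eq_tanh_mul hδ hF hM (h0 a (Finset.mem_insert_self _ _))
    have hκ0 : 0 < π / (4 * δ) := by positivity
    have h1 := ih (fun s hs => hS s (Finset.mem_insert_of_mem hs)) G hG hGM (by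
      intro s hs
      have h2 := h0 s (Finset.mem_insert_of_mem hs)
      rw [hFG s (by simp [hδ])] at h2
      refine (mul_eq_zero.1 h2).resolve_left (ctanh_ne_zero ?_ ?_)
      · rw [← Complex.ofReal_sub, ← Complex.ofReal_mul, Complex.ofReal_im, abs_zero]
        positivity
      · refine mul_ne_zero (by exact_mod_cast hκ0.ne') (sub_ne_zero.2 ?_)
        intro h
        exact haS (Complex.ofReal_injective h ▸ hs))
    rw [hFG x (by simp [hδ]), norm_mul, Finset.card_insert_of_notMem haS, pow_succ]
    have hM0 : 0 ≤ M := (norm_nonneg _).trans (hM 0 (by simp [hδ.le]))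
    have ha := hS a (Finset.mem_insert_self _ _)
    have h3 : ‖Complex.tanh ((π / (4 * δ) : ℝ) * ((x : ℂ) - a))‖ ≤ Real.tanh (π / (4 * δ) * L) := by
      rw [← Complex.ofReal_sub, ← Complex.ofReal_mul, ← Complex.ofReal_tanh, Complex.norm_real,
        Real.norm_eq_abs, abs_le, ← Real.tanh_neg]
      constructor
      · apply tanh_monotone
        have : -L ≤ x - a := by linarith [hx.1, ha.2]
        nlinarith
      · apply tanh_monotone
        have : x - a ≤ L := by linarith [hx.2, ha.1]
        nlinarith
    calc _ ≤ Real.tanh (π / (4 * δ) * L) * (M * Real.tanh (π / (4 * δ) * L) ^ S.card) :=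
          mul_le_mul h3 h1 (norm_nonneg _) ((norm_nonneg _).trans h3)
      _ = _ := by ring

/-! ### Holomorphic extension of periodic real-analytic functions -/

lemma AnalyticAt.exists_complex_extension {f : ℝ → ℝ} {s : ℝ} (hf : AnalyticAt ℝ f s) :
    ∃ r > 0, ∃ h : ℂ → ℂ, DifferentiableOn ℂ h (Metric.ball (s : ℂ) r) ∧
      ∀ x : ℝ, (x : ℂ) ∈ Metric.ball (s : ℂ) r → h x = f x := by
  obtain ⟨p, R, hp⟩ := hf
  obtain ⟨r, hr0, hrR⟩ := ENNReal.lt_iff_exists_nnreal_btwn.1 hp.r_pos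
  have hr0' : 0 < (r : ℝ) := by exact_mod_cast hr0
  have hsum := p.summable_norm_mul_pow (hrR.trans_le hp.r_le)
  refine ⟨r, hr0', fun z => ∑' n, (p.coeff n : ℂ) * (z - s) ^ n, ?_, ?_⟩
  · refine Complex.differentiableOn_tsum_of_summable_norm hsum (fun n => ?_) Metric.isOpen_ball ?_
    · fun_prop
    · intro n z hz
      rw [Metric.mem_ball, dist_eq_norm] at hz
      rw [norm_mul, norm_pow, Complex.norm_real, p.norm_apply_eq_norm_coef]
      gcongr
  · intro x hx
    rw [Metric.mem_ball, dist_eq_norm, ← Complex.ofReal_sub, Complex.norm_real] at hx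
    have h1 : x - s ∈ Metric.eball (0 : ℝ) R := by
      rw [Metric.mem_eball, edist_zero_right]
      refine lt_trans ?_ hrR
      rw [← ofReal_norm, ENNReal.ofReal_lt_coe_iff (by positivity)]
      exact hx
    have h2 := hp.hasSum h1
    rw [add_sub_cancel] at h2
    have h3 := (Complex.hasSum_ofReal.2 h2).tsum_eq
    rw [← h3]
    refine tsum_congr fun n => ?_
    rw [p.apply_eq_pow_smul_coeff]
    simp [mul_comm]

lemma exists_strip_extension {f : ℝ → ℝ} (hf : AnalyticOnNhd ℝ f Set.univ) {L : ℝ} (hL : 0 < L)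
    (hper : Function.Periodic f L) {ε : ℝ} (hε : 0 < ε) :
    ∃ δ > 0, ∃ g : ℂ → ℂ, DifferentiableOn ℂ g {z | |z.im| < δ} ∧ (∀ x : ℝ, g x = f x) ∧
      ∀ z : ℂ, |z.im| < δ → ‖g z - f z.re‖ ≤ ε := by
  have hloc : ∀ s : ℝ, ∃ r > 0, ∃ h : ℂ → ℂ, DifferentiableOn ℂ h (Metric.ball (s : ℂ) r) ∧
      (∀ x : ℝ, (x : ℂ) ∈ Metric.ball (s : ℂ) r → h x = f x) ∧
      ∀ z ∈ Metric.ball (s : ℂ) r, ‖h z - f z.re‖ ≤ ε := by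
    intro s
    obtain ⟨r, hr, h, hd, hx⟩ := (hf s trivial).exists_complex_extension
    have hs : (s : ℂ) ∈ Metric.ball (s : ℂ) r := Metric.mem_ball_self hr
    have hc : ContinuousAt (fun z : ℂ => ‖h z - f z.re‖) s := by
      have h1 : ContinuousAt h s := (hd.differentiableAt (Metric.ball_mem_nhds _ hr)).continuousAt
      have h2 : ContinuousAt f s := (hf s trivial).continuousAt
      have h3 : ContinuousAt (fun z : ℂ => f z.re) s :=
        ContinuousAt.comp (f := Complex.re) (x := (s : ℂ)) (by simpa using h2) (by fun_prop)
      fun_prop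
    have hlt : ‖h s - f (s : ℂ).re‖ < ε := by
      rw [hx s hs]; simpa using hε
    obtain ⟨r', hr', hb⟩ := Metric.eventually_nhds_iff.1 (hc.eventually (gt_mem_nhds hlt))
    refine ⟨min r r', lt_min hr hr', h, hd.mono (Metric.ball_subset_ball (min_le_left _ _)),
      fun x hx' => hx x (Metric.ball_subset_ball (min_le_left _ _) hx'), fun z hz => ?_⟩
    exact (hb (Metric.ball_subset_ball (min_le_right _ _) hz)).le
  choose r hr h hd hx hb using hloc
  have hglob : ∃ δ > 0, ∀ s : ℝ, ∃ h : ℂ → ℂ, DifferentiableOn ℂ h (Metric.ball (s : ℂ) (2 * δ)) ∧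
      (∀ x : ℝ, (x : ℂ) ∈ Metric.ball (s : ℂ) (2 * δ) → h x = f x) ∧
      ∀ z ∈ Metric.ball (s : ℂ) (2 * δ), ‖h z - f z.re‖ ≤ ε := by
    have hr2 : ∃ δ' > 0, ∀ x ∈ Set.Icc (0 : ℝ) L, ∃ s : ℝ,
        Metric.ball (x : ℂ) (2 * δ') ⊆ Metric.ball (s : ℂ) (r s) := by
      obtain ⟨t, hts⟩ := (isCompact_Icc (a := (0 : ℝ)) (b := L)).elim_finite_subcover
        (fun s : ℝ => Metric.ball s (r s / 2)) (fun s => Metric.isOpen_ball)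
        (fun s _ => Set.mem_iUnion.2 ⟨s, Metric.mem_ball_self (half_pos (hr s))⟩)
      have hfin : ∃ δ' > 0, ∀ s ∈ t, 4 * δ' ≤ r s := by
        clear hts
        induction t using Finset.induction_on with
        | empty => exact ⟨1, one_pos, by simp⟩
        | insert a t _ ih =>
          obtain ⟨d, hd0, hd1⟩ := ih
          refine ⟨min d (r a / 4), lt_min hd0 (by linarith [hr a]), fun s hs => ?_⟩
          rcases Finset.mem_insert.1 hs with rfl | hs
          · linarith [min_le_right d (r s / 4)]
          · linarith [min_le_left d (r a / 4), hd1 s hs]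
      obtain ⟨d, hd0, hd1⟩ := hfin
      refine ⟨d, hd0, fun x hxm => ?_⟩
      obtain ⟨s, hs, hxs⟩ := Set.mem_iUnion₂.1 (hts hxm)
      refine ⟨s, Metric.ball_subset_ball' ?_⟩
      rw [Complex.isometry_ofReal.dist_eq]
      have := Metric.mem_ball.1 hxs
      linarith [hd1 s hs]
    obtain ⟨d, hd0, hd1⟩ := hr2
    refine ⟨d, hd0, fun s => ?_⟩
    obtain ⟨k, hk, -⟩ := existsUnique_sub_zsmul_mem_Ico hL s 0
    rw [zero_add] at hk
    obtain ⟨s', hs'⟩ := hd1 _ ⟨hk.1, hk.2.le⟩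
    set τ : ℝ := k • L with hτ
    have hmap : ∀ z ∈ Metric.ball (s : ℂ) (2 * d), z - τ ∈ Metric.ball (s' : ℂ) (r s') := by
      intro z hz
      apply hs'
      simpa [dist_eq_norm] using hz
    have hfper : ∀ x : ℝ, f (x - τ) = f x := fun x => hper.sub_zsmul_eq k
    refine ⟨fun z => h s' (z - τ), ?_, ?_, ?_⟩
    · exact (hd s').comp (by fun_prop) hmap
    · intro x hxm
      have := hx s' (x - τ) (by simpa using hmap x hxm)
      simpa [hfper] using this
    · intro z hz
      simpa [hfper] using hb s' _ (hmap z hz)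
  clear! h r
  obtain ⟨δ, hδ, H⟩ := hglob
  choose h hd hx hb using H
  have hmem : ∀ z : ℂ, |z.im| < δ → z ∈ Metric.ball (z.re : ℂ) δ := by
    intro z hz
    rw [Metric.mem_ball, dist_eq_norm]
    have : z - z.re = z.im * Complex.I := by
      apply Complex.ext <;> simp
    rw [this]
    simpa using hz
  have hagree : ∀ (s : ℝ) (z : ℂ), |z.im| < δ → z ∈ Metric.ball (s : ℂ) δ → h z.re z = h s z := by
    intro s z hz hzs
    set V : Set ℂ := Metric.ball (z.re : ℂ) (2 * δ) ∩ Metric.ball (s : ℂ) (2 * δ) with hV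
    have hVo : IsOpen V := Metric.isOpen_ball.inter Metric.isOpen_ball
    have hVc : IsPreconnected V :=
      ((convex_ball _ _).inter (convex_ball _ _)).isPreconnected
    have h1 : |z.re - s| < δ := by
      rw [Metric.mem_ball, dist_eq_norm] at hzs
      have := Complex.abs_re_le_norm (z - s)
      rw [Complex.sub_re, Complex.ofReal_re] at this
      linarith
    have hreV : (z.re : ℂ) ∈ V := by
      refine ⟨Metric.mem_ball_self (by linarith), ?_⟩
      rw [Metric.mem_ball, Complex.isometry_ofReal.dist_eq, Real.dist_eq]
      linarith
    have hzV : z ∈ V := ⟨Metric.ball_subset_ball (by linarith) (hmem z hz),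
      Metric.ball_subset_ball (by linarith) hzs⟩
    have hfr : ∃ᶠ w in nhdsWithin (z.re : ℂ) {(z.re : ℂ)}ᶜ, h z.re w = h s w := by
      have htend : Filter.Tendsto (fun x : ℝ => (x : ℂ)) (nhdsWithin z.re {z.re}ᶜ)
          (nhdsWithin (z.re : ℂ) {(z.re : ℂ)}ᶜ) := by
        refine tendsto_nhdsWithin_of_tendsto_nhds_of_eventually_within _
          (Complex.continuous_ofReal.continuousAt.tendsto.mono_left nhdsWithin_le_nhds) ?_
        filter_upwards [self_mem_nhdsWithin] with x hx
        simpa using hx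
      refine htend.frequently (Filter.Eventually.frequently ?_)
      have : ∀ᶠ x : ℝ in nhds z.re, (x : ℂ) ∈ V :=
        Complex.continuous_ofReal.continuousAt.eventually (hVo.mem_nhds hreV)
      filter_upwards [nhdsWithin_le_nhds this] with x hxV
      rw [hx _ _ hxV.1, hx _ _ hxV.2]
    exact AnalyticOnNhd.eqOn_of_preconnected_of_frequently_eq
      (((hd z.re).mono Set.inter_subset_left).analyticOnNhd hVo)
      (((hd s).mono Set.inter_subset_right).analyticOnNhd hVo) hVc hreV hfr hzV
  refine ⟨δ, hδ, fun z => h z.re z, ?_, ?_, ?_⟩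
  · intro z hz
    have hz' : |z.im| < δ := hz
    have h1 : DifferentiableAt ℂ (h z.re) z :=
      (hd z.re).differentiableAt (Metric.isOpen_ball.mem_nhds
        (Metric.ball_subset_ball (by linarith) (hmem z hz')))
    refine (h1.congr_of_eventuallyEq ?_).differentiableWithinAt
    have ho : IsOpen {w : ℂ | |w.im| < δ} := isOpen_lt (by fun_prop) continuous_const
    filter_upwards [ho.mem_nhds hz, Metric.isOpen_ball.mem_nhds (hmem z hz')] with w hw hw'
    exact hagree _ _ hw hw'
  · intro x
    exact hx x x (Metric.mem_ball_self (by linarith))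
  · intro z hz
    exact hb z.re z (Metric.ball_subset_ball (by linarith) (hmem z hz))

/-! ### Entire power series with coefficients of Bessel type -/

/-- The sum of the power series with real coefficients `γ`. -/
def pseries (γ : ℕ → ℝ) (z : ℂ) : ℂ := ∑' k, (γ k : ℂ) * z ^ k

/-- Coefficients of the derived power series. -/
def dcoeff (γ : ℕ → ℝ) (k : ℕ) : ℝ := (k + 1) * γ (k + 1)

/-- Coefficients bounded like those of a Bessel function in the squared variable. -/
def BesselType (γ : ℕ → ℝ) (K : ℝ) : Prop := ∀ k, |γ k| ≤ K * (4 ^ k / (k.factorial : ℝ) ^ 2)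

lemma BesselType.dcoeff {γ : ℕ → ℝ} {K : ℝ} (h : BesselType γ K) :
    BesselType (dcoeff γ) (4 * K) := by
  intro k
  have h1 := h (k + 1)
  have hk : (0 : ℝ) < k + 1 := by positivity
  have hK : 0 ≤ K := by simpa using (abs_nonneg _).trans (h 0)
  rw [_root_.dcoeff, abs_mul, abs_of_pos hk]
  refine (mul_le_mul_of_nonneg_left h1 hk.le).trans ?_
  rw [Nat.factorial_succ]
  push_cast
  have hf : (0 : ℝ) < k.factorial := by positivity
  have : (k + 1 : ℝ) * (K * (4 ^ (k + 1) / ((k + 1) * (k.factorial : ℝ)) ^ 2)) =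
      4 * K * (4 ^ k / (k.factorial : ℝ) ^ 2) * (1 / (k + 1)) := by
    field_simp
    ring
  rw [this]
  refine mul_le_of_le_one_right (by positivity) ?_
  rw [div_le_one hk]
  linarith [Nat.cast_nonneg (α := ℝ) k]

lemma BesselType.norm_term_le {γ : ℕ → ℝ} {K : ℝ} (h : BesselType γ K) {r : ℝ} {z : ℂ}
    (hz : ‖z‖ ≤ r) (k : ℕ) : ‖(γ k : ℂ) * z ^ k‖ ≤
      K * Real.exp (2 * √r) * ((2 * √r) ^ k / k.factorial) := by
  have hr : 0 ≤ r := (norm_nonneg z).trans hz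
  have hK : 0 ≤ K := by simpa using (abs_nonneg _).trans (h 0)
  have hx : 0 ≤ 2 * √r := by positivity
  have h2 : (2 * √r) ^ k / k.factorial ≤ Real.exp (2 * √r) := Real.pow_div_factorial_le_exp _ hx k
  rw [norm_mul, Complex.norm_real, norm_pow, Real.norm_eq_abs]
  calc |γ k| * ‖z‖ ^ k ≤ (K * (4 ^ k / (k.factorial : ℝ) ^ 2)) * r ^ k :=
        mul_le_mul (h k) (by gcongr) (by positivity) (by positivity)
    _ = K * ((2 * √r) ^ k / k.factorial) * ((2 * √r) ^ k / k.factorial) := by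
        have h3 : (4 : ℝ) ^ k * r ^ k = (2 * √r) ^ k * (2 * √r) ^ k := by
          rw [← mul_pow, ← mul_pow]
          congr 1
          have := Real.mul_self_sqrt hr
          linear_combination (-4) * this
        have hf : (0 : ℝ) < k.factorial := by positivity
        field_simp
        linear_combination K * h3
    _ ≤ K * Real.exp (2 * √r) * ((2 * √r) ^ k / k.factorial) := by gcongr

lemma BesselType.summable {γ : ℕ → ℝ} {K : ℝ} (h : BesselType γ K) (z : ℂ) :
    Summable fun k => (γ k : ℂ) * z ^ k :=
  Summable.of_norm_bounded ((Real.summable_pow_div_factorial _).mul_left _)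
    (h.norm_term_le le_rfl)

lemma BesselType.norm_pseries_le {γ : ℕ → ℝ} {K : ℝ} (h : BesselType γ K) (z : ℂ) :
    ‖pseries γ z‖ ≤ K * Real.exp (4 * √‖z‖) := by
  have h1 : HasSum (fun k : ℕ => (2 * √‖z‖) ^ k / (k.factorial : ℝ)) (Real.exp (2 * √‖z‖)) := by
    rw [Real.exp_eq_exp_ℝ]
    exact NormedSpace.expSeries_div_hasSum_exp _
  refine (tsum_of_norm_bounded (h1.mul_left _) (h.norm_term_le le_rfl)).trans_eq ?_
  rw [mul_assoc, ← Real.exp_add]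
  ring_nf

lemma BesselType.hasDerivAt_pseries {γ : ℕ → ℝ} {K : ℝ} (h : BesselType γ K) (z : ℂ) :
    HasDerivAt (pseries γ) (pseries (_root_.dcoeff γ) z) z := by
  set u : ℕ → ℝ := fun k => K * Real.exp (2 * √(‖z‖ + 1)) * ((2 * √(‖z‖ + 1)) ^ k / k.factorial)
  have hu : Summable u := (Real.summable_pow_div_factorial _).mul_left _
  have hF : ∀ k, DifferentiableOn ℂ (fun w : ℂ => (γ k : ℂ) * w ^ k) (Metric.ball 0 (‖z‖ + 1)) :=
    fun k => by fun_prop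
  have hle : ∀ k, ∀ w ∈ Metric.ball (0 : ℂ) (‖z‖ + 1), ‖(γ k : ℂ) * w ^ k‖ ≤ u k := by
    intro k w hw
    exact h.norm_term_le (mem_ball_zero_iff.1 hw).le k
  have hz : z ∈ Metric.ball (0 : ℂ) (‖z‖ + 1) := by simp
  have hd := (Complex.differentiableOn_tsum_of_summable_norm hu hF Metric.isOpen_ball
    hle).differentiableAt (Metric.isOpen_ball.mem_nhds hz)
  have hs := Complex.hasSum_deriv_of_summable_norm hu hF Metric.isOpen_ball hle hz
  have hd' : DifferentiableAt ℂ (pseries γ) z := hd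
  refine hd'.hasDerivAt.congr_deriv ?_
  have hs' : HasSum (fun k => deriv (fun w : ℂ => (γ k : ℂ) * w ^ k) z) (deriv (pseries γ) z) := hs
  rw [← hs'.tsum_eq, hs'.summable.tsum_eq_zero_add]
  simp only [pow_zero, mul_one, deriv_const, zero_add]
  refine tsum_congr fun k => ?_
  rw [deriv_const_mul _ (by fun_prop), deriv_pow_field, _root_.dcoeff]
  push_cast
  ring

lemma BesselType.differentiable_pseries {γ : ℕ → ℝ} {K : ℝ} (h : BesselType γ K) :
    Differentiable ℂ (pseries γ) := fun z => (h.hasDerivAt_pseries z).differentiableAt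

lemma ofReal_re_pseries (γ : ℕ → ℝ) (x : ℝ) : (((pseries γ x).re : ℝ) : ℂ) = pseries γ x := by
  have : pseries γ x = ((∑' k, γ k * x ^ k : ℝ) : ℂ) := by
    rw [pseries, Complex.ofReal_tsum]
    push_cast
    rfl
  rw [this, Complex.ofReal_re]

lemma BesselType.mul_pseries {γ : ℕ → ℝ} {K : ℝ} (h : BesselType γ K) (z : ℂ) :
    HasSum (fun k => ((if k = 0 then 0 else γ (k - 1) : ℝ) : ℂ) * z ^ k) (z * pseries γ z) := by
  rw [← hasSum_nat_add_iff' 1]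
  have h0 : z * pseries γ z - ∑ k ∈ Finset.range 1,
      ((if k = 0 then 0 else γ (k - 1) : ℝ) : ℂ) * z ^ k = z * pseries γ z := by simp
  rw [h0]
  refine ((h.summable z).hasSum.mul_left z).congr_fun fun k => ?_
  simp
  ring

/-- Taylor coefficients of `w ↦ J₀(2√w)`. -/
def coeffA (k : ℕ) : ℝ := (-1) ^ k / (k.factorial : ℝ) ^ 2

/-- Taylor coefficients of the entire part of the second solution of the Bessel equation. -/
def coeffB (k : ℕ) : ℝ := -2 * (∑ i ∈ Finset.range k, 1 / ((i : ℝ) + 1)) * coeffA k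

lemma coeffA_succ (k : ℕ) : ((k : ℝ) + 1) ^ 2 * coeffA (k + 1) = -coeffA k := by
  rw [coeffA, coeffA, Nat.factorial_succ]
  push_cast
  field_simp
  ring

lemma coeffB_succ (k : ℕ) : ((k : ℝ) + 1) ^ 2 * coeffB (k + 1) + coeffB k =
    -2 * (((k : ℝ) + 1) * coeffA (k + 1)) := by
  have h := coeffA_succ k
  rw [coeffB, coeffB, Finset.sum_range_succ]
  have hk : (k : ℝ) + 1 ≠ 0 := by positivity
  have : coeffA k = -(((k : ℝ) + 1) ^ 2 * coeffA (k + 1)) := by rw [h, neg_neg]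
  rw [this]
  field_simp
  ring

lemma besselType_coeffA : BesselType coeffA 1 := by
  intro k
  rw [coeffA, abs_div, abs_pow, abs_neg, abs_one, one_pow, one_mul, abs_of_pos (by positivity)]
  gcongr
  exact one_le_pow₀ (by norm_num)

lemma besselType_coeffB : BesselType coeffB 2 := by
  intro k
  have h0 : 0 ≤ ∑ i ∈ Finset.range k, 1 / ((i : ℝ) + 1) :=
    Finset.sum_nonneg fun i _ => by positivity
  have h1 : ∑ i ∈ Finset.range k, 1 / ((i : ℝ) + 1) ≤ 4 ^ k := by
    calc _ ≤ ∑ i ∈ Finset.range k, (1 : ℝ) := by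
          refine Finset.sum_le_sum fun i _ => ?_
          rw [div_le_one (by positivity)]
          linarith [Nat.cast_nonneg (α := ℝ) i]
      _ = k := by simp
      _ ≤ 4 ^ k := by exact_mod_cast (Nat.lt_pow_self (by norm_num : 1 < 4)).le
  rw [coeffB, coeffA, abs_mul, abs_mul, abs_div, abs_pow, abs_neg, abs_neg, abs_one, one_pow,
    abs_of_nonneg h0, abs_of_pos (by positivity : (0 : ℝ) < (k.factorial : ℝ) ^ 2), abs_two,
    mul_assoc, mul_one_div]
  gcongr

lemma pseries_coeffA_ode (z : ℂ) : z * pseries (dcoeff (dcoeff coeffA)) z +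
    pseries (dcoeff coeffA) z + pseries coeffA z = 0 := by
  have h := ((besselType_coeffA.dcoeff.dcoeff.mul_pseries z).add
    (besselType_coeffA.dcoeff.summable z).hasSum).add (besselType_coeffA.summable z).hasSum
  refine h.unique ?_
  convert hasSum_zero using 2 with k
  rw [← add_mul, ← add_mul, ← Complex.ofReal_add, ← Complex.ofReal_add]
  convert zero_mul _
  rw [Complex.ofReal_eq_zero]
  have h1 := coeffA_succ k
  rcases k with _ | k
  · simp [dcoeff] at h1 ⊢; linarith
  · simp only [dcoeff, Nat.succ_ne_zero, if_false, Nat.add_sub_cancel] at h1 ⊢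
    push_cast at h1 ⊢
    linear_combination h1

lemma pseries_coeffB_ode (z : ℂ) : z * pseries (dcoeff (dcoeff coeffB)) z +
    pseries (dcoeff coeffB) z + pseries coeffB z = -2 * pseries (dcoeff coeffA) z := by
  have h := ((besselType_coeffB.dcoeff.dcoeff.mul_pseries z).add
    (besselType_coeffB.dcoeff.summable z).hasSum).add (besselType_coeffB.summable z).hasSum
  refine h.unique ?_
  refine ((besselType_coeffA.dcoeff.summable z).hasSum.mul_left (-2)).congr_fun fun k => ?_
  rw [← add_mul, ← add_mul, ← Complex.ofReal_add, ← Complex.ofReal_add, ← mul_assoc]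
  congr 1
  have h1 := coeffB_succ k
  norm_cast
  rcases k with _ | k
  · simp [dcoeff] at h1 ⊢; linarith
  · simp only [dcoeff, Nat.succ_ne_zero, if_false, Nat.add_sub_cancel] at h1 ⊢
    push_cast at h1 ⊢
    linear_combination h1

/-! ### Boundary charts -/

lemma E2.inner_eq (x y : E2) : ⟪x, y⟫ = x 0 * y 0 + x 1 * y 1 := by
  simp [PiLp.inner_apply, Fin.sum_univ_two]; ring

/-- The determinant of two planar vectors. -/
def crs (x y : E2) : ℝ := x 0 * y 1 - x 1 * y 0

lemma E2.sq_add_sq {x : E2} (hx : ‖x‖ = 1) : x 0 * x 0 + x 1 * x 1 = 1 := by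
  rw [← E2.inner_eq, real_inner_self_eq_norm_sq, hx, one_pow]

namespace BoundaryParam

variable {Ω : Set E2} (B : BoundaryParam Ω)

lemma ν_eq (s : ℝ) : B.ν s 0 = -crs (B.qd s) (B.ν s) * B.qd s 1 ∧
    B.ν s 1 = crs (B.qd s) (B.ν s) * B.qd s 0 := by
  have h1 := B.ν_orth s
  have h2 := E2.sq_add_sq (B.unitSpeed s)
  rw [E2.inner_eq] at h1
  unfold crs
  constructor
  · linear_combination (-B.ν s 0) * h2 + B.qd s 0 * h1
  · linear_combination (-B.ν s 1) * h2 + B.qd s 1 * h1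

lemma crs_sq (s : ℝ) : crs (B.qd s) (B.ν s) ^ 2 = 1 := by
  have h1 := B.ν_orth s
  have h2 := E2.sq_add_sq (B.unitSpeed s)
  have h3 := E2.sq_add_sq (B.ν_unit s)
  rw [E2.inner_eq] at h1
  unfold crs
  linear_combination (B.ν s 0 * B.ν s 0 + B.ν s 1 * B.ν s 1) * h2 + h3 -
    (B.ν s 0 * B.qd s 0 + B.ν s 1 * B.qd s 1) * h1

/-- The chart `(s, t) ↦ q(s) + t ν(s₀)` near the boundary point `q(s₀)`. -/
def chart (s₀ : ℝ) (p : ℝ × ℝ) : E2 := B.q p.1 + p.2 • B.ν s₀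

/-- The differential of `chart` as a linear equivalence at its centre. -/
def frame (s₀ : ℝ) : (ℝ × ℝ) ≃L[ℝ] E2 :=
  ContinuousLinearEquiv.equivOfInverse
    ((ContinuousLinearMap.fst ℝ ℝ ℝ).smulRight (B.qd s₀) +
      (ContinuousLinearMap.snd ℝ ℝ ℝ).smulRight (B.ν s₀))
    ((innerSL ℝ (B.qd s₀)).prod (innerSL ℝ (B.ν s₀)))
    (by
      intro p
      have h1 := B.ν_orth s₀
      have h2 := h1
      rw [real_inner_comm] at h2
      simp [inner_add_right, inner_smul_right, B.unitSpeed, B.ν_unit, h1, h2])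
    (by
      intro x
      have h1 := E2.sq_add_sq (B.unitSpeed s₀)
      have h3 := B.crs_sq s₀
      obtain ⟨h4, h5⟩ := B.ν_eq s₀
      set σ := crs (B.qd s₀) (B.ν s₀)
      ext i
      fin_cases i
      · simp [E2.inner_eq]
        rw [h4, h5]
        linear_combination x 0 * h1 + (B.qd s₀ 1 * B.qd s₀ 1 * x 0 -
          B.qd s₀ 0 * B.qd s₀ 1 * x 1) * h3
      · simp [E2.inner_eq]
        rw [h4, h5]
        linear_combination x 1 * h1 + (B.qd s₀ 0 * B.qd s₀ 0 * x 1 -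
          B.qd s₀ 0 * B.qd s₀ 1 * x 0) * h3)

lemma continuous_q : Continuous B.q :=
  continuous_iff_continuousAt.2 fun s => (B.hasDerivAt s).continuousAt

lemma qd_eq : B.qd = deriv B.q := funext fun s => (B.hasDerivAt s).deriv.symm

variable {B}

lemma IsSmooth.continuous_qd (hB : B.IsSmooth) : Continuous B.qd := by
  rw [B.qd_eq]
  exact ContDiff.continuous_deriv hB (by simp)

lemma IsSmooth.contDiff_chart (hB : B.IsSmooth) (s₀ : ℝ) : ContDiff ℝ (⊤ : ℕ∞) (B.chart s₀) := by
  unfold chart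
  exact (ContDiff.comp (f := Prod.fst) hB contDiff_fst).add (contDiff_snd.smul contDiff_const)

variable (B)

lemma hasFDerivAt_chart (s₀ : ℝ) (p : ℝ × ℝ) : HasFDerivAt (B.chart s₀)
    ((ContinuousLinearMap.fst ℝ ℝ ℝ).smulRight (B.qd p.1) +
      (ContinuousLinearMap.snd ℝ ℝ ℝ).smulRight (B.ν s₀)) p := by
  have h1 := (B.hasDerivAt p.1).hasFDerivAt.comp p (hasFDerivAt_fst (𝕜 := ℝ) (p := p))
  have h2 := (hasFDerivAt_snd (𝕜 := ℝ) (p := p)).smul_const (B.ν s₀)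
  refine (h1.add h2).congr_fderiv ?_
  ext <;> simp

lemma eq_mod_of_q_eq {s t : ℝ} (h : B.q s = B.q t) : ∃ k : ℤ, s - t = k * B.len := by
  have h1 : B.q (toIcoMod B.len_pos 0 s) = B.q (toIcoMod B.len_pos 0 t) := by
    rw [toIcoMod, toIcoMod, B.periodic.sub_zsmul_eq, B.periodic.sub_zsmul_eq, h]
  have m1 := toIcoMod_mem_Ico B.len_pos 0 s
  have m2 := toIcoMod_mem_Ico B.len_pos 0 t
  rw [zero_add] at m1 m2
  have h2 := B.injOn m1 m2 h1
  refine ⟨toIcoDiv B.len_pos 0 s - toIcoDiv B.len_pos 0 t, ?_⟩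
  have h3 := toIcoMod_add_toIcoDiv_zsmul B.len_pos 0 s
  have h4 := toIcoMod_add_toIcoDiv_zsmul B.len_pos 0 t
  rw [zsmul_eq_mul] at h3 h4
  push_cast
  linear_combination h2 - h3 + h4

/-- The coordinate square of half-width `δ` around `(s₀, 0)`. -/
def box (s₀ δ : ℝ) : Set (ℝ × ℝ) := Set.Ioo (s₀ - δ) (s₀ + δ) ×ˢ Set.Ioo (-δ) δ

end BoundaryParam

namespace BoundaryParam

variable {Ω : Set E2} (B : BoundaryParam Ω)

lemma q_mem_frontier (s : ℝ) : B.q s ∈ frontier Ω := B.range_eq ▸ Set.mem_range_self s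

lemma isOpen_box (s₀ δ : ℝ) : IsOpen (box s₀ δ) := isOpen_Ioo.prod isOpen_Ioo

lemma box_mono (s₀ : ℝ) {δ δ' : ℝ} (h : δ' ≤ δ) : box s₀ δ' ⊆ box s₀ δ :=
  Set.prod_mono (Set.Ioo_subset_Ioo (by linarith) (by linarith))
    (Set.Ioo_subset_Ioo (by linarith) (by linarith))

lemma exists_box_subset (s₀ : ℝ) {U : Set (ℝ × ℝ)} (hU : U ∈ nhds (s₀, (0 : ℝ))) :
    ∃ δ > 0, box s₀ δ ⊆ U := by
  obtain ⟨δ, hδ, h⟩ := Metric.mem_nhds_iff.1 hU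
  refine ⟨δ, hδ, ?_⟩
  rwa [← ball_prod_same, Real.ball_eq_Ioo, Real.ball_eq_Ioo, zero_sub, zero_add] at h

variable {B}

lemma IsSmooth.exists_injOn_chart (hB : B.IsSmooth) (s₀ : ℝ) :
    ∃ δ > 0, Set.InjOn (B.chart s₀) (box s₀ δ) ∧
      (∀ U ⊆ box s₀ δ, IsOpen U → IsOpen (B.chart s₀ '' U)) ∧
      ∃ g : E2 → ℝ × ℝ, (∀ r ∈ box s₀ δ, g (B.chart s₀ r) = r) ∧
        HasFDerivAt g ((B.frame s₀).symm : E2 →L[ℝ] ℝ × ℝ) (B.q s₀) := by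
  have h1 : HasStrictFDerivAt (B.chart s₀) (B.frame s₀ : (ℝ × ℝ) →L[ℝ] E2) (s₀, 0) :=
    (hB.contDiff_chart s₀).contDiffAt.hasStrictFDerivAt'
      ((B.hasFDerivAt_chart s₀ (s₀, 0)).congr_fderiv rfl) (by simp)
  set e := h1.toOpenPartialHomeomorph (B.chart s₀) with he
  have hec : (e : ℝ × ℝ → E2) = B.chart s₀ := h1.toOpenPartialHomeomorph_coe
  have hs : ((s₀, 0) : ℝ × ℝ) ∈ e.source := h1.mem_toOpenPartialHomeomorph_source
  obtain ⟨δ, hδ, h⟩ := exists_box_subset s₀ (e.open_source.mem_nhds hs)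
  refine ⟨δ, hδ, ?_, ?_, e.symm, ?_, ?_⟩
  · rw [← hec]; exact e.injOn.mono h
  · intro U hU hUo
    rw [← hec]; exact e.isOpen_image_of_subset_source hUo (hU.trans h)
  · intro r hr
    rw [← hec]; exact e.left_inv (h hr)
  · have hq : B.q s₀ = e (s₀, 0) := by rw [hec]; simp [chart]
    rw [hq]
    refine e.hasFDerivAt_symm (e.map_source hs) ?_
    rw [e.left_inv hs, hec]
    exact h1.hasFDerivAt

lemma IsSmooth.exists_frontier_chart (hB : B.IsSmooth) (s₀ : ℝ) :
    ∃ δ > 0, 2 * δ ≤ B.len ∧ Set.InjOn (B.chart s₀) (box s₀ δ) ∧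
      (∀ U ⊆ box s₀ δ, IsOpen U → IsOpen (B.chart s₀ '' U)) ∧
      (∃ g : E2 → ℝ × ℝ, (∀ r ∈ box s₀ δ, g (B.chart s₀ r) = r) ∧
        HasFDerivAt g ((B.frame s₀).symm : E2 →L[ℝ] ℝ × ℝ) (B.q s₀)) ∧
      (∀ r ∈ box s₀ δ, B.chart s₀ r ∈ frontier Ω → r.2 = 0) ∧
      ∀ s ∈ Set.Ioo (s₀ - δ) (s₀ + δ), 1 / 2 ≤ ⟪B.qd s₀, B.qd s⟫ := by
  obtain ⟨δ₀, hδ₀, hi, ho, g, hg, hg'⟩ := hB.exists_injOn_chart s₀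
  have hlen := B.len_pos
  set δ₁ := min δ₀ (B.len / 2) with hδ₁
  have h1 : 0 < δ₁ := by positivity
  have h1' : δ₁ ≤ δ₀ := min_le_left _ _
  have h1'' : δ₁ ≤ B.len / 2 := min_le_right _ _
  set K := B.q '' Set.Icc (s₀ + δ₁) (s₀ - δ₁ + B.len)
  have hK : IsClosed K := (isCompact_Icc.image B.continuous_q).isClosed
  have hqK : B.q s₀ ∉ K := by
    rintro ⟨s, hs, h⟩
    obtain ⟨k, hk⟩ := B.eq_mod_of_q_eq h
    have h2 : 0 < (k : ℝ) * B.len := by rw [← hk]; linarith [hs.1]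
    have h3 : (k : ℝ) * B.len < 1 * B.len := by rw [← hk]; linarith [hs.2]
    have h4 : (0 : ℝ) < k := pos_of_mul_pos_left h2 hlen.le
    have h5 : (k : ℝ) < 1 := lt_of_mul_lt_mul_right h3 hlen.le
    have h6 : 0 < k := by exact_mod_cast h4
    have h7 : k < 1 := by exact_mod_cast h5
    omega
  have hc : Continuous (B.chart s₀) := (hB.contDiff_chart s₀).continuous
  have hn1 : B.chart s₀ ⁻¹' Kᶜ ∈ nhds (s₀, (0 : ℝ)) :=
    hc.continuousAt.preimage_mem_nhds (hK.isOpen_compl.mem_nhds (by simpa [chart] using hqK))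
  have hn2 : {p : ℝ × ℝ | 1 / 2 < ⟪B.qd s₀, B.qd p.1⟫} ∈ nhds (s₀, (0 : ℝ)) := by
    have : Continuous fun p : ℝ × ℝ => ⟪B.qd s₀, B.qd p.1⟫ :=
      continuous_const.inner (hB.continuous_qd.comp continuous_fst)
    refine (isOpen_lt continuous_const this).mem_nhds ?_
    simp [B.unitSpeed]
    norm_num
  obtain ⟨δ₂, hδ₂, h2⟩ := exists_box_subset s₀ (Filter.inter_mem hn1 hn2)
  set δ := min δ₁ δ₂
  have hδ : 0 < δ := by positivity
  have d1 : δ ≤ δ₁ := min_le_left _ _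
  have d2 : δ ≤ δ₂ := min_le_right _ _
  refine ⟨δ, hδ, by linarith, hi.mono (box_mono s₀ (d1.trans h1')),
    fun U hU => ho U (hU.trans (box_mono s₀ (d1.trans h1'))),
    ⟨g, fun r hr => hg r (box_mono s₀ (d1.trans h1') hr), hg'⟩, ?_, ?_⟩
  · intro r hr hf
    rw [← B.range_eq] at hf
    obtain ⟨s, hs⟩ := hf
    set s' := toIocMod hlen (s₀ - δ₁) s
    have hs' : B.q s' = B.chart s₀ r := by
      rw [← hs]; exact B.periodic.sub_zsmul_eq _
    have m := toIocMod_mem_Ioc hlen (s₀ - δ₁) s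
    have hlt : s' < s₀ + δ₁ := by
      by_contra hcon
      exact (h2 (box_mono s₀ d2 hr)).1 (hs' ▸ ⟨s', ⟨not_lt.1 hcon, m.2⟩, rfl⟩)
    have e1 : B.chart s₀ r = B.chart s₀ (s', 0) := by rw [← hs']; simp [chart]
    have := hi.mono (box_mono s₀ h1') (box_mono s₀ d1 hr)
      (Set.mk_mem_prod ⟨m.1, hlt⟩ ⟨by linarith, h1⟩) e1
    rw [this]
  · intro s hs
    have : ((s, 0) : ℝ × ℝ) ∈ box s₀ δ := Set.mk_mem_prod hs ⟨by linarith, hδ⟩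
    exact (h2 (box_mono s₀ d2 this)).2.le

end BoundaryParam

lemma IsPreconnected.frontier_inter_nonempty {X : Type*} [TopologicalSpace X] {s t : Set X}
    (hs : IsPreconnected s) (h1 : (s ∩ t).Nonempty) (h2 : (s ∩ tᶜ).Nonempty) :
    (s ∩ frontier t).Nonempty := by
  by_contra hcon
  rw [Set.not_nonempty_iff_eq_empty] at hcon
  have hd : ∀ x ∈ s, x ∈ interior t ∨ x ∈ (closure t)ᶜ := fun x hx => by
    by_contra! h
    exact (Set.eq_empty_iff_forall_notMem.1 hcon x) ⟨hx, not_not.1 h.2, h.1⟩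
  obtain ⟨x, hx, hxt⟩ := h1
  obtain ⟨y, hy, hyt⟩ := h2
  obtain ⟨z, -, hz, hz'⟩ := hs _ _ isOpen_interior isClosed_closure.isOpen_compl hd
    ⟨x, hx, (hd x hx).resolve_right fun h => h (subset_closure hxt)⟩
    ⟨y, hy, (hd y hy).resolve_left fun h => hyt (interior_subset h)⟩
  exact hz' (subset_closure (interior_subset hz))

lemma nonneg_of_hasDerivAt_of_pos {f : ℝ → ℝ} {d : ℝ} (hf : HasDerivAt f d 0) (h0 : f 0 = 0)
    (h : ∀ᶠ t in nhdsWithin 0 (Set.Ioi 0), 0 < f t) : 0 ≤ d := by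
  have h1 := hf.tendsto_slope_zero_right
  refine ge_of_tendsto h1 ?_
  filter_upwards [h, self_mem_nhdsWithin] with t ht ht0
  have : (0 : ℝ) < t := ht0
  simp only [zero_add, h0, sub_zero, smul_eq_mul]
  positivity

namespace BoundaryParam

variable {Ω : Set E2} {B : BoundaryParam Ω}

lemma chart_pos_mem (hB : B.IsSmooth) {s₀ δ : ℝ}
    (hδ : 0 < δ) (h : ∀ r ∈ box s₀ δ, B.chart s₀ r ∈ frontier Ω → r.2 = 0) :
    ∀ r ∈ box s₀ δ, 0 < r.2 → B.chart s₀ r ∈ Ω := by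
  have hc : Continuous (B.chart s₀) := (hB.contDiff_chart s₀).continuous
  set U : Set (ℝ × ℝ) := Set.Ioo (s₀ - δ) (s₀ + δ) ×ˢ Set.Ioo 0 δ
  have hU : IsPreconnected (B.chart s₀ '' U) :=
    (isPreconnected_Ioo.prod isPreconnected_Ioo).image _ hc.continuousOn
  intro r hr hr0
  by_contra hcon
  have hrU : r ∈ U := ⟨hr.1, hr0, hr.2.2⟩
  obtain ⟨δ', hδ', h'⟩ := B.ν_inward s₀
  have hm : min δ δ' / 2 < δ := by
    have := min_le_left δ δ'
    have := lt_min hδ hδ'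
    linarith
  have hm' : min δ δ' / 2 < δ' := by
    have := min_le_right δ δ'
    have := lt_min hδ hδ'
    linarith
  have h0 : 0 < min δ δ' / 2 := by positivity
  obtain ⟨x, ⟨r', hr', rfl⟩, hx⟩ := hU.frontier_inter_nonempty (t := Ω)
    ⟨B.chart s₀ (s₀, min δ δ' / 2), ⟨_, ⟨⟨by simp [hδ], by simp [hδ]⟩, h0, hm⟩, rfl⟩,
      h' _ ⟨h0, hm'⟩⟩ ⟨B.chart s₀ r, ⟨r, hrU, rfl⟩, hcon⟩
  have := h r' ⟨hr'.1, by linarith [hr'.2.1], hr'.2.2⟩ hx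
  linarith [hr'.2.1]

lemma chart_neg_mem (hB : B.IsSmooth) {s₀ δ : ℝ}
    (h : ∀ r ∈ box s₀ δ, B.chart s₀ r ∈ frontier Ω → r.2 = 0) :
    (∀ r ∈ box s₀ δ, r.2 < 0 → B.chart s₀ r ∈ Ω) ∨
      ∀ r ∈ box s₀ δ, r.2 < 0 → B.chart s₀ r ∉ Ω := by
  have hc : Continuous (B.chart s₀) := (hB.contDiff_chart s₀).continuous
  set U : Set (ℝ × ℝ) := Set.Ioo (s₀ - δ) (s₀ + δ) ×ˢ Set.Ioo (-δ) 0
  have hU : IsPreconnected (B.chart s₀ '' U) :=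
    (isPreconnected_Ioo.prod isPreconnected_Ioo).image _ hc.continuousOn
  by_contra! hcon
  obtain ⟨⟨r, hr, hr0, hrΩ⟩, r', hr', hr0', hrΩ'⟩ := hcon
  obtain ⟨x, ⟨p, hp, rfl⟩, hx⟩ := hU.frontier_inter_nonempty (t := Ω)
    ⟨_, ⟨r', ⟨hr'.1, hr'.2.1, hr0'⟩, rfl⟩, hrΩ'⟩ ⟨_, ⟨r, ⟨hr.1, hr.2.1, hr0⟩, rfl⟩, hrΩ⟩
  have := h p ⟨hp.1, hp.2.1, by linarith [hp.2.2, hr.2.1, hr.2.2]⟩ hx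
  linarith [hp.2.2]

lemma q_not_mem (hΩ : IsPlaneDomain Ω) (s : ℝ) : B.q s ∉ Ω := fun h => by
  have := B.q_mem_frontier s
  rw [hΩ.isOpen.frontier_eq] at this
  exact this.2 h

lemma q_not_mem_interior_closure_of_neg {s₀ δ : ℝ} (hB : B.IsSmooth)
    (ho : ∀ U ⊆ box s₀ δ, IsOpen U → IsOpen (B.chart s₀ '' U))
    (h : ∀ r ∈ box s₀ δ, r.2 < 0 → B.chart s₀ r ∉ Ω) {s : ℝ}
    (hs : s ∈ Set.Ioo (s₀ - δ) (s₀ + δ)) : B.q s ∉ interior (closure Ω) := by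
  intro hq
  have hδ : 0 < δ := by linarith [hs.1, hs.2]
  have hc : Continuous (B.chart s₀) := (hB.contDiff_chart s₀).continuous
  set U : Set (ℝ × ℝ) := Set.Ioo (s₀ - δ) (s₀ + δ) ×ˢ Set.Ioo (-δ) 0
  have hUR : U ⊆ box s₀ δ := Set.prod_mono le_rfl (Set.Ioo_subset_Ioo le_rfl hδ.le)
  have hUo : IsOpen (B.chart s₀ '' U) := ho U hUR (isOpen_Ioo.prod isOpen_Ioo)
  have hd : Disjoint (B.chart s₀ '' U) (closure Ω) := by
    refine Disjoint.closure_right ?_ hUo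
    rw [Set.disjoint_left]
    rintro _ ⟨r, hr, rfl⟩
    exact h r (hUR hr) hr.2.2
  have hcl : B.q s ∈ closure (B.chart s₀ '' U) := by
    have h1 : ((s, 0) : ℝ × ℝ) ∈ closure U := by
      rw [closure_prod_eq, closure_Ioo (by linarith), closure_Ioo (by linarith)]
      exact ⟨⟨hs.1.le, hs.2.le⟩, by linarith, le_rfl⟩
    have := image_closure_subset_closure_image hc ⟨_, h1, rfl⟩
    simpa [chart] using this
  obtain ⟨x, hx, hx'⟩ := mem_closure_iff.1 hcl _ isOpen_interior hq
  exact Set.disjoint_left.1 hd hx' (interior_subset hx)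

lemma q_mem_interior_closure_of_neg {s₀ δ : ℝ} (hB : B.IsSmooth)
    (ho : ∀ U ⊆ box s₀ δ, IsOpen U → IsOpen (B.chart s₀ '' U))
    (hf : ∀ r ∈ box s₀ δ, B.chart s₀ r ∈ frontier Ω → r.2 = 0)
    (h : ∀ r ∈ box s₀ δ, r.2 < 0 → B.chart s₀ r ∈ Ω) {s : ℝ}
    (hs : s ∈ Set.Ioo (s₀ - δ) (s₀ + δ)) : B.q s ∈ interior (closure Ω) := by
  have hδ : 0 < δ := by linarith [hs.1, hs.2]
  have hsub : B.chart s₀ '' box s₀ δ ⊆ closure Ω := by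
    rintro _ ⟨r, hr, rfl⟩
    rcases lt_trichotomy r.2 0 with h0 | h0 | h0
    · exact subset_closure (h r hr h0)
    · have : B.chart s₀ r = B.q r.1 := by simp [chart, h0]
      rw [this]; exact frontier_subset_closure (B.q_mem_frontier _)
    · exact subset_closure (chart_pos_mem hB hδ hf r hr h0)
  refine interior_maximal hsub (ho _ le_rfl (isOpen_box _ _)) ⟨(s, 0), ⟨hs, by simp [hδ]⟩, ?_⟩
  simp [chart]

lemma q_not_mem_interior_closure (hΩ : IsPlaneDomain Ω) (hB : B.IsSmooth) (s : ℝ) :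
    B.q s ∉ interior (closure Ω) := by
  set Z := {s | B.q s ∈ interior (closure Ω)}
  have hZo : IsOpen Z := isOpen_interior.preimage B.continuous_q
  have hZc : IsOpen Zᶜ := by
    rw [isOpen_iff_mem_nhds]
    intro s₀ hs₀
    obtain ⟨δ, hδ, -, -, ho, -, hf, -⟩ := hB.exists_frontier_chart s₀
    have hmem : s₀ ∈ Set.Ioo (s₀ - δ) (s₀ + δ) := by simp [hδ]
    rcases chart_neg_mem hB hf with h | h
    · exact absurd (q_mem_interior_closure_of_neg hB ho hf h hmem) hs₀
    · filter_upwards [isOpen_Ioo.mem_nhds hmem] with s hs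
      exact q_not_mem_interior_closure_of_neg hB ho h hs
  rcases isClopen_iff.1 (⟨⟨hZc⟩, hZo⟩ : IsClopen Z) with h | h
  · exact fun hs => Set.notMem_empty s (h ▸ hs)
  · exfalso
    have h1 : closure Ω ⊆ interior (closure Ω) := by
      rw [closure_eq_self_union_frontier]
      rintro x (hx | hx)
      · rw [← closure_eq_self_union_frontier]
        exact interior_maximal subset_closure hΩ.isOpen hx
      · rw [← closure_eq_self_union_frontier]
        rw [← B.range_eq] at hx
        obtain ⟨s, rfl⟩ := hx
        exact (h ▸ Set.mem_univ s : s ∈ Z)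
    have h2 : IsClopen (closure Ω) :=
      ⟨isClosed_closure, by rw [h1.antisymm interior_subset]; exact isOpen_interior⟩
    have h3 := h2.eq_univ hΩ.isConnected.nonempty.closure
    exact NormedSpace.unbounded_univ ℝ E2 (h3 ▸ hΩ.isBounded.closure)

end BoundaryParam

/-- A chart of half-width `δ` at `q(s₀)` flattening the boundary. -/
structure BoundaryParam.IsPatch {Ω : Set E2} (B : BoundaryParam Ω) (s₀ δ : ℝ) : Prop where
  pos : 0 < δ
  two_mul_le : 2 * δ ≤ B.len
  injOn : Set.InjOn (B.chart s₀) (BoundaryParam.box s₀ δ)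
  isOpen_image : ∀ U ⊆ BoundaryParam.box s₀ δ, IsOpen U → IsOpen (B.chart s₀ '' U)
  mem_iff : ∀ r ∈ BoundaryParam.box s₀ δ, B.chart s₀ r ∈ Ω ↔ 0 < r.2
  half_le : ∀ s ∈ Set.Ioo (s₀ - δ) (s₀ + δ), 1 / 2 ≤ ⟪B.qd s₀, B.qd s⟫
  exists_inverse : ∃ g : E2 → ℝ × ℝ, (∀ r ∈ BoundaryParam.box s₀ δ, g (B.chart s₀ r) = r) ∧
        HasFDerivAt g ((B.frame s₀).symm : E2 →L[ℝ] ℝ × ℝ) (B.q s₀)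
  eq_zero : ∀ r ∈ BoundaryParam.box s₀ δ, B.chart s₀ r ∈ frontier Ω → r.2 = 0

namespace BoundaryParam

variable {Ω : Set E2} {B : BoundaryParam Ω}

lemma exists_isPatch (hΩ : IsPlaneDomain Ω) (hB : B.IsSmooth) (s₀ : ℝ) :
    ∃ δ, B.IsPatch s₀ δ := by
  obtain ⟨δ, hδ, hl, hi, ho, hg, hf, hh⟩ := hB.exists_frontier_chart s₀
  refine ⟨δ, hδ, hl, hi, ho, fun r hr => ⟨fun h => ?_, chart_pos_mem hB hδ hf r hr⟩, hh, hg,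
    hf⟩
  by_contra! hr0
  rcases hr0.lt_or_eq with h0 | h0
  · rcases chart_neg_mem hB hf with h' | h'
    · exact q_not_mem_interior_closure hΩ hB s₀
        (q_mem_interior_closure_of_neg hB ho hf h' (by simp [hδ]))
    · exact h' r hr h0 h
  · have : B.chart s₀ r = B.q r.1 := by simp [chart, h0]
    exact q_not_mem hΩ _ (this ▸ h)

lemma IsPatch.mem_Ioo {s₀ δ : ℝ} (h : B.IsPatch s₀ δ) {s : ℝ}
    (hs : s ∈ Set.Ico (s₀ - δ) (s₀ - δ + B.len)) (hq : B.q s ∈ B.chart s₀ '' box s₀ δ) :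
    s ∈ Set.Ioo (s₀ - δ) (s₀ + δ) := by
  obtain ⟨r, hr, hrs⟩ := hq
  have h0 := h.eq_zero r hr (hrs ▸ B.q_mem_frontier s)
  have h1 : B.q r.1 = B.q s := by rw [← hrs]; simp [chart, h0]
  obtain ⟨k, hk⟩ := B.eq_mod_of_q_eq h1
  have hr1 := hr.1
  have hl := h.two_mul_le
  have hlen := B.len_pos
  have h2 : (k : ℝ) * B.len < 1 * B.len := by rw [← hk]; linarith [hr1.1, hr1.2, hs.1, hs.2]
  have h3 : (-1) * B.len < (k : ℝ) * B.len := by rw [← hk]; linarith [hr1.1, hr1.2, hs.1, hs.2]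
  have h4 : (k : ℝ) < 1 := lt_of_mul_lt_mul_right h2 hlen.le
  have h5 : (-1 : ℝ) < k := lt_of_mul_lt_mul_right h3 hlen.le
  have h6 : k < 1 := by exact_mod_cast h4
  have h7 : -1 < k := by exact_mod_cast h5
  have h8 : k = 0 := by omega
  rw [h8] at hk
  have : s = r.1 := by simp at hk; linarith
  rwa [this]

lemma inner_nonneg_of_mem (hΩ : IsPlaneDomain Ω) (hB : B.IsSmooth) {s : ℝ} {w : E2}
    (h : ∀ᶠ t in nhdsWithin (0 : ℝ) (Set.Ioi 0), B.q s + t • w ∈ Ω) : 0 ≤ ⟪B.ν s, w⟫ := by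
  obtain ⟨δ, hP⟩ := exists_isPatch hΩ hB s
  obtain ⟨g, hg, hg'⟩ := hP.exists_inverse
  have hs : ((s, 0) : ℝ × ℝ) ∈ box s δ := ⟨by simp [hP.pos], by simp [hP.pos]⟩
  have hl : HasDerivAt (fun t : ℝ => B.q s + t • w) w 0 := by
    simpa using ((hasDerivAt_id (0 : ℝ)).smul_const w).const_add (B.q s)
  have hg'' : HasFDerivAt g ((B.frame s).symm : E2 →L[ℝ] ℝ × ℝ) (B.q s + (0 : ℝ) • w) := by
    simpa using hg'
  have h1 := (hasFDerivAt_snd (𝕜 := ℝ)).comp_hasDerivAt (0 : ℝ) (hg''.comp_hasDerivAt (0 : ℝ) hl)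
  have hq : B.chart s (s, 0) = B.q s := by simp [chart]
  refine nonneg_of_hasDerivAt_of_pos h1 ?_ ?_
  · have := hg _ hs
    rw [hq] at this
    simp [this]
  · have ho := hP.isOpen_image _ le_rfl (isOpen_box s δ)
    have : ∀ᶠ t in nhdsWithin (0 : ℝ) (Set.Ioi 0), B.q s + t • w ∈ B.chart s '' box s δ := by
      refine nhdsWithin_le_nhds (hl.continuousAt.preimage_mem_nhds (ho.mem_nhds ?_))
      exact ⟨_, hs, by simp [hq]⟩
    filter_upwards [h, this] with t ht ht'
    obtain ⟨r, hr, hrt⟩ := ht'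
    have := (hP.mem_iff r hr).1 (hrt ▸ ht)
    simp only [Function.comp_apply]
    rwa [← hrt, hg r hr]

lemma crs_locally_const (hΩ : IsPlaneDomain Ω) (hB : B.IsSmooth) {s₀ δ : ℝ}
    (hP : B.IsPatch s₀ δ) {s : ℝ} (hs : s ∈ Set.Ioo (s₀ - δ) (s₀ + δ)) :
    crs (B.qd s) (B.ν s) = crs (B.qd s₀) (B.ν s₀) := by
  have h1 : 0 ≤ ⟪B.ν s, B.ν s₀⟫ := by
    refine inner_nonneg_of_mem hΩ hB ?_
    filter_upwards [Ioo_mem_nhdsGT hP.pos] with t ht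
    exact (hP.mem_iff (s, t) ⟨hs, by linarith [ht.1, hP.pos], ht.2⟩).2 ht.1
  have h2 := hP.half_le s hs
  have h3 := B.crs_sq s
  have h4 := B.crs_sq s₀
  obtain ⟨a1, a2⟩ := B.ν_eq s
  obtain ⟨b1, b2⟩ := B.ν_eq s₀
  rw [E2.inner_eq] at h1 h2
  rw [a1, a2, b1, b2] at h1
  set σ := crs (B.qd s) (B.ν s)
  set σ₀ := crs (B.qd s₀) (B.ν s₀)
  set I := B.qd s₀ 0 * B.qd s 0 + B.qd s₀ 1 * B.qd s 1 with hI
  have h5 : 0 ≤ σ * σ₀ * I := by rw [hI]; linarith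
  have h6 : 0 ≤ σ * σ₀ := by
    by_contra! hcon
    nlinarith
  have h7 : (σ - σ₀) ^ 2 * (σ + σ₀) ^ 2 = 0 := by linear_combination (σ ^ 2 - σ₀ ^ 2) * (h3 - h4)
  have h8 : (σ + σ₀) ^ 2 ≠ 0 := by nlinarith
  have h9 := (mul_eq_zero.1 h7).resolve_right h8
  linarith [pow_eq_zero_iff (two_ne_zero) |>.1 h9]

lemma exists_crs_eq (hΩ : IsPlaneDomain Ω) (hB : B.IsSmooth) :
    ∃ σ : ℝ, σ ^ 2 = 1 ∧ ∀ s, crs (B.qd s) (B.ν s) = σ := by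
  have : IsLocallyConstant fun s => crs (B.qd s) (B.ν s) := by
    rw [IsLocallyConstant.iff_eventually_eq]
    intro s₀
    obtain ⟨δ, hP⟩ := exists_isPatch hΩ hB s₀
    filter_upwards [Ioo_mem_nhds (sub_lt_self s₀ hP.pos) (lt_add_of_pos_right s₀ hP.pos)] with s hs
    exact crs_locally_const hΩ hB hP hs
  obtain ⟨σ, hσ⟩ := this.exists_eq_const
  exact ⟨σ, by rw [← B.crs_sq 0, congrFun hσ 0]; rfl, fun s => congrFun hσ s⟩

end BoundaryParam

/-! ### Change of variables and the divergence theorem -/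

/-- The measurable identification of `ℝ × ℝ` with the Euclidean plane. -/
def pairE : ℝ × ℝ ≃ᵐ E2 :=
  ((MeasurableEquiv.toLp 2 (Fin 2 → ℝ)).symm.trans MeasurableEquiv.finTwoArrow).symm

lemma measurePreserving_pairE : MeasurePreserving pairE :=
  ((volume_preserving_finTwoArrow ℝ).comp
    (EuclideanSpace.volume_preserving_symm_measurableEquiv_toLp (Fin 2))).symm
      ((MeasurableEquiv.toLp 2 (Fin 2 → ℝ)).symm.trans MeasurableEquiv.finTwoArrow)

lemma hasFDerivAt_pairE_symm_comp {Ψ : ℝ × ℝ → E2} {a b : E2} {r : ℝ × ℝ}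
    (h : HasFDerivAt Ψ ((ContinuousLinearMap.fst ℝ ℝ ℝ).smulRight a +
      (ContinuousLinearMap.snd ℝ ℝ ℝ).smulRight b) r) :
    HasFDerivAt (fun r => pairE.symm (Ψ r))
      ((ContinuousLinearMap.fst ℝ ℝ ℝ).smulRight (a 0, a 1) +
      (ContinuousLinearMap.snd ℝ ℝ ℝ).smulRight (b 0, b 1)) r := by
  have h0 := (EuclideanSpace.proj (𝕜 := ℝ) (ι := Fin 2) 0).hasFDerivAt.comp r h
  have h1 := (EuclideanSpace.proj (𝕜 := ℝ) (ι := Fin 2) 1).hasFDerivAt.comp r h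
  refine (h0.prodMk h1).congr_fderiv ?_
  ext <;> simp

lemma det_fst_smulRight_add_snd_smulRight (a b : E2) :
    ((ContinuousLinearMap.fst ℝ ℝ ℝ).smulRight ((a 0, a 1) : ℝ × ℝ) +
      (ContinuousLinearMap.snd ℝ ℝ ℝ).smulRight ((b 0, b 1) : ℝ × ℝ)).det = crs a b := by
  rw [ContinuousLinearMap.det, ← LinearMap.det_toMatrix (Module.Basis.finTwoProd ℝ),
    Matrix.det_fin_two]
  simp [LinearMap.toMatrix_apply, crs]
  ring

lemma integral_image_eq {Ψ : ℝ × ℝ → E2} {a b : ℝ × ℝ → E2} {S : Set (ℝ × ℝ)}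
    (hS : MeasurableSet S)
    (h : ∀ r ∈ S, HasFDerivAt Ψ ((ContinuousLinearMap.fst ℝ ℝ ℝ).smulRight (a r) +
      (ContinuousLinearMap.snd ℝ ℝ ℝ).smulRight (b r)) r) (hi : Set.InjOn Ψ S) (g : E2 → ℝ) :
    ∫ x in Ψ '' S, g x = ∫ r in S, |crs (a r) (b r)| * g (Ψ r) := by
  rw [← measurePreserving_pairE.setIntegral_preimage_emb pairE.measurableEmbedding,
    ← MeasurableEquiv.image_symm, Set.image_image,
    integral_image_eq_integral_abs_det_fderiv_smul volume hS
      (fun r hr => (hasFDerivAt_pairE_symm_comp (h r hr)).hasFDerivWithinAt)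
      (fun x hx y hy hxy => hi hx hy (pairE.symm.injective hxy))]
  simp [det_fst_smulRight_add_snd_smulRight]

/-- The divergence theorem for functions supported in a boundary chart. -/
lemma BoundaryParam.IsPatch.integral_fderiv_eq {Ω : Set E2} {B : BoundaryParam Ω}
    (hΩ : IsPlaneDomain Ω) (hB : B.IsSmooth) {s₀ δ δ' : ℝ} (hP : B.IsPatch s₀ δ) (hδ' : 0 < δ')
    (hδ : δ' < δ) {f : E2 → ℝ} (hf : ContDiff ℝ 1 f)
    (hs : ∀ x, x ∉ B.chart s₀ '' box s₀ δ' → f x = 0)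
    (hs' : ∀ x, x ∉ B.chart s₀ '' box s₀ δ' → fderiv ℝ f x = 0) (v : E2) :
    ∫ x in Ω, fderiv ℝ f x v = -∫ s in (0 : ℝ)..B.len, f (B.q s) * ⟪v, B.ν s⟫ := by
  obtain ⟨σ, hσ, hσ'⟩ := exists_crs_eq hΩ hB
  have hlen := B.len_pos
  have hbb : box s₀ δ' ⊆ box s₀ δ := box_mono s₀ hδ.le
  have hν : ∀ s, ⟪v, B.ν s⟫ = σ * crs (B.qd s) v := by
    intro s
    obtain ⟨h1, h2⟩ := B.ν_eq s
    rw [E2.inner_eq, h1, h2, hσ' s]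
    unfold crs
    ring
  have hqd : ∀ s, B.qd (s + B.len) = B.qd s := by
    intro s
    have h1 := (B.hasDerivAt (s + B.len)).comp_add_const s B.len
    have h2 : (fun x => B.q (x + B.len)) = B.q := funext B.periodic
    rw [h2] at h1
    exact h1.unique (B.hasDerivAt s)
  -- vanishing in the larger box outside the smaller one
  have hv : ∀ r ∈ box s₀ δ, r ∉ box s₀ δ' → f (B.chart s₀ r) = 0 := by
    intro r hr hr'
    apply hs
    rintro ⟨p, hp, hpr⟩
    exact hr' (hP.injOn (hbb hp) hr hpr ▸ hp)
  have hD : ∀ s, crs (B.qd s) (B.ν s₀) = σ * ⟪B.qd s₀, B.qd s⟫ := by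
    intro s
    obtain ⟨h1, h2⟩ := B.ν_eq s₀
    unfold crs
    rw [E2.inner_eq, h1, h2, hσ' s₀]
    ring
  have hD' : ∀ s ∈ Set.Ioo (s₀ - δ) (s₀ + δ), |crs (B.qd s) (B.ν s₀)| =
      σ * crs (B.qd s) (B.ν s₀) := by
    intro s hs
    have h1 := hP.half_le s hs
    have h2 : |σ| = 1 := by rw [← Real.sqrt_sq_eq_abs, hσ, Real.sqrt_one]
    rw [hD, abs_mul, h2, abs_of_nonneg (by linarith)]
    linear_combination -⟪B.qd s₀, B.qd s⟫ * hσ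
  have hcc : Continuous (B.chart s₀) := (hB.contDiff_chart s₀).continuous
  have hcD : Continuous fun r : ℝ × ℝ => crs (B.qd r.1) (B.ν s₀) := by
    have := hB.continuous_qd
    unfold crs
    fun_prop
  have hcf : Continuous fun r : ℝ × ℝ => fderiv ℝ f (B.chart s₀ r) v :=
    ((hf.continuous_fderiv (by simp)).comp hcc).clm_apply continuous_const
  -- the two sides in coordinates
  have hL : ∫ x in Ω, fderiv ℝ f x v =
      ∫ s in (s₀ - δ')..(s₀ + δ'), ∫ t in (0 : ℝ)..δ', σ *
        (crs (B.qd s) (B.ν s₀) * fderiv ℝ f (B.chart s₀ (s, t)) v) := by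
    set S : Set (ℝ × ℝ) := Set.Ioo (s₀ - δ') (s₀ + δ') ×ˢ Set.Ioo 0 δ' with hSdef
    have hSb : S ⊆ box s₀ δ' := Set.prod_mono le_rfl (Set.Ioo_subset_Ioo (by linarith) le_rfl)
    have hSm : MeasurableSet S := measurableSet_Ioo.prod measurableSet_Ioo
    have hsub : B.chart s₀ '' S ⊆ Ω := by
      rintro _ ⟨r, hr, rfl⟩
      exact (hP.mem_iff r (hbb (hSb hr))).2 hr.2.1
    rw [setIntegral_eq_of_subset_of_forall_sdiff_eq_zero hΩ.isOpen.measurableSet hsub,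
      integral_image_eq hSm (fun r _ => B.hasFDerivAt_chart s₀ r)
        (hP.injOn.mono (hSb.trans hbb))]
    · rw [setIntegral_congr_fun (g := fun r : ℝ × ℝ =>
        σ * (crs (B.qd r.1) (B.ν s₀) * fderiv ℝ f (B.chart s₀ r) v)) hSm]
      · rw [intervalIntegral.integral_of_le (by linarith), integral_Ioc_eq_integral_Ioo,
          hSdef, Measure.volume_eq_prod, setIntegral_prod]
        · refine setIntegral_congr_fun measurableSet_Ioo fun s _ => ?_
          simp only
          rw [intervalIntegral.integral_of_le hδ'.le, integral_Ioc_eq_integral_Ioo]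
        · rw [← Measure.volume_eq_prod]
          exact ((hcD.mul hcf).const_mul σ).continuousOn.integrableOn_compact
            (isCompact_Icc.prod isCompact_Icc) |>.mono_set
              (Set.prod_mono Set.Ioo_subset_Icc_self Set.Ioo_subset_Icc_self)
      · intro r hr
        simp only
        rw [hD' _ (hbb (hSb hr)).1]
        ring
    · rintro x ⟨hx, hxS⟩
      by_cases h : x ∈ B.chart s₀ '' box s₀ δ'
      · obtain ⟨r, hr, rfl⟩ := h
        exact absurd ⟨r, ⟨hr.1, (hP.mem_iff r (hbb hr)).1 hx, hr.2.2⟩, rfl⟩ hxS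
      · simp [hs' x h]
  have hR : ∫ s in (0 : ℝ)..B.len, f (B.q s) * ⟪v, B.ν s⟫ =
      ∫ s in (s₀ - δ')..(s₀ + δ'), σ * (f (B.q s) * crs (B.qd s) v) := by
    have hper : Function.Periodic (fun s => f (B.q s) * ⟪v, B.ν s⟫) B.len := by
      intro s
      simp only [hν, hqd, B.periodic s]
    have h2 := hP.two_mul_le
    have h3 := hper.intervalIntegral_add_eq 0 (s₀ - δ)
    rw [zero_add] at h3
    rw [h3, intervalIntegral.integral_of_le (by linarith), integral_Ioc_eq_integral_Ioo,
      intervalIntegral.integral_of_le (by linarith), integral_Ioc_eq_integral_Ioo,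
      setIntegral_eq_of_subset_of_forall_sdiff_eq_zero measurableSet_Ioo
        (Set.Ioo_subset_Ioo (by linarith : s₀ - δ ≤ s₀ - δ')
          (by linarith : s₀ + δ' ≤ s₀ - δ + B.len))]
    · refine setIntegral_congr_fun measurableSet_Ioo fun s _ => ?_
      simp only [hν]
      ring
    · rintro s ⟨hs1, hs2⟩
      suffices f (B.q s) = 0 by simp [this]
      by_contra hcon
      have hq : B.q s ∈ B.chart s₀ '' box s₀ δ' := by
        by_contra h
        exact hcon (hs _ h)
      have h4 := hP.mem_Ioo ⟨hs1.1.le, hs1.2⟩ (Set.image_mono hbb hq)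
      refine hcon ?_
      have := hv (s, 0) ⟨h4, by simp [hP.pos]⟩ fun h => hs2 h.1
      simpa [chart] using this
  have hdd : ∀ s, HasDerivAt B.qd (deriv B.qd s) s := by
    intro s
    have h1 : ContDiff ℝ (⊤ : ℕ∞) B.qd := by
      rw [B.qd_eq]
      exact ((contDiff_infty_iff_deriv (𝕜 := ℝ)).1 hB).2
    exact (h1.differentiable (by simp) s).hasDerivAt
  have hq2 : ∀ s, HasDerivAt (fun s => crs (B.qd s) v) (crs (deriv B.qd s) v) s := by
    intro s
    have h0 := (EuclideanSpace.proj (𝕜 := ℝ) (ι := Fin 2) 0).hasFDerivAt.comp_hasDerivAt s (hdd s)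
    have h1 := (EuclideanSpace.proj (𝕜 := ℝ) (ι := Fin 2) 1).hasFDerivAt.comp_hasDerivAt s (hdd s)
    exact (h0.mul_const (v 1)).sub (h1.mul_const (v 0))
  have hF : ∀ r, HasFDerivAt (fun r => f (B.chart s₀ r)) _ r := fun r =>
    ((hf.differentiable (by simp) _).hasFDerivAt).comp r (B.hasFDerivAt_chart s₀ r)
  have hP' : ∀ r, HasFDerivAt (fun r => f (B.chart s₀ r) * (σ * crs v (B.ν s₀))) _ r := fun r =>
    (hF r).mul_const _
  have hQ' : ∀ r : ℝ × ℝ, HasFDerivAt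
      (fun r : ℝ × ℝ => f (B.chart s₀ r) * (σ * crs (B.qd r.1) v)) _ r := fun r =>
    (hF r).mul (((hq2 r.1).hasFDerivAt.comp r (hasFDerivAt_fst (𝕜 := ℝ) (p := r))).const_mul σ)
  have hvv : ∀ s, crs v (B.ν s₀) • B.qd s + crs (B.qd s) v • B.ν s₀ =
      crs (B.qd s) (B.ν s₀) • v := by
    intro s
    ext i
    fin_cases i <;> simp [crs] <;> ring
  have key := integral2_divergence_prod_of_hasFDerivAt_off_countable _ _ _ _
    (s₀ - δ') 0 (s₀ + δ') δ' ∅ Set.countable_empty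
    (fun r _ => (hP' r).continuousAt.continuousWithinAt)
    (fun r _ => (hQ' r).continuousAt.continuousWithinAt) (fun r _ => hP' r) (fun r _ => hQ' r)
  have hI : ∀ s t : ℝ, σ * (crs (B.qd s) (B.ν s₀) * fderiv ℝ f (B.chart s₀ (s, t)) v) =
      σ * crs v (B.ν s₀) * fderiv ℝ f (B.chart s₀ (s, t)) (B.qd s) +
      σ * crs (B.qd s) v * fderiv ℝ f (B.chart s₀ (s, t)) (B.ν s₀) := by
    intro s t
    have := congrArg (fderiv ℝ f (B.chart s₀ (s, t))) (hvv s)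
    simp only [map_add, map_smul, smul_eq_mul] at this
    linear_combination -σ * this
  have e0 : ∀ t ∈ Set.uIcc 0 δ', f (B.chart s₀ (s₀ + δ', t)) = 0 := by
    intro t ht
    rw [Set.uIcc_of_le hδ'.le] at ht
    refine hv _ ⟨?_, ?_⟩ fun h => ?_
    · constructor <;> simp only <;> linarith
    · constructor <;> simp only <;> linarith [ht.1, ht.2]
    · exact lt_irrefl _ h.1.2
  have e1 : ∀ t ∈ Set.uIcc 0 δ', f (B.chart s₀ (s₀ - δ', t)) = 0 := by
    intro t ht
    rw [Set.uIcc_of_le hδ'.le] at ht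
    refine hv _ ⟨?_, ?_⟩ fun h => ?_
    · constructor <;> simp only <;> linarith
    · constructor <;> simp only <;> linarith [ht.1, ht.2]
    · exact lt_irrefl _ h.1.1
  have e2 : ∀ s ∈ Set.uIcc (s₀ - δ') (s₀ + δ'), f (B.chart s₀ (s, δ')) = 0 := by
    intro s hs
    rw [Set.uIcc_of_le (by linarith)] at hs
    refine hv _ ⟨?_, ?_⟩ fun h => ?_
    · constructor <;> simp only <;> linarith [hs.1, hs.2]
    · constructor <;> simp only <;> linarith
    · exact lt_irrefl _ h.2.2
  rw [hL, hR]
  simp_rw [hI]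
  have hz0 : ∫ t in (0 : ℝ)..δ', f (B.chart s₀ (s₀ + δ', t)) * (σ * crs v (B.ν s₀)) = 0 := by
    rw [intervalIntegral.integral_congr (g := fun _ => 0) fun t ht => by simp [e0 t ht]]
    simp
  have hz1 : ∫ t in (0 : ℝ)..δ', f (B.chart s₀ (s₀ - δ', t)) * (σ * crs v (B.ν s₀)) = 0 := by
    rw [intervalIntegral.integral_congr (g := fun _ => 0) fun t ht => by simp [e1 t ht]]
    simp
  have hz2 : ∫ s in (s₀ - δ')..(s₀ + δ'), f (B.chart s₀ (s, δ')) * (σ * crs (B.qd s) v) = 0 := by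
    rw [intervalIntegral.integral_congr (g := fun _ => 0) fun s hs => by simp [e2 s hs]]
    simp
  rw [hz0, hz1, hz2] at key
  have hcI : Continuous fun r : ℝ × ℝ =>
      σ * (crs (B.qd r.1) (B.ν s₀) * fderiv ℝ f (B.chart s₀ r) v) := (hcD.mul hcf).const_mul σ
  have hin : IntegrableOn (fun r : ℝ × ℝ =>
      σ * (crs (B.qd r.1) (B.ν s₀) * fderiv ℝ f (B.chart s₀ r) v))
      (Set.uIcc (s₀ - δ') (s₀ + δ') ×ˢ Set.uIcc 0 δ') :=
    hcI.continuousOn.integrableOn_compact (isCompact_uIcc.prod isCompact_uIcc)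
  simp only [add_apply, smul_apply,
    ContinuousLinearMap.comp_apply, ContinuousLinearMap.smulRight_apply,
    ContinuousLinearMap.coe_fst', ContinuousLinearMap.coe_snd', one_smul, zero_smul, add_zero,
    zero_add, map_zero, smul_eq_mul, mul_zero, sub_zero, zero_sub] at key
  rw [key (hin.congr_fun (fun r _ => hI r.1 r.2)
    (measurableSet_uIcc.prod measurableSet_uIcc))]
  congr 1
  refine intervalIntegral.integral_congr fun s _ => ?_
  simp [chart]
  ring

lemma IsPlaneDomain.isCompact_closure {Ω : Set E2} (hΩ : IsPlaneDomain Ω) :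
    IsCompact (closure Ω) := hΩ.isBounded.isCompact_closure

lemma IsPlaneDomain.integrableOn {Ω : Set E2} (hΩ : IsPlaneDomain Ω) {g : E2 → ℝ}
    (hg : ContinuousOn g (closure Ω)) : IntegrableOn g Ω :=
  (hg.integrableOn_compact hΩ.isCompact_closure).mono_set subset_closure

lemma IsPlaneDomain.integral_fderiv_eq_zero {Ω : Set E2} (hΩ : IsPlaneDomain Ω) {f : E2 → ℝ}
    (hf : ContDiff ℝ 1 f) (hs : tsupport f ⊆ Ω) (v : E2) :
    ∫ x in Ω, fderiv ℝ f x v = 0 := by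
  have hc : HasCompactSupport f :=
    hΩ.isCompact_closure.of_isClosed_subset (isClosed_tsupport f) (hs.trans subset_closure)
  rw [setIntegral_eq_integral_of_forall_compl_eq_zero]
  · have h1 := integral_mul_fderiv_eq_neg_fderiv_mul_of_integrable (μ := (volume : Measure E2))
      (f := fun _ : E2 => (1 : ℝ)) (g := f) (v := v) (by simp) ?_ ?_ (by simp)
      (fun x _ => hf.differentiable (by simp) x)
    · simpa using h1
    · simp only [one_mul]
      exact ((hf.continuous_fderiv (by simp)).clm_apply continuous_const).integrable_of_hasCompactSupport
        (hc.fderiv_apply ℝ v)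
    · simpa using hf.continuous.integrable_of_hasCompactSupport hc
  · intro x hx
    have : x ∉ tsupport (fderiv ℝ f) := fun h => hx (hs (tsupport_fderiv_subset ℝ h))
    simp [image_eq_zero_of_notMem_tsupport this]

lemma BoundaryParam.IsSmooth.continuous_inner_ν {Ω : Set E2} {B : BoundaryParam Ω}
    (hB : B.IsSmooth) (hΩ : IsPlaneDomain Ω) (v : E2) : Continuous fun s => ⟪v, B.ν s⟫ := by
  obtain ⟨σ, hσ, hσ'⟩ := exists_crs_eq hΩ hB
  have := hB.continuous_qd
  have h : ∀ s, ⟪v, B.ν s⟫ = σ * crs (B.qd s) v := by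
    intro s
    obtain ⟨h1, h2⟩ := B.ν_eq s
    rw [E2.inner_eq, h1, h2, hσ' s]
    unfold crs
    ring
  simp_rw [h]
  unfold crs
  fun_prop

lemma BoundaryParam.IsSmooth.continuous_ν {Ω : Set E2} {B : BoundaryParam Ω}
    (hB : B.IsSmooth) (hΩ : IsPlaneDomain Ω) : Continuous B.ν := by
  have h : Continuous fun s (i : Fin 2) => B.ν s i := continuous_pi fun i => by
    have := hB.continuous_inner_ν hΩ (EuclideanSpace.single i 1)
    simpa [EuclideanSpace.inner_single_left] using this
  exact (PiLp.continuous_toLp 2 _).comp h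

open scoped Manifold ContDiff in
/-- The divergence theorem on a smooth planar domain. -/
lemma IsPlaneDomain.integral_fderiv_eq {Ω : Set E2} {B : BoundaryParam Ω}
    (hΩ : IsPlaneDomain Ω) (hB : B.IsSmooth) {f : E2 → ℝ} (hf : ContDiff ℝ 1 f) (v : E2) :
    ∫ x in Ω, fderiv ℝ f x v = -∫ s in (0 : ℝ)..B.len, f (B.q s) * ⟪v, B.ν s⟫ := by
  choose δ hP using fun s₀ => BoundaryParam.exists_isPatch hΩ hB s₀
  set U : Option ℝ → Set E2 := fun o => o.elim Ω
    fun s₀ => B.chart s₀ '' BoundaryParam.box s₀ (δ s₀ / 2) with hU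
  have hbb : ∀ s, BoundaryParam.box s (δ s / 2) ⊆ BoundaryParam.box s (δ s) := fun s =>
    BoundaryParam.box_mono s (by linarith [(hP s).pos])
  have hUo : ∀ i, IsOpen (U i) := by
    rintro (_ | s)
    · exact hΩ.isOpen
    · exact (hP s).isOpen_image _ (hbb s) (BoundaryParam.isOpen_box _ _)
  have hcov : closure Ω ⊆ ⋃ i, U i := by
    intro x hx
    rw [closure_eq_self_union_frontier] at hx
    rcases hx with hx | hx
    · exact Set.mem_iUnion.2 ⟨none, hx⟩
    · rw [← B.range_eq] at hx
      obtain ⟨s, rfl⟩ := hx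
      refine Set.mem_iUnion.2 ⟨some s, (s, 0), ?_, by simp [BoundaryParam.chart]⟩
      have := (hP s).pos
      constructor <;> constructor <;> simp only <;> linarith
  obtain ⟨T, hT⟩ := hΩ.isCompact_closure.elim_finite_subcover U hUo hcov
  obtain ⟨ρ, hρ⟩ := SmoothPartitionOfUnity.exists_isSubordinate 𝓘(ℝ, E2) isClosed_closure
    (fun i : T => U i) (fun i => hUo i) (by simpa [Set.iUnion_subtype] using hT)
  have hρc : ∀ i, ContDiff ℝ 1 (ρ i) := fun i => (ρ i).contMDiff.contDiff.of_le (by simp)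
  have hsum : ∀ x ∈ closure Ω, f x = ∑ i, ρ i x * f x := by
    intro x hx
    rw [← Finset.sum_mul]
    have := ρ.sum_eq_one hx
    rw [finsum_eq_sum_of_fintype] at this
    rw [this, one_mul]
  have hfi : ∀ i, ContDiff ℝ 1 fun x => ρ i x * f x := fun i => (hρc i).mul hf
  have hsupp : ∀ i, tsupport (fun x => ρ i x * f x) ⊆ U i := fun i =>
    (tsupport_mul_subset_left).trans (hρ i)
  have hpart : ∀ i, ∫ x in Ω, fderiv ℝ (fun x => ρ i x * f x) x v =
      -∫ s in (0 : ℝ)..B.len, (ρ i (B.q s) * f (B.q s)) * ⟪v, B.ν s⟫ := by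
    rintro ⟨_ | s, hi⟩
    · rw [hΩ.integral_fderiv_eq_zero (hfi _) (hsupp _) v]
      rw [intervalIntegral.integral_congr (g := fun _ => 0)]
      · simp
      · intro s _
        have h1 := image_eq_zero_of_notMem_tsupport
          (fun h => BoundaryParam.q_not_mem (B := B) hΩ s (hsupp ⟨none, hi⟩ h))
        simp only [h1, zero_mul]
    · refine (hP s).integral_fderiv_eq hΩ hB (half_pos (hP s).pos) (half_lt_self (hP s).pos)
        (hfi _) (fun x hx => ?_) (fun x hx => ?_) v
      · exact image_eq_zero_of_notMem_tsupport
          (f := fun x => ρ ⟨some s, hi⟩ x * f x) fun h => hx (hsupp ⟨some s, hi⟩ h)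
      · exact image_eq_zero_of_notMem_tsupport
          fun h => hx (hsupp ⟨some s, hi⟩ (tsupport_fderiv_subset ℝ h))
  have h1 : ∀ x ∈ Ω, fderiv ℝ f x v = ∑ i, fderiv ℝ (fun x => ρ i x * f x) x v := by
    intro x hx
    have h2 : f =ᶠ[nhds x] fun x => ∑ i, ρ i x * f x := by
      filter_upwards [hΩ.isOpen.mem_nhds hx] with y hy
      exact hsum y (subset_closure hy)
    rw [h2.fderiv_eq, fderiv_fun_sum fun i _ => (hfi i).differentiable (by simp) x]
    simp
  rw [setIntegral_congr_fun hΩ.isOpen.measurableSet h1, integral_finsetSum]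
  · simp_rw [hpart]
    rw [Finset.sum_neg_distrib, ← intervalIntegral.integral_finsetSum]
    · congr 1
      refine intervalIntegral.integral_congr fun s _ => ?_
      rw [← Finset.sum_mul, ← hsum _ (frontier_subset_closure (B.q_mem_frontier s))]
    · intro i _
      have := B.continuous_q
      exact ((((hfi i).continuous.comp this)).mul (hB.continuous_inner_ν hΩ v)).intervalIntegrable _ _
  · intro i _
    exact hΩ.integrableOn (((hfi i).continuous_fderiv (by simp)).clm_apply
      continuous_const).continuousOn

/-- The `i`-th partial derivative. -/
def pd (i : Fin 2) (f : E2 → ℝ) (x : E2) : ℝ := fderiv ℝ f x (EuclideanSpace.single i 1)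

lemma lap_eq (f : E2 → ℝ) (x : E2) : lap f x = ∑ i, pd i (pd i f) x := rfl

lemma E2.sum_smul_single (v : E2) : v = ∑ i, v i • EuclideanSpace.single i (1 : ℝ) := by
  ext j
  fin_cases j <;> simp [Fin.sum_univ_two]

lemma fderiv_apply_eq_sum_pd (f : E2 → ℝ) (x v : E2) :
    fderiv ℝ f x v = ∑ i, pd i f x * v i := by
  conv_lhs => rw [E2.sum_smul_single v]
  simp [pd, mul_comm]

lemma contDiff_pd {f : E2 → ℝ} {n m : WithTop ℕ∞} (hf : ContDiff ℝ n f) (h : m + 1 ≤ n)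
    (i : Fin 2) : ContDiff ℝ m (pd i f) :=
  (hf.fderiv_right h).clm_apply contDiff_const

lemma pd_mul {f g : E2 → ℝ} {x : E2} (hf : DifferentiableAt ℝ f x) (hg : DifferentiableAt ℝ g x)
    (i : Fin 2) : pd i (fun y => f y * g y) x = f x * pd i g x + pd i f x * g x := by
  unfold pd
  rw [fderiv_fun_mul hf hg]
  simp [mul_comm]

lemma continuous_lap {f : E2 → ℝ} (hf : ContDiff ℝ 2 f) : Continuous (lap f) := by
  have : lap f = fun x => ∑ i, pd i (pd i f) x := rfl
  rw [this]
  refine continuous_finsetSum _ fun i _ => ?_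
  exact (contDiff_pd (m := 0) (contDiff_pd (m := 1) hf (by norm_num) i) (by norm_num) i).continuous

/-- Green's first identity. -/
lemma IsPlaneDomain.integral_mul_lap {Ω : Set E2} {B : BoundaryParam Ω}
    (hΩ : IsPlaneDomain Ω) (hB : B.IsSmooth) {u w : E2 → ℝ} (hu : ContDiff ℝ 1 u)
    (hw : ContDiff ℝ 2 w) :
    (∫ x in Ω, u x * lap w x) + ∫ x in Ω, ∑ i, pd i u x * pd i w x =
      -∫ s in (0 : ℝ)..B.len, u (B.q s) * fderiv ℝ w (B.q s) (B.ν s) := by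
  have hwi : ∀ i, ContDiff ℝ 1 (pd i w) := fun i => contDiff_pd hw (by norm_num) i
  have hui : ∀ i, Continuous (pd i u) := fun i =>
    (contDiff_pd (m := 0) hu (by norm_num) i).continuous
  have hfi : ∀ i, ContDiff ℝ 1 fun x => u x * pd i w x := fun i => hu.mul (hwi i)
  have hq := B.continuous_q
  have key : ∀ i, ∫ x in Ω, pd i (fun x => u x * pd i w x) x =
      -∫ s in (0 : ℝ)..B.len, (u (B.q s) * pd i w (B.q s)) * ⟪EuclideanSpace.single i 1, B.ν s⟫ :=
    fun i => hΩ.integral_fderiv_eq hB (hfi i) (EuclideanSpace.single i 1)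
  have hsum := congrArg Neg.neg (Finset.sum_congr rfl fun i (_ : i ∈ Finset.univ) => key i)
  rw [Finset.sum_neg_distrib, neg_neg, ← intervalIntegral.integral_finsetSum,
    ← integral_finsetSum] at hsum
  · rw [← integral_add]
    · rw [← neg_eq_iff_eq_neg]
      have e1 : ∀ x ∈ Ω, u x * lap w x + ∑ i, pd i u x * pd i w x =
          ∑ i, pd i (fun x => u x * pd i w x) x := fun x _ => by
        simp only [lap_eq, Finset.mul_sum, ← Finset.sum_add_distrib]
        refine Finset.sum_congr rfl fun i _ => ?_
        rw [pd_mul (hu.differentiable (by simp) x) ((hwi i).differentiable (by simp) x)]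
      rw [setIntegral_congr_fun hΩ.isOpen.measurableSet e1, hsum]
      refine intervalIntegral.integral_congr fun s _ => ?_
      rw [fderiv_apply_eq_sum_pd, Finset.mul_sum]
      refine Finset.sum_congr rfl fun i _ => ?_
      simp [EuclideanSpace.inner_single_left]
      ring
    · exact hΩ.integrableOn (hu.continuous.mul (continuous_lap hw)).continuousOn
    · exact hΩ.integrableOn (continuous_finsetSum _ fun i _ =>
        (hui i).mul (hwi i).continuous).continuousOn
  · intro i _
    exact hΩ.integrableOn
      (contDiff_pd (m := 0) (hfi i) (by norm_num) i).continuous.continuousOn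
  · intro i _
    exact (((hfi i).continuous.comp hq).mul (hB.continuous_inner_ν hΩ _)).intervalIntegrable _ _

/-- A globally smooth function solving the Neumann eigenvalue problem. -/
structure IsSmoothNeumann {Ω : Set E2} (B : BoundaryParam Ω) (lam : ℝ) (φ : E2 → ℝ) : Prop where
  smooth : ContDiff ℝ 2 φ
  eigen : ∀ x ∈ Ω, lap φ x = -lam ^ 2 * φ x
  neumann : ∀ s : ℝ, fderiv ℝ φ (B.q s) (B.ν s) = 0

section

variable {Ω : Set E2} {B : BoundaryParam Ω} {lam : ℝ} {φ : E2 → ℝ}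

lemma IsSmoothNeumann.integral_eq_zero (h : IsSmoothNeumann B lam φ) (hΩ : IsPlaneDomain Ω)
    (hB : B.IsSmooth) (hlam : 0 < lam) : ∫ x in Ω, φ x = 0 := by
  have h1 := hΩ.integral_mul_lap hB (u := fun _ => 1) contDiff_const h.smooth
  simp only [h.neumann, one_mul, intervalIntegral.integral_zero, neg_zero] at h1
  rw [setIntegral_congr_fun hΩ.isOpen.measurableSet h.eigen, integral_const_mul] at h1
  have h2 : ∀ i x, pd i (fun _ => 1) x = 0 := by intro i x; simp [pd]
  simp only [h2, zero_mul, Finset.sum_const_zero, integral_zero, add_zero] at h1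
  simpa [hlam.ne'] using h1

lemma IsSmoothNeumann.integral_grad_sq (h : IsSmoothNeumann B lam φ) (hΩ : IsPlaneDomain Ω)
    (hB : B.IsSmooth) : ∫ x in Ω, ∑ i, pd i φ x ^ 2 = lam ^ 2 * ∫ x in Ω, φ x ^ 2 := by
  have h1 := hΩ.integral_mul_lap hB (h.smooth.of_le (by norm_num)) h.smooth
  simp only [h.neumann, mul_zero, intervalIntegral.integral_zero, neg_zero] at h1
  have h2 : ∫ x in Ω, φ x * lap φ x = -(lam ^ 2 * ∫ x in Ω, φ x ^ 2) := by
    rw [← integral_const_mul, ← integral_neg]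
    refine setIntegral_congr_fun hΩ.isOpen.measurableSet fun x hx => ?_
    simp only [h.eigen x hx]
    ring
  simp_rw [sq (pd _ φ _)]
  linarith

lemma IsSmoothNeumann.green (h : IsSmoothNeumann B lam φ) (hΩ : IsPlaneDomain Ω)
    (hB : B.IsSmooth) {w : E2 → ℝ} (hw : ContDiff ℝ 2 w) :
    ∫ x in Ω, φ x * (lap w x + lam ^ 2 * w x) =
      -∫ s in (0 : ℝ)..B.len, φ (B.q s) * fderiv ℝ w (B.q s) (B.ν s) := by
  have h1 := hΩ.integral_mul_lap hB (h.smooth.of_le (by norm_num)) hw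
  have h2 := hΩ.integral_mul_lap hB (hw.of_le (by norm_num)) h.smooth
  simp only [h.neumann, mul_zero, intervalIntegral.integral_zero, neg_zero] at h2
  simp_rw [mul_comm (pd _ w _)] at h2
  have h3 : ∫ x in Ω, φ x * (lap w x + lam ^ 2 * w x) =
      (∫ x in Ω, φ x * lap w x) - ∫ x in Ω, w x * lap φ x := by
    rw [← integral_sub]
    · refine setIntegral_congr_fun hΩ.isOpen.measurableSet fun x hx => ?_
      simp only [h.eigen x hx]
      ring
    · exact hΩ.integrableOn (h.smooth.continuous.mul (continuous_lap hw)).continuousOn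
    · exact hΩ.integrableOn (hw.continuous.mul (continuous_lap h.smooth)).continuousOn
  linarith

lemma fderiv_eq_inner_gradient (f : E2 → ℝ) (x v : E2) : fderiv ℝ f x v = ⟪gradient f x, v⟫ := by
  simp [gradient]

lemma two_le_infty : (2 : WithTop ℕ∞) ≤ ((⊤ : ℕ∞) : WithTop ℕ∞) :=
  WithTop.coe_le_coe.2 (le_top : (2 : ℕ∞) ≤ ⊤)

open scoped Manifold ContDiff in
/-- A Neumann eigenfunction agrees on the closed domain with a globally smooth one. -/
lemma IsNeumannEigenfunction.exists_smooth
    (h : IsNeumannEigenfunction B lam φ) :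
    ∃ ψ, IsSmoothNeumann B lam ψ ∧ ∀ x ∈ closure Ω, ψ x = φ x := by
  obtain ⟨U, hU, hΩU, hφ⟩ := h.smooth
  have : ∃ χ : E2 → ℝ, ContDiff ℝ 2 χ ∧ tsupport χ ⊆ U ∧ ∀ x ∈ closure Ω, χ =ᶠ[nhds x] 1 := by
    obtain ⟨V, hV, hΩV, hVU⟩ := normal_exists_closure_subset (isClosed_closure (s := Ω)) hU hΩU
    obtain ⟨χ, h1, h0, -⟩ := exists_contMDiffMap_one_nhds_of_subset_interior (n := 2) 𝓘(ℝ, E2)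
      (isClosed_closure (s := Ω)) (t := V) (by rwa [hV.interior_eq])
    refine ⟨χ, χ.contMDiff.contDiff, (closure_mono fun x hx => ?_).trans hVU, fun x hx => ?_⟩
    · by_contra hcon
      exact hx (h0 x hcon)
    · exact (Filter.eventually_of_mem (nhds_le_nhdsSet hx h1) fun y hy => hy)
  obtain ⟨χ, hχ, hχU, hχ1⟩ := this
  have he : ∀ x ∈ closure Ω, (fun y => χ y * φ y) =ᶠ[nhds x] φ := fun x hx => by
    filter_upwards [hχ1 x hx] with y hy
    simp [hy]
  refine ⟨fun x => χ x * φ x, ⟨?_, fun x hx => ?_, fun s => ?_⟩, fun x hx => (he x hx).eq_of_nhds⟩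
  · rw [contDiff_iff_contDiffAt]
    intro x
    by_cases hx : x ∈ U
    · exact hχ.contDiffAt.mul ((hφ.contDiffAt (hU.mem_nhds hx)).of_le two_le_infty)
    · have h0 : (fun y => χ y * φ y) =ᶠ[nhds x] fun _ => 0 := by
        filter_upwards [(isClosed_tsupport χ).isOpen_compl.mem_nhds fun hx' => hx (hχU hx')]
          with y hy
        simp [image_eq_zero_of_notMem_tsupport hy]
      exact (contDiffAt_const (c := (0 : ℝ))).congr_of_eventuallyEq h0
  · have hx' := subset_closure hx
    rw [(he x hx').eq_of_nhds, ← h.eigen x hx]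
    unfold lap
    refine Finset.sum_congr rfl fun i _ => ?_
    have : (fun y : E2 => fderiv ℝ (fun y => χ y * φ y) y (EuclideanSpace.single i 1)) =ᶠ[nhds x]
        fun y : E2 => fderiv ℝ φ y (EuclideanSpace.single i 1) := by
      filter_upwards [(he x hx').fderiv (𝕜 := ℝ)] with y hy
      rw [hy]
    rw [this.fderiv_eq]
  · rw [(he _ (frontier_subset_closure (B.q_mem_frontier s))).fderiv_eq,
      fderiv_eq_inner_gradient]
    exact h.neumann s

end

/-! ### A Poincaré inequality -/

/-- The Cauchy–Schwarz inequality for the mean of a continuous function. -/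
lemma sq_intervalIntegral_le {g : ℝ → ℝ} (hg : Continuous g) {a b : ℝ} (hab : a ≤ b) :
    (∫ s in a..b, g s) ^ 2 ≤ (b - a) * ∫ s in a..b, g s ^ 2 := by
  have h : ∀ c : ℝ, 0 ≤ (∫ s in a..b, g s ^ 2) - 2 * c * (∫ s in a..b, g s) + c ^ 2 * (b - a) := by
    intro c
    have h1 : 0 ≤ ∫ s in a..b, (g s - c) ^ 2 :=
      intervalIntegral.integral_nonneg hab fun s _ => sq_nonneg _
    have h2 : ∫ s in a..b, (g s - c) ^ 2 = (∫ s in a..b, g s ^ 2) - 2 * c * (∫ s in a..b, g s) +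
        c ^ 2 * (b - a) := by
      have : ∀ s, (g s - c) ^ 2 = g s ^ 2 - 2 * c * g s + c ^ 2 := fun s => by ring
      simp_rw [this]
      rw [intervalIntegral.integral_add, intervalIntegral.integral_sub,
        intervalIntegral.integral_const_mul, intervalIntegral.integral_const]
      · simp; ring
      all_goals
        apply Continuous.intervalIntegrable
        fun_prop
    rwa [h2] at h1
  rcases hab.eq_or_lt with rfl | hab
  · simp
  · have h1 := h ((∫ s in a..b, g s) / (b - a))
    have h2 : 0 < b - a := sub_pos.2 hab
    field_simp at h1
    nlinarith

lemma sq_sub_le_integral_sq_deriv {g g' : ℝ → ℝ} (hg : ∀ s, HasDerivAt g (g' s) s)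
    (hg' : Continuous g') {a b s t : ℝ} (hs : s ∈ Set.Icc a b) (ht : t ∈ Set.Icc a b) :
    (g s - g t) ^ 2 ≤ (b - a) * ∫ u in a..b, g' u ^ 2 := by
  wlog hst : t ≤ s generalizing s t
  · rw [sub_sq_comm]
    exact this ht hs (not_le.1 hst).le
  rw [← intervalIntegral.integral_eq_sub_of_hasDerivAt (fun x _ => hg x)
    (hg'.intervalIntegrable _ _)]
  have h0 : 0 ≤ ∫ u in t..s, g' u ^ 2 :=
    intervalIntegral.integral_nonneg hst fun _ _ => sq_nonneg _
  refine (sq_intervalIntegral_le hg' hst).trans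
    (mul_le_mul (by linarith [hs.2, ht.1]) ?_ h0 (by linarith [hs.2, ht.1]))
  exact intervalIntegral.integral_mono_interval ht.1 hst hs.2
    (Filter.Eventually.of_forall fun _ => sq_nonneg _) ((hg'.pow 2).intervalIntegrable _ _)

lemma exists_mul_le_intervalIntegral {g : ℝ → ℝ} (hg : Continuous g) {a b : ℝ} (hab : a < b) :
    ∃ s ∈ Set.Icc a b, (b - a) * g s ≤ ∫ s in a..b, g s := by
  obtain ⟨s, hs, hmin⟩ := isCompact_Icc.exists_isMinOn (Set.nonempty_Icc.2 hab.le) hg.continuousOn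
  refine ⟨s, hs, ?_⟩
  have := intervalIntegral.integral_mono_on hab.le (intervalIntegrable_const (μ := volume) (c := g s))
    (hg.intervalIntegrable a b) fun x hx => hmin hx
  simpa using this

/-- The Poincaré inequality on a rectangle. -/
lemma exists_integral_sq_sub_le_rect {F Fs Ft : ℝ → ℝ → ℝ}
    (hs : ∀ s t, HasDerivAt (fun s => F s t) (Fs s t) s)
    (ht : ∀ s t, HasDerivAt (fun t => F s t) (Ft s t) t)
    (hF : Continuous fun p : ℝ × ℝ => F p.1 p.2)
    (hFs : Continuous fun p : ℝ × ℝ => Fs p.1 p.2)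
    (hFt : Continuous fun p : ℝ × ℝ => Ft p.1 p.2) {a b c d : ℝ} (hab : a < b) (hcd : c < d) :
    ∃ m, ∫ s in a..b, ∫ t in c..d, (F s t - m) ^ 2 ≤
      2 * (b - a) ^ 2 * (∫ s in a..b, ∫ t in c..d, Fs s t ^ 2) +
      2 * (d - c) ^ 2 * (∫ s in a..b, ∫ t in c..d, Ft s t ^ 2) := by
  have hcT : Continuous fun s => ∫ t in c..d, Ft s t ^ 2 :=
    intervalIntegral.continuous_parametric_intervalIntegral_of_continuous' (hFt.pow 2) c d
  have hswap : Continuous fun p : ℝ × ℝ => Fs p.2 p.1 ^ 2 := by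
    have : Continuous fun p : ℝ × ℝ => Fs p.2 p.1 := hFs.comp continuous_swap
    exact this.pow 2
  have hcS : Continuous fun t => ∫ s in a..b, Fs s t ^ 2 :=
    intervalIntegral.continuous_parametric_intervalIntegral_of_continuous'
      (f := fun t s => Fs s t ^ 2) hswap a b
  obtain ⟨s', hs', hle⟩ := exists_mul_le_intervalIntegral hcT hab
  set m := F s' c
  refine ⟨m, ?_⟩
  have hFm : Continuous fun p : ℝ × ℝ => (F p.1 p.2 - m) ^ 2 := (hF.sub continuous_const).pow 2
  have hcm : Continuous fun s => ∫ t in c..d, (F s t - m) ^ 2 :=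
    intervalIntegral.continuous_parametric_intervalIntegral_of_continuous' hFm c d
  set I := ∫ t in c..d, Ft s' t ^ 2
  set J := ∫ s in a..b, ∫ t in c..d, Fs s t ^ 2
  have hJ : J = ∫ t in c..d, ∫ s in a..b, Fs s t ^ 2 := by
    refine intervalIntegral_intervalIntegral_swap ?_
    refine IntegrableOn.mono_set (t := Set.Icc (min a b) (max a b) ×ˢ Set.Icc (min c d) (max c d))
      ?_ (Set.prod_mono Set.Ioc_subset_Icc_self Set.Ioc_subset_Icc_self)
    exact (hFs.pow 2).continuousOn.integrableOn_compact (isCompact_Icc.prod isCompact_Icc)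
  have h1 : ∀ s ∈ Set.Icc a b, ∫ t in c..d, (F s t - m) ^ 2 ≤
      2 * (b - a) * J + 2 * (d - c) ^ 2 * I := by
    intro s hs2
    calc ∫ t in c..d, (F s t - m) ^ 2 ≤
        ∫ t in c..d, (2 * (b - a) * (∫ u in a..b, Fs u t ^ 2) + 2 * (d - c) * I) := by
          refine intervalIntegral.integral_mono_on hcd.le ?_ ?_ fun t ht2 => ?_
          · exact (hFm.comp (by fun_prop : Continuous fun t : ℝ => (s, t))).intervalIntegrable _ _
          · exact ((hcS.const_mul _).add continuous_const).intervalIntegrable _ _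
          · have e1 := sq_sub_le_integral_sq_deriv (fun s => hs s t)
              (hFs.comp (by fun_prop : Continuous fun s : ℝ => (s, t))) hs2 hs'
            have e2 := sq_sub_le_integral_sq_deriv (fun t => ht s' t)
              (hFt.comp (by fun_prop : Continuous fun t : ℝ => (s', t))) ht2
              (Set.left_mem_Icc.2 hcd.le)
            nlinarith [sq_nonneg ((F s t - F s' t) - (F s' t - F s' c))]
      _ = 2 * (b - a) * J + 2 * (d - c) ^ 2 * I := by
          rw [intervalIntegral.integral_add, intervalIntegral.integral_const_mul, ← hJ,
            intervalIntegral.integral_const, smul_eq_mul]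
          · ring
          · exact (hcS.const_mul _).intervalIntegrable _ _
          · exact intervalIntegrable_const
  have h2 := intervalIntegral.integral_mono_on hab.le (hcm.intervalIntegrable a b)
    (intervalIntegrable_const (μ := volume) (c := 2 * (b - a) * J + 2 * (d - c) ^ 2 * I)) h1
  rw [intervalIntegral.integral_const, smul_eq_mul] at h2
  nlinarith [mul_le_mul_of_nonneg_left hle (by positivity : 0 ≤ 2 * (d - c) ^ 2)]

lemma integrableOn_rect {g : ℝ × ℝ → ℝ} (hg : Continuous g) (a b c d : ℝ) :
    IntegrableOn g (Set.Ioo a b ×ˢ Set.Ioo c d) :=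
  (hg.continuousOn.integrableOn_compact
    ((isCompact_Icc (a := a) (b := b)).prod (isCompact_Icc (a := c) (b := d)))).mono_set
    (Set.prod_mono Set.Ioo_subset_Icc_self Set.Ioo_subset_Icc_self)

lemma setIntegral_rect {g : ℝ × ℝ → ℝ} (hg : Continuous g) {a b c d : ℝ} (hab : a ≤ b)
    (hcd : c ≤ d) :
    ∫ r in Set.Ioo a b ×ˢ Set.Ioo c d, g r = ∫ s in a..b, ∫ t in c..d, g (s, t) := by
  have := setIntegral_prod (μ := volume) (ν := volume) g (integrableOn_rect hg a b c d)
  rw [← Measure.volume_eq_prod] at this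
  rw [this, intervalIntegral.integral_of_le hab, integral_Ioc_eq_integral_Ioo]
  simp_rw [intervalIntegral.integral_of_le hcd, integral_Ioc_eq_integral_Ioo]

lemma fderiv_sq_le {f : E2 → ℝ} {x v : E2} (hv : ‖v‖ ≤ 1) :
    fderiv ℝ f x v ^ 2 ≤ ∑ i, pd i f x ^ 2 := by
  have h1 := E2.inner_eq v v
  rw [real_inner_self_eq_norm_sq] at h1
  have h2 : ‖v‖ ^ 2 ≤ 1 := pow_le_one₀ (norm_nonneg _) hv
  rw [fderiv_apply_eq_sum_pd]
  simp only [Fin.sum_univ_two]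
  nlinarith [sq_nonneg (pd 0 f x * v 1 - pd 1 f x * v 0),
    mul_nonneg (add_nonneg (sq_nonneg (pd 0 f x)) (sq_nonneg (pd 1 f x))) (sub_nonneg.2 h2)]

/-- An open subset `U` of `Ω` on which every `C¹` function is controlled up to constants by
its Dirichlet energy on `Ω`. -/
structure IsPoincareSet (Ω U : Set E2) : Prop where
  isOpen : IsOpen U
  subset : U ⊆ Ω
  exists_le : ∃ A ≥ (0 : ℝ), ∀ f : E2 → ℝ, ContDiff ℝ 1 f →
    ∃ m, ∫ x in U, (f x - m) ^ 2 ≤ A * ∫ x in Ω, ∑ i, pd i f x ^ 2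

lemma continuous_sum_pd_sq {f : E2 → ℝ} (hf : ContDiff ℝ 1 f) :
    Continuous fun x => ∑ i, pd i f x ^ 2 :=
  continuous_finsetSum _ fun _ _ =>
    (((hf.continuous_fderiv one_ne_zero).clm_apply continuous_const).pow 2)

lemma IsPoincareSet.image_rect {Ω : Set E2} (hΩ : IsPlaneDomain Ω) {Ψ a b : ℝ × ℝ → E2}
    (h : ∀ r, HasFDerivAt Ψ ((ContinuousLinearMap.fst ℝ ℝ ℝ).smulRight (a r) +
      (ContinuousLinearMap.snd ℝ ℝ ℝ).smulRight (b r)) r)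
    (ha : Continuous a) (hb : Continuous b) (ha1 : ∀ r, ‖a r‖ ≤ 1) (hb1 : ∀ r, ‖b r‖ ≤ 1)
    {x₀ x₁ y₀ y₁ : ℝ} (hx : x₀ < x₁) (hy : y₀ < y₁)
    (hinj : Set.InjOn Ψ (Set.Ioo x₀ x₁ ×ˢ Set.Ioo y₀ y₁))
    (hD : ∀ r ∈ Set.Ioo x₀ x₁ ×ˢ Set.Ioo y₀ y₁, 1 / 2 ≤ |crs (a r) (b r)|)
    (hD1 : ∀ r, |crs (a r) (b r)| ≤ 1)
    (ho : IsOpen (Ψ '' (Set.Ioo x₀ x₁ ×ˢ Set.Ioo y₀ y₁)))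
    (hsub : Ψ '' (Set.Ioo x₀ x₁ ×ˢ Set.Ioo y₀ y₁) ⊆ Ω) :
    IsPoincareSet Ω (Ψ '' (Set.Ioo x₀ x₁ ×ˢ Set.Ioo y₀ y₁)) := by
  set S := Set.Ioo x₀ x₁ ×ˢ Set.Ioo y₀ y₁
  have hS : MeasurableSet S := measurableSet_Ioo.prod measurableSet_Ioo
  have hΨ : Continuous Ψ := continuous_iff_continuousAt.2 fun r => (h r).continuousAt
  have hcrs : Continuous fun r => |crs (a r) (b r)| := by
    unfold crs
    fun_prop
  refine ⟨ho, hsub, 2 * (2 * (x₁ - x₀) ^ 2 + 2 * (y₁ - y₀) ^ 2), by positivity, fun f hf => ?_⟩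
  have hfd : Continuous (fderiv ℝ f) := hf.continuous_fderiv one_ne_zero
  have hG := continuous_sum_pd_sq hf
  set G := fun x => ∑ i, pd i f x ^ 2 with hGdef
  have hG0 : ∀ x, 0 ≤ G x := fun x => Finset.sum_nonneg fun i _ => sq_nonneg _
  have hd : ∀ r, HasFDerivAt (fun r => f (Ψ r)) _ r := fun r =>
    ((hf.differentiable one_ne_zero).differentiableAt (x := Ψ r)).hasFDerivAt.comp r (h r)
  have hds : ∀ s t : ℝ, HasDerivAt (fun s => f (Ψ (s, t))) (fderiv ℝ f (Ψ (s, t)) (a (s, t))) s := by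
    intro s t
    have := (hd (s, t)).comp_hasDerivAt s ((hasDerivAt_id s).prodMk (hasDerivAt_const s t))
    simpa [Function.comp_def] using this
  have hdt : ∀ s t : ℝ, HasDerivAt (fun t => f (Ψ (s, t))) (fderiv ℝ f (Ψ (s, t)) (b (s, t))) t := by
    intro s t
    have := (hd (s, t)).comp_hasDerivAt t ((hasDerivAt_const t s).prodMk (hasDerivAt_id t))
    simpa [Function.comp_def] using this
  have hFs : Continuous fun p : ℝ × ℝ => fderiv ℝ f (Ψ p) (a p) := (hfd.comp hΨ).clm_apply ha
  have hFt : Continuous fun p : ℝ × ℝ => fderiv ℝ f (Ψ p) (b p) := (hfd.comp hΨ).clm_apply hb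
  have hfΨ : Continuous fun p : ℝ × ℝ => f (Ψ p) := hf.continuous.comp hΨ
  obtain ⟨m, hm⟩ := exists_integral_sq_sub_le_rect hds hdt hfΨ hFs hFt hx hy
  refine ⟨m, ?_⟩
  rw [← setIntegral_rect (g := fun p => (f (Ψ p) - m) ^ 2)
      ((hfΨ.sub continuous_const).pow 2) hx.le hy.le,
    ← setIntegral_rect (g := fun p => fderiv ℝ f (Ψ p) (a p) ^ 2) (hFs.pow 2) hx.le hy.le,
    ← setIntegral_rect (g := fun p => fderiv ℝ f (Ψ p) (b p) ^ 2) (hFt.pow 2) hx.le hy.le] at hm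
  have e1 : ∫ x in Ψ '' S, (f x - m) ^ 2 ≤ ∫ r in S, (f (Ψ r) - m) ^ 2 := by
    rw [integral_image_eq hS (fun r _ => h r) hinj (fun x => (f x - m) ^ 2)]
    refine setIntegral_mono (integrableOn_rect (hcrs.mul ((hfΨ.sub continuous_const).pow 2)) _ _ _ _)
      (integrableOn_rect ((hfΨ.sub continuous_const).pow 2) _ _ _ _) fun r => ?_
    exact mul_le_of_le_one_left (sq_nonneg _) (hD1 r)
  have hGΨ : Continuous fun r => G (Ψ r) := hG.comp hΨ
  have e2 : ∀ v : ℝ × ℝ → E2, Continuous v → (∀ r, ‖v r‖ ≤ 1) →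
      ∫ r in S, fderiv ℝ f (Ψ r) (v r) ^ 2 ≤ ∫ r in S, G (Ψ r) := fun v hv hv1 =>
    setIntegral_mono (integrableOn_rect (((hfd.comp hΨ).clm_apply hv).pow 2) _ _ _ _)
      (integrableOn_rect hGΨ _ _ _ _) fun r => fderiv_sq_le (hv1 r)
  have e3 : ∫ r in S, G (Ψ r) ≤ 2 * ∫ x in Ω, G x := by
    have : ∫ x in Ψ '' S, G x ≤ ∫ x in Ω, G x :=
      setIntegral_mono_set (hΩ.integrableOn hG.continuousOn)
        (Filter.Eventually.of_forall hG0) (Filter.Eventually.of_forall hsub)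
    rw [integral_image_eq hS (fun r _ => h r) hinj G] at this
    have h2 : ∫ r in S, G (Ψ r) ≤ ∫ r in S, 2 * (|crs (a r) (b r)| * G (Ψ r)) := by
      refine setIntegral_mono_on (integrableOn_rect hGΨ _ _ _ _)
        (integrableOn_rect (continuous_const.mul (hcrs.mul hGΨ)) _ _ _ _) hS fun r hr => ?_
      nlinarith [hD r hr, hG0 (Ψ r)]
    rw [integral_const_mul] at h2
    linarith
  have e4 := e2 a ha ha1
  have e5 := e2 b hb hb1
  have p1 : 0 ≤ 2 * (x₁ - x₀) ^ 2 := by positivity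
  have p2 : 0 ≤ 2 * (y₁ - y₀) ^ 2 := by positivity
  have := mul_le_mul_of_nonneg_left (e4.trans e3) p1
  have := mul_le_mul_of_nonneg_left (e5.trans e3) p2
  linarith

lemma abs_crs_le_one {x y : E2} (hx : ‖x‖ = 1) (hy : ‖y‖ = 1) : |crs x y| ≤ 1 := by
  have h1 := E2.sq_add_sq hx
  have h2 := E2.sq_add_sq hy
  have h3 : crs x y ^ 2 + (x 0 * y 0 + x 1 * y 1) ^ 2 =
    (x 0 * x 0 + x 1 * x 1) * (y 0 * y 0 + y 1 * y 1) := by unfold crs; ring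
  rw [h1, h2] at h3
  exact abs_le_one_iff_mul_self_le_one.2 (by nlinarith [sq_nonneg (x 0 * y 0 + x 1 * y 1)])

namespace IsPlaneDomain

variable {Ω : Set E2}

lemma exists_isPoincareSet_of_mem (hΩ : IsPlaneDomain Ω) {p : E2} (hp : p ∈ Ω) :
    ∃ N : Set E2, IsOpen N ∧ p ∈ N ∧ IsPoincareSet Ω (N ∩ Ω) := by
  obtain ⟨ε, hε, hball⟩ := Metric.isOpen_iff.1 hΩ.isOpen p hp
  set e₀ : E2 := EuclideanSpace.single 0 1
  set e₁ : E2 := EuclideanSpace.single 1 1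
  have n0 : ‖e₀‖ = 1 := by simp [e₀]
  have n1 : ‖e₁‖ = 1 := by simp [e₁]
  have hc : crs e₀ e₁ = 1 := by simp [crs, e₀, e₁]
  set Ψ : ℝ × ℝ → E2 := fun r => p + (r.1 • e₀ + r.2 • e₁) with hΨ
  have hΨ0 : ∀ r, Ψ r 0 = p 0 + r.1 := fun r => by simp [Ψ, e₀, e₁]
  have hΨ1 : ∀ r, Ψ r 1 = p 1 + r.2 := fun r => by simp [Ψ, e₀, e₁]
  set S : Set (ℝ × ℝ) := Set.Ioo (-(ε / 2)) (ε / 2) ×ˢ Set.Ioo (-(ε / 2)) (ε / 2) with hS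
  have himg : Ψ '' S = {x : E2 | x 0 - p 0 ∈ Set.Ioo (-(ε / 2)) (ε / 2) ∧
      x 1 - p 1 ∈ Set.Ioo (-(ε / 2)) (ε / 2)} := by
    ext x
    constructor
    · rintro ⟨r, hr, rfl⟩
      change _ ∧ _
      rw [hΨ0, hΨ1, add_sub_cancel_left, add_sub_cancel_left]
      exact hr
    · intro hx
      refine ⟨(x 0 - p 0, x 1 - p 1), hx, ?_⟩
      ext i
      fin_cases i
      · simp [hΨ0]
      · simp [hΨ1]
  have ho : IsOpen (Ψ '' S) := by
    rw [himg]
    exact (isOpen_Ioo.preimage (by fun_prop)).inter (isOpen_Ioo.preimage (by fun_prop))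
  have hsub : Ψ '' S ⊆ Ω := by
    rintro _ ⟨r, hr, rfl⟩
    refine hball ?_
    rw [mem_ball_iff_norm, hΨ, add_sub_cancel_left]
    refine (norm_add_le _ _).trans_lt ?_
    rw [norm_smul, norm_smul, n0, n1, mul_one, mul_one, Real.norm_eq_abs, Real.norm_eq_abs]
    have := abs_lt.2 hr.1
    have := abs_lt.2 hr.2
    linarith
  refine ⟨Ψ '' S, ho, ⟨0, ⟨by simp [hε], by simp [hε]⟩, by simp [Ψ]⟩, ?_⟩
  rw [Set.inter_eq_left.2 hsub]
  refine IsPoincareSet.image_rect hΩ (a := fun _ => e₀) (b := fun _ => e₁) (fun r => ?_)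
    continuous_const continuous_const (fun _ => n0.le) (fun _ => n1.le) (by linarith) (by linarith)
    ?_ (fun _ _ => by rw [hc]; norm_num) (fun _ => by rw [hc]; norm_num) ho hsub
  · exact (((hasFDerivAt_fst (𝕜 := ℝ) (p := r)).smul_const e₀).add
      ((hasFDerivAt_snd (𝕜 := ℝ) (p := r)).smul_const e₁)).const_add p
  · intro r _ r' _ h
    have h0 := congrArg (fun x : E2 => x 0) h
    have h1 := congrArg (fun x : E2 => x 1) h
    simp only [hΨ0, hΨ1] at h0 h1
    exact Prod.ext (by linarith) (by linarith)

lemma exists_isPoincareSet_of_boundary (hΩ : IsPlaneDomain Ω) {B : BoundaryParam Ω}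
    (hB : B.IsSmooth) (s₀ : ℝ) :
    ∃ N : Set E2, IsOpen N ∧ B.q s₀ ∈ N ∧ IsPoincareSet Ω (N ∩ Ω) := by
  obtain ⟨δ, hP⟩ := BoundaryParam.exists_isPatch hΩ hB s₀
  have hδ := hP.pos
  have hopen := hP.isOpen_image _ subset_rfl (BoundaryParam.isOpen_box s₀ δ)
  refine ⟨B.chart s₀ '' BoundaryParam.box s₀ δ, hopen,
    ⟨(s₀, 0), ⟨by simp [hδ], by simp [hδ]⟩, by simp [BoundaryParam.chart]⟩, ?_⟩
  set S : Set (ℝ × ℝ) := Set.Ioo (s₀ - δ) (s₀ + δ) ×ˢ Set.Ioo 0 δ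
  have hSb : S ⊆ BoundaryParam.box s₀ δ := fun r hr => ⟨hr.1, by linarith [hr.2.1], hr.2.2⟩
  have himg : B.chart s₀ '' BoundaryParam.box s₀ δ ∩ Ω = B.chart s₀ '' S := by
    ext x
    constructor
    · rintro ⟨⟨r, hr, rfl⟩, hx⟩
      exact ⟨r, ⟨hr.1, (hP.mem_iff r hr).1 hx, hr.2.2⟩, rfl⟩
    · rintro ⟨r, hr, rfl⟩
      exact ⟨⟨r, hSb hr, rfl⟩, (hP.mem_iff r (hSb hr)).2 hr.2.1⟩
  rw [himg]
  refine IsPoincareSet.image_rect hΩ (B.hasFDerivAt_chart s₀) (hB.continuous_qd.comp continuous_fst)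
    continuous_const (fun r => (B.unitSpeed _).le) (fun r => (B.ν_unit _).le) (by linarith) hδ
    (hP.injOn.mono hSb) (fun r hr => ?_) (fun r => abs_crs_le_one (B.unitSpeed _) (B.ν_unit _))
    (himg ▸ hopen.inter hΩ.isOpen) (himg ▸ Set.inter_subset_right)
  have h1 := hP.half_le r.1 hr.1
  obtain ⟨b0, b1⟩ := B.ν_eq s₀
  have h2 : crs (B.qd r.1) (B.ν s₀) = crs (B.qd s₀) (B.ν s₀) * ⟪B.qd s₀, B.qd r.1⟫ := by
    rw [E2.inner_eq]
    conv_lhs => unfold crs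
    rw [b0, b1]
    ring
  have h3 : |crs (B.qd s₀) (B.ν s₀)| = 1 := by
    rw [← sq_eq_sq₀ (abs_nonneg _) zero_le_one, sq_abs, B.crs_sq, one_pow]
  change 1 / 2 ≤ |crs (B.qd r.1) (B.ν s₀)|
  rw [h2, abs_mul, h3, one_mul]
  exact h1.trans (le_abs_self _)

lemma _root_.IsPoincareSet.union {U V : Set E2} (hΩ : IsPlaneDomain Ω) (hU : IsPoincareSet Ω U)
    (hV : IsPoincareSet Ω V) (h : (U ∩ V).Nonempty) : IsPoincareSet Ω (U ∪ V) := by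
  obtain ⟨A, hA, hA'⟩ := hU.exists_le
  obtain ⟨A', hA2, hA2'⟩ := hV.exists_le
  have hfin : volume V ≠ ⊤ :=
    (measure_mono hV.subset).trans_lt hΩ.isBounded.measure_lt_top |>.ne
  set κ := volume.real (U ∩ V)
  have hκ : 0 < κ := by
    refine ENNReal.toReal_pos ((hU.isOpen.inter hV.isOpen).measure_pos _ h).ne' ?_
    exact ((measure_mono Set.inter_subset_right).trans_lt hfin.lt_top).ne
  set v := volume.real V
  have hv : 0 ≤ v := measureReal_nonneg
  refine ⟨hU.isOpen.union hV.isOpen, Set.union_subset hU.subset hV.subset,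
    A + 2 * A' + 2 * v / κ * (2 * A + 2 * A'), by positivity, fun f hf => ?_⟩
  obtain ⟨m, hm⟩ := hA' f hf
  obtain ⟨m', hm'⟩ := hA2' f hf
  set D := ∫ x in Ω, ∑ i, pd i f x ^ 2
  refine ⟨m, ?_⟩
  have hsqi : ∀ (W : Set E2) (c : ℝ), W ⊆ Ω → IntegrableOn (fun x => (f x - c) ^ 2) W :=
    fun W c hW => (hΩ.integrableOn
      ((hf.continuous.sub continuous_const).pow 2).continuousOn).mono_set hW
  have hle : ∀ (W W' : Set E2) (c : ℝ), W ⊆ W' → W' ⊆ Ω →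
      ∫ x in W, (f x - c) ^ 2 ≤ ∫ x in W', (f x - c) ^ 2 := fun W W' c h h' =>
    setIntegral_mono_set (hsqi W' c h') (Filter.Eventually.of_forall fun _ => sq_nonneg _)
      (Filter.Eventually.of_forall h)
  have hc : ∀ (W : Set E2) (c : ℝ), volume W ≠ ⊤ → IntegrableOn (fun _ => c) W := fun W c hW =>
    integrableOn_const hW
  have hfin' : volume (U ∩ V) ≠ ⊤ := ((measure_mono Set.inter_subset_right).trans_lt hfin.lt_top).ne
  have hUV : U ∩ V ⊆ Ω := Set.inter_subset_left.trans hU.subset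
  have e1 : ∫ x in U ∪ V, (f x - m) ^ 2 ≤ (∫ x in U, (f x - m) ^ 2) + ∫ x in V, (f x - m) ^ 2 := by
    rw [← Set.union_sdiff_self,
      setIntegral_union Set.disjoint_sdiff_right (hV.isOpen.measurableSet.diff hU.isOpen.measurableSet)
        (hsqi U m hU.subset) (hsqi _ m (Set.sdiff_subset.trans hV.subset))]
    refine add_le_add_right ?_ _
    exact hle _ _ _ Set.sdiff_subset hV.subset
  have e2 : ∫ x in V, (f x - m) ^ 2 ≤ 2 * (∫ x in V, (f x - m') ^ 2) + 2 * (m - m') ^ 2 * v := by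
    have : ∫ x in V, (f x - m) ^ 2 ≤ ∫ x in V, (2 * (f x - m') ^ 2 + 2 * (m - m') ^ 2) :=
      setIntegral_mono (hsqi V m hV.subset) (((hsqi V m' hV.subset).const_mul _).add (hc V _ hfin))
        fun x => by nlinarith [sq_nonneg ((f x - m') + (m - m'))]
    rwa [integral_add ((hsqi V m' hV.subset).const_mul _) (hc V _ hfin), integral_const_mul,
      setIntegral_const, smul_eq_mul, mul_comm (volume.real V)] at this
  have e3 : (m - m') ^ 2 * κ ≤ 2 * (∫ x in U, (f x - m) ^ 2) + 2 * ∫ x in V, (f x - m') ^ 2 := by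
    have : ∫ x in U ∩ V, (m - m') ^ 2 ≤
        ∫ x in U ∩ V, (2 * (f x - m) ^ 2 + 2 * (f x - m') ^ 2) :=
      setIntegral_mono (hc _ _ hfin')
        (((hsqi _ m hUV).const_mul _).add ((hsqi _ m' hUV).const_mul _))
        fun x => by nlinarith [sq_nonneg ((f x - m) + (f x - m'))]
    rw [integral_add ((hsqi _ m hUV).const_mul _) ((hsqi _ m' hUV).const_mul _), integral_const_mul,
      integral_const_mul, setIntegral_const, smul_eq_mul, mul_comm (volume.real _)] at this
    have := hle (U ∩ V) U m Set.inter_subset_left hU.subset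
    have := hle (U ∩ V) V m' Set.inter_subset_right hV.subset
    linarith
  have e4 : (m - m') ^ 2 ≤ (2 * A + 2 * A') * D / κ := by
    rw [le_div_iff₀ hκ]
    linarith
  have e5 := mul_le_mul_of_nonneg_right e4 hv
  calc _ ≤ A * D + (2 * (A' * D) + 2 * ((2 * A + 2 * A') * D / κ * v)) := by linarith
    _ = _ := by ring

/-- The Poincaré inequality on a smooth bounded domain. -/
lemma isPoincareSet_self (hΩ : IsPlaneDomain Ω) {B : BoundaryParam Ω} (hB : B.IsSmooth) :
    IsPoincareSet Ω Ω := by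
  have hloc : ∀ p ∈ closure Ω, ∃ N : Set E2, IsOpen N ∧ p ∈ N ∧ IsPoincareSet Ω (N ∩ Ω) := by
    intro p hp
    by_cases h : p ∈ Ω
    · exact hΩ.exists_isPoincareSet_of_mem h
    · have : p ∈ frontier Ω := ⟨hp, by rwa [hΩ.isOpen.interior_eq]⟩
      rw [← B.range_eq] at this
      obtain ⟨s, rfl⟩ := this
      exact hΩ.exists_isPoincareSet_of_boundary hB s
  choose! N hNo hpN hN using hloc
  obtain ⟨T, hT, hcov⟩ := hΩ.isCompact_closure.elim_nhds_subcover N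
    fun p hp => (hNo p hp).mem_nhds (hpN p hp)
  have hne : ∀ p ∈ T, (N p ∩ Ω).Nonempty := fun p hp =>
    mem_closure_iff.1 (hT p hp) _ (hNo p (hT p hp)) (hpN p (hT p hp))
  have hcov' : ∀ x ∈ Ω, ∃ p ∈ T, x ∈ N p := fun x hx => by
    simpa using hcov (subset_closure hx)
  classical
  set W : Finset E2 → Set E2 := fun T' => ⋃ p ∈ T', N p ∩ Ω with hW
  obtain ⟨x₀, hx₀⟩ := hΩ.isConnected.nonempty
  obtain ⟨p₀, hp₀, -⟩ := hcov' x₀ hx₀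
  obtain ⟨T', hT', hmax⟩ := (T.powerset.filter fun T' => T'.Nonempty ∧
      IsPoincareSet Ω (W T')).exists_max_image Finset.card
    ⟨{p₀}, by simp [hW, hp₀, hN p₀ (hT p₀ hp₀)]⟩
  simp only [Finset.mem_filter, Finset.mem_powerset] at hT' hmax
  obtain ⟨hTT, hTne, hP⟩ := hT'
  have hdich : ∀ p ∈ T, p ∉ T' → N p ∩ Ω ∩ W T' = ∅ := by
    intro p hp hpT
    by_contra hcon
    have hU := IsPoincareSet.union hΩ (hN p (hT p hp)) hP (Set.nonempty_iff_ne_empty.2 hcon)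
    have := hmax (insert p T') ⟨Finset.insert_subset hp hTT, Finset.insert_nonempty _ _, by
      simpa [hW, Finset.set_biUnion_insert] using hU⟩
    rw [Finset.card_insert_of_notMem hpT] at this
    omega
  have hV : IsOpen (⋃ p ∈ T \ T', N p ∩ Ω) := isOpen_biUnion fun p hp =>
    (hN p (hT p (Finset.mem_sdiff.1 hp).1)).isOpen
  have hsub : Ω ⊆ W T' ∪ ⋃ p ∈ T \ T', N p ∩ Ω := by
    intro x hx
    obtain ⟨p, hp, hxp⟩ := hcov' x hx
    by_cases h : p ∈ T'
    · exact Or.inl (Set.mem_biUnion h ⟨hxp, hx⟩)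
    · exact Or.inr (Set.mem_biUnion (Finset.mem_sdiff.2 ⟨hp, h⟩) ⟨hxp, hx⟩)
  obtain ⟨p₁, hp₁⟩ := hTne
  have hWne : (Ω ∩ W T').Nonempty := by
    obtain ⟨x, hx⟩ := hne p₁ (hTT hp₁)
    exact ⟨x, hx.2, Set.mem_biUnion hp₁ hx⟩
  have hΩW : Ω ⊆ W T' := by
    refine hΩ.isConnected.isPreconnected.subset_left_of_subset_union hP.isOpen hV ?_ hsub hWne
    rw [Set.disjoint_iUnion₂_right]
    intro p hp
    rw [Finset.mem_sdiff] at hp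
    exact (Set.disjoint_iff_inter_eq_empty.2 (hdich p hp.1 hp.2)).symm
  rwa [hP.subset.antisymm hΩW] at hP

/-- Neumann eigenvalues are bounded away from zero. -/
lemma exists_forall_le (hΩ : IsPlaneDomain Ω) {B : BoundaryParam Ω} (hB : B.IsSmooth) :
    ∃ A > (0 : ℝ), ∀ (lam : ℝ) (φ : E2 → ℝ), 0 < lam → IsSmoothNeumann B lam φ →
      (∃ x ∈ Ω, φ x ≠ 0) → 1 ≤ A * lam ^ 2 := by
  obtain ⟨A, hA, h⟩ := (hΩ.isPoincareSet_self hB).exists_le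
  refine ⟨A + 1, by positivity, fun lam φ hlam hφ hne => ?_⟩
  obtain ⟨m, hm⟩ := h φ (hφ.smooth.of_le one_le_two)
  rw [hφ.integral_grad_sq hΩ hB] at hm
  have h0 := hφ.integral_eq_zero hΩ hB hlam
  have hc : Continuous φ := hφ.smooth.continuous
  have hi := hΩ.integrableOn hc.continuousOn
  have hi2 : IntegrableOn (fun x => φ x ^ 2) Ω := hΩ.integrableOn (hc.pow 2).continuousOn
  have e : ∫ x in Ω, φ x ^ 2 ≤ ∫ x in Ω, (φ x - m) ^ 2 := by
    have : ∫ x in Ω, (φ x ^ 2 - 2 * m * φ x) ≤ ∫ x in Ω, (φ x - m) ^ 2 :=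
      setIntegral_mono (hi2.sub (hi.const_mul _))
        (hΩ.integrableOn ((hc.sub continuous_const).pow 2).continuousOn)
        fun x => by nlinarith [sq_nonneg m]
    rwa [integral_sub hi2 (hi.const_mul _), integral_const_mul, h0, mul_zero, sub_zero] at this
  have hpos : 0 < ∫ x in Ω, φ x ^ 2 := by
    obtain ⟨x, hx, hx0⟩ := hne
    refine (setIntegral_pos_iff_support_of_nonneg_ae
      (Filter.Eventually.of_forall fun x => sq_nonneg (φ x)) hi2).2 ?_
    have hop : IsOpen (Function.support (fun x => φ x ^ 2) ∩ Ω) :=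
      ((hc.pow 2).isOpen_support).inter hΩ.isOpen
    exact hop.measure_pos _ ⟨x, by simpa using hx0, hx⟩
  nlinarith [mul_nonneg (sq_nonneg lam) hpos.le]

end IsPlaneDomain

/-! ### The fundamental solution and the representation formula -/

/-- The real function `w ↦ ∑ γₖ (μ w)ᵏ`. -/
def rseries (γ : ℕ → ℝ) (μ w : ℝ) : ℝ := (pseries γ ((μ * w : ℝ) : ℂ)).re

lemma ofReal_rseries (γ : ℕ → ℝ) (μ w : ℝ) :
    ((rseries γ μ w : ℝ) : ℂ) = pseries γ (μ * w) := by
  rw [rseries, ofReal_re_pseries, Complex.ofReal_mul]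

lemma BesselType.hasDerivAt_rseries {γ : ℕ → ℝ} {K : ℝ} (h : BesselType γ K) (μ w : ℝ) :
    HasDerivAt (rseries γ μ) (μ * rseries (_root_.dcoeff γ) μ w) w := by
  have h1 := (h.hasDerivAt_pseries ((μ * w : ℝ) : ℂ)).real_of_complex
  have h2 : HasDerivAt (fun w : ℝ => μ * w) μ w := by
    simpa using (hasDerivAt_id w).const_mul μ
  have := h1.comp w h2
  rwa [mul_comm] at this

lemma BesselType.contDiff_rseries {γ : ℕ → ℝ} {K : ℝ} (h : BesselType γ K) (μ : ℝ) {n : ℕ∞} :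
    ContDiff ℝ n (rseries γ μ) := by
  have h1 : ContDiff ℝ n (pseries γ) := (h.differentiable_pseries.contDiff).restrict_scalars ℝ
  exact (Complex.reCLM.contDiff.comp (h1.comp Complex.ofRealCLM.contDiff)).comp
    (contDiff_const.mul contDiff_id)

lemma BesselType.continuous_rseries {γ : ℕ → ℝ} {K : ℝ} (h : BesselType γ K) (μ : ℝ) :
    Continuous (rseries γ μ) := (h.contDiff_rseries μ (n := 0)).continuous

lemma rseries_coeffA_zero (μ : ℝ) : rseries coeffA μ 0 = 1 := by
  rw [rseries, pseries, tsum_eq_single 0]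
  · simp [coeffA]
  · intro k hk
    simp [hk]

lemma rseries_coeffA_ode (μ w : ℝ) : w * (μ * (μ * rseries (dcoeff (dcoeff coeffA)) μ w)) +
    μ * rseries (dcoeff coeffA) μ w + μ * rseries coeffA μ w = 0 := by
  have h := pseries_coeffA_ode (μ * w)
  simp only [← ofReal_rseries] at h
  have h' : μ * w * rseries (dcoeff (dcoeff coeffA)) μ w +
    rseries (dcoeff coeffA) μ w + rseries coeffA μ w = 0 := by exact_mod_cast h
  linear_combination μ * h'

lemma rseries_coeffB_ode (μ w : ℝ) : w * (μ * (μ * rseries (dcoeff (dcoeff coeffB)) μ w)) +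
    μ * rseries (dcoeff coeffB) μ w + μ * rseries coeffB μ w =
    -2 * (μ * rseries (dcoeff coeffA) μ w) := by
  have h := pseries_coeffB_ode (μ * w)
  simp only [← ofReal_rseries] at h
  have h' : μ * w * rseries (dcoeff (dcoeff coeffB)) μ w +
    rseries (dcoeff coeffB) μ w + rseries coeffB μ w = -2 * rseries (dcoeff coeffA) μ w := by
      exact_mod_cast h
  linear_combination μ * h'

lemma hasFDerivAt_norm_sub_sq (x y : E2) :
    HasFDerivAt (fun y : E2 => ‖y - x‖ ^ 2) ((2 : ℝ) • innerSL ℝ (y - x)) y := by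
  have := ((hasFDerivAt_id y).sub_const x).norm_sq
  refine this.congr_fderiv ?_
  ext v
  simp

lemma fderiv_radial {g : ℝ → ℝ} {g' : ℝ} {x y : E2} (h : HasDerivAt g g' (‖y - x‖ ^ 2)) (v : E2) :
    fderiv ℝ (fun y => g (‖y - x‖ ^ 2)) y v = g' * (2 * ⟪y - x, v⟫) := by
  have := h.comp_hasFDerivAt y (hasFDerivAt_norm_sub_sq x y)
  rw [show (fun y => g (‖y - x‖ ^ 2)) = g ∘ fun y => ‖y - x‖ ^ 2 from rfl, this.fderiv]
  simp [inner_sub_left]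

lemma lap_radial {g g' g'' : ℝ → ℝ} (h : ∀ w, 0 ≤ w → HasDerivAt g (g' w) w)
    (h' : ∀ w, 0 ≤ w → HasDerivAt g' (g'' w) w) (x y : E2) :
    lap (fun y => g (‖y - x‖ ^ 2)) y =
      4 * (‖y - x‖ ^ 2 * g'' (‖y - x‖ ^ 2) + g' (‖y - x‖ ^ 2)) := by
  have h1 : ∀ i, pd i (fun y => g (‖y - x‖ ^ 2)) = fun y => g' (‖y - x‖ ^ 2) * (2 * (y i - x i)) := by
    intro i
    funext y
    rw [pd, fderiv_radial (h _ (sq_nonneg _))]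
    simp [EuclideanSpace.inner_single_right]
  have h2 : ∀ i, pd i (pd i (fun y => g (‖y - x‖ ^ 2))) y =
      g' (‖y - x‖ ^ 2) * 2 + g'' (‖y - x‖ ^ 2) * (2 * (y i - x i)) * (2 * (y i - x i)) := by
    intro i
    have hd1 := (h' _ (sq_nonneg _)).comp_hasFDerivAt y (hasFDerivAt_norm_sub_sq x y)
    have hd2 : HasFDerivAt (fun y : E2 => 2 * (y i - x i)) ((2 : ℝ) • EuclideanSpace.proj i) y :=
      (((EuclideanSpace.proj i : E2 →L[ℝ] ℝ).hasFDerivAt).sub_const (x i)).const_mul 2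
    rw [h1 i, pd_mul (f := fun y => g' (‖y - x‖ ^ 2)) hd1.differentiableAt hd2.differentiableAt]
    congr 1
    · rw [pd, hd2.fderiv]
      simp
    · rw [pd, fderiv_radial (h' _ (sq_nonneg _))]
      simp [EuclideanSpace.inner_single_right]
  have h3 : ‖y - x‖ ^ 2 = (y 0 - x 0) * (y 0 - x 0) + (y 1 - x 1) * (y 1 - x 1) := by
    rw [← real_inner_self_eq_norm_sq, E2.inner_eq]
    simp
  rw [lap_eq, Fin.sum_univ_two, h2, h2]
  generalize g'' (‖y - x‖ ^ 2) = u
  rw [h3]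
  ring

/-- The regularized fundamental solution of the Helmholtz equation in the squared distance. -/
def regFund (μ e w : ℝ) : ℝ := Real.log (w + e) * rseries coeffA μ w + rseries coeffB μ w

/-- The derivative of `regFund` in the squared distance. -/
def regFund' (μ e w : ℝ) : ℝ := rseries coeffA μ w / (w + e) +
  Real.log (w + e) * (μ * rseries (dcoeff coeffA) μ w) + μ * rseries (dcoeff coeffB) μ w

lemma contDiff_regFund (μ : ℝ) {e : ℝ} (he : 0 < e) (x : E2) :
    ContDiff ℝ 2 fun y : E2 => regFund μ e (‖y - x‖ ^ 2) := by
  have h1 : ContDiff ℝ 2 fun y : E2 => ‖y - x‖ ^ 2 := (contDiff_id.sub contDiff_const).norm_sq ℝ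
  have h2 := (besselType_coeffA.contDiff_rseries μ (n := 2)).comp h1
  have h3 := (besselType_coeffB.contDiff_rseries μ (n := 2)).comp h1
  exact (((h1.add contDiff_const).log fun y => by positivity).mul h2).add h3

lemma hasDerivAt_regFund (μ : ℝ) {e w : ℝ} (h : 0 < w + e) :
    HasDerivAt (regFund μ e) (regFund' μ e w) w := by
  have hl : HasDerivAt (fun w => Real.log (w + e)) (1 / (w + e)) w :=
    ((hasDerivAt_id w).add_const e).log h.ne'
  have := (hl.mul (besselType_coeffA.hasDerivAt_rseries μ w)).add
    (besselType_coeffB.hasDerivAt_rseries μ w)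
  refine this.congr_deriv ?_
  rw [regFund']
  ring

lemma lap_regFund_add (μ : ℝ) {e : ℝ} (he : 0 < e) (x y : E2) :
    lap (fun y => regFund μ e (‖y - x‖ ^ 2)) y + 4 * μ * regFund μ e (‖y - x‖ ^ 2) =
      4 * rseries coeffA μ (‖y - x‖ ^ 2) * (e / (‖y - x‖ ^ 2 + e) ^ 2) -
      8 * (μ * rseries (dcoeff coeffA) μ (‖y - x‖ ^ 2)) * (e / (‖y - x‖ ^ 2 + e)) := by
  have hd : ∀ w, 0 ≤ w → HasDerivAt (regFund' μ e)
      (-rseries coeffA μ w / (w + e) ^ 2 + 2 * (μ * rseries (dcoeff coeffA) μ w) / (w + e) +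
        Real.log (w + e) * (μ * (μ * rseries (dcoeff (dcoeff coeffA)) μ w)) +
        μ * (μ * rseries (dcoeff (dcoeff coeffB)) μ w)) w := by
    intro w hw
    have h : 0 < w + e := by positivity
    have hi := (hasDerivAt_id w).add_const e
    have hl : HasDerivAt (fun w => Real.log (w + e)) (1 / (w + e)) w := hi.log h.ne'
    have := (((besselType_coeffA.hasDerivAt_rseries μ w).div hi h.ne').add
      (hl.mul ((besselType_coeffA.dcoeff.hasDerivAt_rseries μ w).const_mul μ))).add
      ((besselType_coeffB.dcoeff.hasDerivAt_rseries μ w).const_mul μ)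
    refine this.congr_deriv ?_
    simp only [id]
    field_simp
    ring
  rw [lap_radial (fun w hw => hasDerivAt_regFund μ (by positivity)) hd]
  have hw : 0 < ‖y - x‖ ^ 2 + e := by positivity
  generalize ‖y - x‖ ^ 2 = w at *
  have hA := rseries_coeffA_ode μ w
  have hB := rseries_coeffB_ode μ w
  rw [regFund, regFund']
  generalize Real.log (w + e) = l
  generalize rseries coeffA μ w = A at *
  generalize rseries coeffB μ w = B at *
  generalize rseries (dcoeff coeffA) μ w = A' at *
  generalize rseries (dcoeff coeffB) μ w = B' at *
  generalize rseries (dcoeff (dcoeff coeffA)) μ w = A'' at *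
  generalize rseries (dcoeff (dcoeff coeffB)) μ w = B'' at *
  have key : 4 * (w * (-A / (w + e) ^ 2 + 2 * (μ * A') / (w + e)) + A / (w + e)) - 8 * (μ * A') =
      4 * A * (e / (w + e) ^ 2) - 8 * (μ * A') * (e / (w + e)) := by
    field_simp
    ring
  linear_combination 4 * l * hA + 4 * hB + key

section Representation

variable {Ω : Set E2} {B : BoundaryParam Ω} {lam : ℝ} {φ : E2 → ℝ}

lemma IsSmoothNeumann.regularized_representation (h : IsSmoothNeumann B lam φ)
    (hΩ : IsPlaneDomain Ω) (hB : B.IsSmooth) (x : E2) {e : ℝ} (he : 0 < e) :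
    ∫ y in Ω, φ y * (4 * rseries coeffA (lam ^ 2 / 4) (‖y - x‖ ^ 2) * (e / (‖y - x‖ ^ 2 + e) ^ 2) -
      8 * (lam ^ 2 / 4 * rseries (dcoeff coeffA) (lam ^ 2 / 4) (‖y - x‖ ^ 2)) *
        (e / (‖y - x‖ ^ 2 + e))) =
    -∫ s in (0 : ℝ)..B.len, φ (B.q s) *
      (regFund' (lam ^ 2 / 4) e (‖B.q s - x‖ ^ 2) * (2 * ⟪B.q s - x, B.ν s⟫)) := by
  have := h.green hΩ hB (contDiff_regFund (lam ^ 2 / 4) he x)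
  simp_rw [fun s : ℝ => fderiv_radial (x := x) (y := B.q s)
    (hasDerivAt_regFund (lam ^ 2 / 4) (by positivity : 0 < ‖B.q s - x‖ ^ 2 + e))] at this
  rw [← this]
  refine integral_congr_ae (Filter.Eventually.of_forall fun y => ?_)
  beta_reduce
  rw [← lap_regFund_add _ he]
  ring

end Representation

lemma integrable_inv_one_add_norm_sq_sq :
    Integrable fun z : E2 => 1 / (1 + ‖z‖ ^ 2) ^ 2 := by
  have h := integrable_rpow_neg_one_add_norm_sq (E := E2) (μ := volume) (r := 4)
    (by rw [finrank_euclideanSpace_fin]; norm_num)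
  refine h.congr (Filter.Eventually.of_forall fun z => ?_)
  norm_num

/-- The mass of the approximate identity. -/
def bumpMass : ℝ := ∫ z : E2, 1 / (1 + ‖z‖ ^ 2) ^ 2

lemma bumpMass_pos : 0 < bumpMass := by
  have hc : Continuous fun z : E2 => 1 / (1 + ‖z‖ ^ 2) ^ 2 :=
    continuous_const.div (by fun_prop) fun z => by positivity
  exact integral_pos_of_integrable_nonneg_nonzero (x := 0) hc integrable_inv_one_add_norm_sq_sq
    (fun z => by positivity) (by simp)

lemma tendsto_integral_bump {G : E2 → ℝ} {M : ℝ} (hG : Measurable G) (hM : ∀ y, |G y| ≤ M)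
    {x : E2} (hx : ContinuousAt G x) :
    Filter.Tendsto (fun r : ℝ => ∫ y, G y * (r ^ 2 / (‖y - x‖ ^ 2 + r ^ 2) ^ 2))
      (nhdsWithin 0 (Set.Ioi 0)) (nhds (bumpMass * G x)) := by
  have h1 : ∀ r : ℝ, 0 < r → ∫ y, G y * (r ^ 2 / (‖y - x‖ ^ 2 + r ^ 2) ^ 2) =
      ∫ z, G (x + r • z) * (1 / (1 + ‖z‖ ^ 2) ^ 2) := by
    intro r hr
    have e1 := integral_add_left_eq_self (μ := (volume : Measure E2))
      (fun y => G y * (r ^ 2 / (‖y - x‖ ^ 2 + r ^ 2) ^ 2)) x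
    have e2 := Measure.integral_comp_smul (volume : Measure E2)
      (fun y => G (x + y) * (r ^ 2 / (‖x + y - x‖ ^ 2 + r ^ 2) ^ 2)) r
    rw [← e1]
    have hfr : Module.finrank ℝ E2 = 2 := by simp
    rw [hfr, smul_eq_mul, abs_of_pos (by positivity)] at e2
    have e3 : ∫ y, G (x + y) * (r ^ 2 / (‖x + y - x‖ ^ 2 + r ^ 2) ^ 2) =
        r ^ 2 * ∫ y, G (x + r • y) * (r ^ 2 / (‖x + r • y - x‖ ^ 2 + r ^ 2) ^ 2) := by
      rw [e2, mul_inv_cancel_left₀ (by positivity)]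
    rw [e3, ← integral_const_mul]
    refine integral_congr_ae (Filter.Eventually.of_forall fun z => ?_)
    beta_reduce
    rw [add_sub_cancel_left, norm_smul, Real.norm_eq_abs, mul_pow, sq_abs]
    have : 0 < 1 + ‖z‖ ^ 2 := by positivity
    have h2 : r ^ 2 * ‖z‖ ^ 2 + r ^ 2 = r ^ 2 * (1 + ‖z‖ ^ 2) := by ring
    rw [h2]
    field_simp
  have h2 : bumpMass * G x = ∫ z : E2, G x * (1 / (1 + ‖z‖ ^ 2) ^ 2) := by
    rw [integral_const_mul, mul_comm, bumpMass]
  rw [h2]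
  refine Filter.Tendsto.congr'
    (f₁ := fun r : ℝ => ∫ z, G (x + r • z) * (1 / (1 + ‖z‖ ^ 2) ^ 2)) ?_ ?_
  · filter_upwards [self_mem_nhdsWithin] with r hr
    exact (h1 r hr).symm
  · refine tendsto_integral_filter_of_dominated_convergence
      (fun z => M * (1 / (1 + ‖z‖ ^ 2) ^ 2)) ?_ ?_ (integrable_inv_one_add_norm_sq_sq.const_mul M) ?_
    · refine Filter.Eventually.of_forall fun r => Measurable.aestronglyMeasurable ?_
      exact (hG.comp (by fun_prop)).mul (by fun_prop)
    · refine Filter.Eventually.of_forall fun r => Filter.Eventually.of_forall fun z => ?_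
      have : 0 ≤ 1 / (1 + ‖z‖ ^ 2) ^ 2 := by positivity
      rw [norm_mul, Real.norm_eq_abs, Real.norm_eq_abs, abs_of_nonneg this]
      gcongr
      exact hM _
    · refine Filter.Eventually.of_forall fun z => ?_
      refine Filter.Tendsto.mul_const _ ?_
      have hl : Filter.Tendsto (fun r : ℝ => x + r • z) (nhdsWithin 0 (Set.Ioi 0)) (nhds x) := by
        have : Continuous fun r : ℝ => x + r • z := by fun_prop
        simpa using (this.tendsto 0).mono_left nhdsWithin_le_nhds
      exact hx.tendsto.comp hl

lemma tendsto_integral_remainder {f : E2 → ℝ} {S : Set E2} (hf : IntegrableOn f S) (x : E2) :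
    Filter.Tendsto (fun r : ℝ => ∫ y in S, f y * (r ^ 2 / (‖y - x‖ ^ 2 + r ^ 2)))
      (nhdsWithin 0 (Set.Ioi 0)) (nhds 0) := by
  have h0 : (0 : ℝ) = ∫ y in S, (0 : ℝ) := by simp
  rw [h0]
  refine tendsto_integral_filter_of_dominated_convergence (fun y => |f y|) ?_ ?_ hf.abs ?_
  · refine Filter.Eventually.of_forall fun r => hf.aestronglyMeasurable.mul ?_
    exact Measurable.aestronglyMeasurable (by fun_prop)
  · refine Filter.Eventually.of_forall fun r => Filter.Eventually.of_forall fun y => ?_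
    have h1 : 0 ≤ r ^ 2 / (‖y - x‖ ^ 2 + r ^ 2) := by positivity
    have h2 : r ^ 2 / (‖y - x‖ ^ 2 + r ^ 2) ≤ 1 :=
      div_le_one_of_le₀ (by linarith [sq_nonneg ‖y - x‖]) (by positivity)
    rw [norm_mul, Real.norm_eq_abs, Real.norm_eq_abs, abs_of_nonneg h1]
    exact mul_le_of_le_one_right (abs_nonneg _) h2
  · refine ae_restrict_of_ae ?_
    filter_upwards [compl_mem_ae_iff.2 (measure_singleton (μ := (volume : Measure E2)) x)] with y hy
    have hy0 : 0 < ‖y - x‖ ^ 2 := by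
      have : 0 < ‖y - x‖ := norm_pos_iff.2 (sub_ne_zero.2 hy)
      positivity
    have : ContinuousAt (fun r : ℝ => f y * (r ^ 2 / (‖y - x‖ ^ 2 + r ^ 2))) 0 :=
      continuousAt_const.mul (ContinuousAt.div (by fun_prop) (by fun_prop) (by
        simpa using hy0.ne'))
    simpa using this.tendsto.mono_left nhdsWithin_le_nhds

namespace IsSmoothNeumann

variable {Ω : Set E2} {B : BoundaryParam Ω} {lam : ℝ} {φ : E2 → ℝ}

/-- Representation of an eigenfunction by its boundary values. -/
lemma representation (h : IsSmoothNeumann B lam φ)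
    (hΩ : IsPlaneDomain Ω) (hB : B.IsSmooth) {x : E2} (hx : x ∈ Ω) :
    4 * bumpMass * φ x = -∫ s in (0 : ℝ)..B.len, φ (B.q s) *
      (regFund' (lam ^ 2 / 4) 0 (‖B.q s - x‖ ^ 2) * (2 * ⟪B.q s - x, B.ν s⟫)) := by
  set μ := lam ^ 2 / 4
  have hφ : Continuous φ := h.smooth.continuous
  have hcA : Continuous fun y : E2 => rseries coeffA μ (‖y - x‖ ^ 2) :=
    (besselType_coeffA.continuous_rseries μ).comp (by fun_prop)
  have hcA' : Continuous fun y : E2 => rseries (dcoeff coeffA) μ (‖y - x‖ ^ 2) :=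
    (besselType_coeffA.dcoeff.continuous_rseries μ).comp (by fun_prop)
  set g : E2 → ℝ := fun y => φ y * rseries coeffA μ (‖y - x‖ ^ 2) with hg
  have hgc : Continuous g := hφ.mul hcA
  obtain ⟨M, hM⟩ := (hΩ.isCompact_closure.image hgc).isBounded.exists_norm_le
  have hM' : ∀ y ∈ Ω, |g y| ≤ M := fun y hy => hM _ (Set.mem_image_of_mem g (subset_closure hy))
  have hM0 : 0 ≤ M := (abs_nonneg _).trans (hM' x hx)
  have t1 := tendsto_integral_bump (G := Ω.indicator g) (M := M)
    (hgc.measurable.indicator hΩ.isOpen.measurableSet)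
    (fun y => by
      by_cases hy : y ∈ Ω
      · rw [Set.indicator_of_mem hy]; exact hM' y hy
      · rw [Set.indicator_of_notMem hy]; simpa using hM0)
    (x := x) (hgc.continuousAt.congr (by
      filter_upwards [hΩ.isOpen.mem_nhds hx] with y hy
      rw [Set.indicator_of_mem hy]))
  have hgx : Ω.indicator g x = φ x := by
    rw [Set.indicator_of_mem hx, hg]
    simp [rseries_coeffA_zero]
  have t2 := tendsto_integral_remainder (f := fun y => φ y * (μ * rseries (dcoeff coeffA) μ (‖y - x‖ ^ 2)))
    (hΩ.integrableOn (hφ.mul (continuous_const.mul hcA')).continuousOn) x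
  have t3 := (t1.const_mul 4).sub (t2.const_mul 8)
  have hpos : ∀ (r : ℝ) (s : ℝ), 0 < ‖B.q s - x‖ ^ 2 + r ^ 2 := by
    intro r s
    have : B.q s - x ≠ 0 := fun h0 => BoundaryParam.q_not_mem hΩ s (by rwa [sub_eq_zero.1 h0])
    have := norm_pos_iff.2 this
    positivity
  have t4 : Continuous fun r : ℝ => -∫ s in (0 : ℝ)..B.len, φ (B.q s) *
      (regFund' μ (r ^ 2) (‖B.q s - x‖ ^ 2) * (2 * ⟪B.q s - x, B.ν s⟫)) := by
    refine (intervalIntegral.continuous_parametric_intervalIntegral_of_continuous' ?_ _ _).neg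
    have hq := B.continuous_q
    have hw : Continuous fun p : ℝ × ℝ => ‖B.q p.2 - x‖ ^ 2 := by fun_prop
    have hwe : Continuous fun p : ℝ × ℝ => ‖B.q p.2 - x‖ ^ 2 + p.1 ^ 2 := by fun_prop
    have hν := hB.continuous_ν hΩ
    refine (hφ.comp (hq.comp continuous_snd)).mul (Continuous.mul ?_ (by fun_prop))
    exact ((((besselType_coeffA.continuous_rseries μ).comp hw).div hwe
      fun p => (hpos p.1 p.2).ne').add
      ((hwe.log fun p => (hpos p.1 p.2).ne').mul
        (continuous_const.mul ((besselType_coeffA.dcoeff.continuous_rseries μ).comp hw)))).add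
      (continuous_const.mul ((besselType_coeffB.dcoeff.continuous_rseries μ).comp hw))
  have t5 := (t4.tendsto 0).mono_left (nhdsWithin_le_nhds (s := Set.Ioi 0))
  rw [hgx] at t3
  have := tendsto_nhds_unique (t3.congr' ?_) t5
  · simpa [mul_assoc] using this
  · filter_upwards [self_mem_nhdsWithin] with r hr
    have hr : 0 < r := hr
    rw [← h.regularized_representation hΩ hB x (by positivity : 0 < r ^ 2)]
    have e1 : ∫ y, Ω.indicator g y * (r ^ 2 / (‖y - x‖ ^ 2 + r ^ 2) ^ 2) =
        ∫ y in Ω, g y * (r ^ 2 / (‖y - x‖ ^ 2 + r ^ 2) ^ 2) := by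
      rw [← integral_indicator hΩ.isOpen.measurableSet]
      refine integral_congr_ae (Filter.Eventually.of_forall fun y => ?_)
      by_cases hy : y ∈ Ω <;> simp [hy]
    rw [e1, ← integral_const_mul, ← integral_const_mul, ← integral_sub]
    · refine integral_congr_ae (Filter.Eventually.of_forall fun y => ?_)
      simp only [hg]
      ring
    · refine (hΩ.integrableOn (Continuous.continuousOn ?_)).const_mul 4
      exact hgc.mul (Continuous.div (by fun_prop) (by fun_prop) fun y => by positivity)
    · refine (hΩ.integrableOn (Continuous.continuousOn ?_)).const_mul 8
      exact (hφ.mul (continuous_const.mul hcA')).mul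
        (Continuous.div (by fun_prop) (by fun_prop) fun y => by positivity)

end IsSmoothNeumann

/-! ### Complexification of the boundary kernel -/

/-- The holomorphic extension of `regFund' μ 0`. -/
def cker (μ : ℝ) (w : ℂ) : ℂ := pseries coeffA (μ * w) / w +
  Complex.log w * (μ * pseries (dcoeff coeffA) (μ * w)) + μ * pseries (dcoeff coeffB) (μ * w)

lemma cker_ofReal (μ : ℝ) {w : ℝ} (hw : 0 ≤ w) : cker μ w = regFund' μ 0 w := by
  rw [cker, regFund', add_zero]
  push_cast
  rw [ofReal_rseries, ofReal_rseries, ofReal_rseries, Complex.ofReal_log hw]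

lemma differentiableAt_cker (μ : ℝ) {w : ℂ} (hw : 0 < w.re) : DifferentiableAt ℂ (cker μ) w := by
  have hs : w ∈ Complex.slitPlane := Or.inl hw
  have hl : ∀ {γ : ℕ → ℝ} {K : ℝ}, BesselType γ K →
      DifferentiableAt ℂ (fun w : ℂ => pseries γ (μ * w)) w := fun h =>
    (h.differentiable_pseries _).comp w (by fun_prop)
  exact (((hl besselType_coeffA).div differentiableAt_id (Complex.slitPlane_ne_zero hs)).add
    ((Complex.differentiableAt_log hs).mul
      ((hl besselType_coeffA.dcoeff).const_mul _))).add ((hl besselType_coeffB.dcoeff).const_mul _)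

lemma norm_log_le {η R : ℝ} (hη : 0 < η) {w : ℂ} (h1 : η ≤ ‖w‖) (h2 : ‖w‖ ≤ R) :
    ‖Complex.log w‖ ≤ max |Real.log η| |Real.log R| + π := by
  refine (Complex.norm_le_abs_re_add_abs_im _).trans (add_le_add ?_ ?_)
  · rw [Complex.log_re]
    exact abs_le_max_abs_abs (Real.log_le_log hη h1) (Real.log_le_log (hη.trans_le h1) h2)
  · rw [Complex.log_im]
    exact Complex.abs_arg_le_pi w

lemma exists_norm_cker_le {η R : ℝ} (hη : 0 < η) : ∃ C > 0, ∀ lam : ℝ, 0 < lam → ∀ w : ℂ,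
    η ≤ w.re → ‖w‖ ≤ R → ‖cker (lam ^ 2 / 4) w‖ ≤ C * Real.exp (C * lam) := by
  set ℓ₀ := max |Real.log η| |Real.log R| + π
  have hℓ : 0 ≤ ℓ₀ := add_nonneg (le_max_of_le_left (abs_nonneg _)) Real.pi_pos.le
  refine ⟨1 / η + 4 * ℓ₀ + 8 + 2 * √R + 1, by positivity, fun lam hlam w hw hR => ?_⟩
  set μ := lam ^ 2 / 4
  have hμ : 0 ≤ μ := by positivity
  have hw1 : η ≤ ‖w‖ := hw.trans (Complex.re_le_norm w)
  set E := Real.exp (2 * √R * lam)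
  have hp : ∀ {γ : ℕ → ℝ} {K : ℝ}, 0 ≤ K → BesselType γ K → ‖pseries γ (μ * w)‖ ≤ K * E := by
    intro γ K hK h
    refine (h.norm_pseries_le _).trans ?_
    have : √‖(μ : ℂ) * w‖ ≤ √R * (lam / 2) := by
      rw [norm_mul, Complex.norm_real, Real.norm_eq_abs, abs_of_nonneg hμ]
      refine (Real.sqrt_le_sqrt (mul_le_mul_of_nonneg_left hR hμ)).trans ?_
      rw [show μ = (lam / 2) ^ 2 by simp only [μ]; ring, Real.sqrt_mul (sq_nonneg _),
        Real.sqrt_sq (by positivity), mul_comm]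
    exact mul_le_mul_of_nonneg_left (Real.exp_le_exp.2 (by linarith)) hK
  have hμe : μ ≤ Real.exp lam := by
    have := Real.quadratic_le_exp_of_nonneg hlam.le
    simp only [μ]
    nlinarith
  have h1 : 1 ≤ Real.exp lam := Real.one_le_exp hlam.le
  have hE : 0 < E := Real.exp_pos _
  have a1 : ‖pseries coeffA (μ * w) / w‖ ≤ (Real.exp lam * E) * (1 / η) := by
    rw [norm_div, mul_one_div]
    refine div_le_div₀ (by positivity) ((hp zero_le_one besselType_coeffA).trans ?_) hη hw1
    gcongr
  have a2 : ‖Complex.log w * (μ * pseries (dcoeff coeffA) (μ * w))‖ ≤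
      (Real.exp lam * E) * (4 * ℓ₀) := by
    rw [norm_mul, norm_mul, Complex.norm_real, Real.norm_eq_abs, abs_of_nonneg hμ]
    calc _ ≤ ℓ₀ * (Real.exp lam * (4 * 1 * E)) := by
          gcongr
          · exact norm_log_le hη hw1 hR
          · exact hp (by norm_num) besselType_coeffA.dcoeff
      _ = _ := by ring
  have a3 : ‖(μ : ℂ) * pseries (dcoeff coeffB) (μ * w)‖ ≤ (Real.exp lam * E) * 8 := by
    rw [norm_mul, Complex.norm_real, Real.norm_eq_abs, abs_of_nonneg hμ]
    calc _ ≤ Real.exp lam * (4 * 2 * E) := by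
          gcongr
          exact hp (by norm_num) besselType_coeffB.dcoeff
      _ = _ := by ring
  have hX : Real.exp lam * E ≤ Real.exp ((1 / η + 4 * ℓ₀ + 8 + 2 * √R + 1) * lam) := by
    rw [← Real.exp_add]
    gcongr
    have : 0 ≤ (1 / η + 4 * ℓ₀ + 8) * lam := by positivity
    linarith
  calc ‖cker μ w‖ ≤ (Real.exp lam * E) * (1 / η) + (Real.exp lam * E) * (4 * ℓ₀) +
        (Real.exp lam * E) * 8 := (norm_add₃_le).trans (by gcongr)
    _ = (1 / η + 4 * ℓ₀ + 8) * (Real.exp lam * E) := by ring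
    _ ≤ _ := mul_le_mul (by linarith [Real.sqrt_nonneg R]) hX (by positivity) (by positivity)

lemma differentiableOn_intervalIntegral {U : Set ℂ} (hU : IsOpen U) {Φ : ℂ → ℝ → ℂ} {M : ℝ}
    (hd : ∀ s, DifferentiableOn ℂ (fun z => Φ z s) U) (hc : ∀ z ∈ U, Continuous (Φ z))
    (hM : ∀ z ∈ U, ∀ s, ‖Φ z s‖ ≤ M) (a b : ℝ) :
    DifferentiableOn ℂ (fun z => ∫ s in a..b, Φ z s) U := by
  intro z₀ hz₀
  obtain ⟨ε, hε, hball⟩ := Metric.isOpen_iff.1 hU z₀ hz₀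
  have hmem : ∀ z ∈ Metric.ball z₀ (ε / 2), ∀ u ∈ Metric.closedBall z (ε / 3), u ∈ U := by
    intro z hz u hu
    refine hball ?_
    rw [Metric.mem_ball] at hz ⊢
    rw [Metric.mem_closedBall] at hu
    linarith [dist_triangle u z z₀]
  have hderiv : ∀ s, ∀ z ∈ U, HasDerivAt (fun z => Φ z s) (deriv (fun z => Φ z s) z) z :=
    fun s z hz => ((hd s).differentiableAt (hU.mem_nhds hz)).hasDerivAt
  refine (intervalIntegral.hasDerivAt_integral_of_dominated_loc_of_deriv_le
    (F := Φ) (F' := fun z s => deriv (fun z => Φ z s) z) (bound := fun _ => M / (ε / 3))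
    (Metric.ball_mem_nhds z₀ (half_pos hε)) ?_ ?_ ?_ ?_ ?_ ?_).2.differentiableAt.differentiableWithinAt
  · filter_upwards [hU.mem_nhds hz₀] with z hz
    exact (hc z hz).aestronglyMeasurable
  · exact (hc z₀ hz₀).intervalIntegrable _ _
  · set u : ℕ → ℂ := fun n => z₀ + ((ε / (n + 2) : ℝ) : ℂ)
    have hu : ∀ n, u n ∈ U := by
      intro n
      refine hball ?_
      rw [mem_ball_iff_norm, add_sub_cancel_left, Complex.norm_real, Real.norm_eq_abs,
        abs_of_pos (by positivity)]
      exact div_lt_self hε (by linarith [(Nat.cast_nonneg n : (0 : ℝ) ≤ n)])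
    have hlim : Filter.Tendsto u Filter.atTop (nhdsWithin z₀ {z₀}ᶜ) := by
      refine tendsto_nhdsWithin_iff.2 ⟨?_, Filter.Eventually.of_forall fun n => ?_⟩
      · have h1 : Filter.Tendsto (fun n : ℕ => ε / ((n : ℝ) + 2)) Filter.atTop (nhds 0) :=
          Filter.Tendsto.const_div_atTop
            (Filter.tendsto_atTop_add_const_right _ _ tendsto_natCast_atTop_atTop) _
        have := (Complex.continuous_ofReal.tendsto 0).comp h1
        simpa [u] using this.const_add z₀
      · simp only [u, Set.mem_compl_iff, Set.mem_singleton_iff, add_eq_left]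
        exact_mod_cast (by positivity : ε / ((n : ℝ) + 2) ≠ 0)
    refine aestronglyMeasurable_of_tendsto_ae Filter.atTop
      (f := fun n s => slope (fun z => Φ z s) z₀ (u n)) (fun n => ?_)
      (Filter.Eventually.of_forall fun s => (hderiv s z₀ hz₀).tendsto_slope.comp hlim)
    simp only [slope_def_field]
    exact (((hc _ (hu n)).sub (hc z₀ hz₀)).div_const _).aestronglyMeasurable
  · refine Filter.Eventually.of_forall fun s _ z hz => ?_
    refine Complex.norm_deriv_le_of_forall_mem_sphere_norm_le (by positivity) ?_ fun u hu =>
      hM u (hmem z hz u (Metric.sphere_subset_closedBall hu)) s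
    exact DifferentiableOn.diffContOnCl
      ((hd s).mono fun u hu => hmem z hz u (Metric.closure_ball_subset_closedBall hu))
  · exact intervalIntegrable_const
  · exact Filter.Eventually.of_forall fun s _ z hz =>
      hderiv s z (hmem z hz z (Metric.mem_closedBall_self (by positivity)))

/-- If `g` is complex and close to the real number `c`, then the real part of `(g - q)²` is
close to `(c - q)²`. -/
lemma sq_sub_le_re_sq {g : ℂ} {c q ε D : ℝ} (hg : ‖g - c‖ ≤ ε) (hD : |c - q| ≤ D) :
    (c - q) ^ 2 - 2 * D * ε - ε ^ 2 ≤ ((g - q) ^ 2).re := by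
  have hε : 0 ≤ ε := (norm_nonneg _).trans hg
  set h := g - c with hh
  have h1 : |h.re| ≤ ε := (Complex.abs_re_le_norm h).trans hg
  have h2 : |h.im| ≤ ε := (Complex.abs_im_le_norm h).trans hg
  have e1 : ((g - q) ^ 2).re = (c - q + h.re) ^ 2 - h.im ^ 2 := by
    simp [hh, sq]
  have h3 : |(c - q) * h.re| ≤ D * ε := by
    rw [abs_mul]
    exact mul_le_mul hD h1 (abs_nonneg _) ((abs_nonneg _).trans hD)
  have h4 : h.im ^ 2 ≤ ε ^ 2 := sq_le_sq.2 (by rwa [abs_of_nonneg hε])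
  rw [e1]
  nlinarith [abs_le.1 h3, sq_nonneg h.re]

lemma norm_sub_le_of_near {g : ℂ} {c q ε D : ℝ} (hg : ‖g - c‖ ≤ ε) (hD : |c - q| ≤ D) :
    ‖g - q‖ ≤ D + ε := by
  have : g - q = ((c - q : ℝ) : ℂ) + (g - c) := by push_cast; ring
  rw [this]
  refine (norm_add_le _ _).trans (add_le_add ?_ hg)
  rwa [Complex.norm_real]

lemma E2.norm_sub_sq (x y : E2) : ‖x - y‖ ^ 2 = (x 0 - y 0) ^ 2 + (x 1 - y 1) ^ 2 := by
  rw [← real_inner_self_eq_norm_sq, E2.inner_eq]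
  simp only [PiLp.sub_apply]
  ring

namespace InteriorCurve

variable {Ω : Set E2} (Γ : InteriorCurve Ω)

lemma continuous_c : Continuous Γ.c :=
  continuous_iff_continuousAt.2 fun s => (Γ.hasDerivAt s).continuousAt

lemma exists_le_norm_sub (hΩ : IsPlaneDomain Ω) (B : BoundaryParam Ω) :
    ∃ η > 0, ∀ s t, η ≤ ‖Γ.c t - B.q s‖ := by
  have hK : IsCompact (Set.range Γ.c) :=
    Γ.periodic.compact_of_continuous Γ.len_pos.ne' Γ.continuous_c
  obtain ⟨η, hη, h⟩ := hK.exists_cthickening_subset_open hΩ.isOpen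
    (Set.range_subset_iff.2 Γ.mem)
  refine ⟨η, hη, fun s t => ?_⟩
  by_contra! hlt
  refine BoundaryParam.q_not_mem hΩ s (B := B) (h ?_)
  refine Metric.mem_cthickening_of_dist_le _ (Γ.c t) _ _ (Set.mem_range_self t) ?_
  rw [dist_comm, dist_eq_norm]
  exact hlt.le

/-- A common complexification of the coordinates of an interior curve, keeping the squared
distance to the boundary in a fixed compact subset of the right half plane. -/
lemma exists_complexification (hΩ : IsPlaneDomain Ω) (B : BoundaryParam Ω) :
    ∃ δ > 0, ∃ η > 0, ∃ D, 0 ≤ D ∧ ∃ g : Fin 2 → ℂ → ℂ,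
      (∀ i, DifferentiableOn ℂ (g i) {z | |z.im| < δ}) ∧ (∀ i (x : ℝ), g i x = Γ.c x i) ∧
      ∀ z, |z.im| < δ → ∀ s, (∀ i, ‖g i z - B.q s i‖ ≤ D) ∧
        η ≤ ((g 0 z - B.q s 0) ^ 2 + (g 1 z - B.q s 1) ^ 2).re := by
  obtain ⟨η, hη, hdist⟩ := Γ.exists_le_norm_sub hΩ B
  obtain ⟨D, hD⟩ := Metric.isBounded_iff.1 hΩ.isCompact_closure.isBounded
  have hcoord : ∀ s t i, |Γ.c t i - B.q s i| ≤ D := fun s t i => by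
    have h1 := hD (subset_closure (Γ.mem t)) (frontier_subset_closure (B.q_mem_frontier s))
    rw [dist_eq_norm] at h1
    exact (PiLp.norm_apply_le (Γ.c t - B.q s) i).trans h1
  have hD0 : 0 ≤ D := (abs_nonneg _).trans (hcoord 0 0 0)
  set ε := min 1 (η ^ 2 / (2 * (4 * D + 2)))
  have hε : 0 < ε := lt_min one_pos (by positivity)
  have hε1 : ε ≤ 1 := min_le_left _ _
  have hε2 : ε * (2 * (4 * D + 2)) ≤ η ^ 2 :=
    (le_div_iff₀ (by positivity)).1 (min_le_right _ _)
  have han : ∀ i, AnalyticOnNhd ℝ (fun t => Γ.c t i) Set.univ := fun i =>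
    ((EuclideanSpace.proj i : E2 →L[ℝ] ℝ).analyticOnNhd Set.univ).comp Γ.analytic fun _ _ => trivial
  have hext := fun i => exists_strip_extension (han i) Γ.len_pos
    (fun t => by simp only [Γ.periodic t]) hε
  choose δ hδ g hg hgr hgε using hext
  refine ⟨min (δ 0) (δ 1), lt_min (hδ 0) (hδ 1), η ^ 2 / 2, by positivity, D + ε, by positivity, g,
    ?_, hgr, ?_⟩
  · rw [Fin.forall_fin_two]
    exact ⟨(hg 0).mono fun z (hz : |z.im| < _) => hz.trans_le (min_le_left _ _),
      (hg 1).mono fun z (hz : |z.im| < _) => hz.trans_le (min_le_right _ _)⟩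
  · intro z hz s
    have hgz : ∀ i, ‖g i z - Γ.c z.re i‖ ≤ ε := by
      rw [Fin.forall_fin_two]
      exact ⟨hgε 0 z (lt_of_lt_of_le hz (min_le_left _ _)),
        hgε 1 z (lt_of_lt_of_le hz (min_le_right _ _))⟩
    refine ⟨fun i => norm_sub_le_of_near (hgz i) (hcoord s _ i), ?_⟩
    have h0 := sq_sub_le_re_sq (hgz 0) (hcoord s _ 0)
    have h1 := sq_sub_le_re_sq (hgz 1) (hcoord s _ 1)
    have h2 : η ^ 2 ≤ ‖Γ.c z.re - B.q s‖ ^ 2 := pow_le_pow_left₀ hη.le (hdist s _) 2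
    rw [E2.norm_sub_sq] at h2
    rw [Complex.add_re]
    nlinarith

lemma exists_complex_kernel {B : BoundaryParam Ω} (hΩ : IsPlaneDomain Ω) (hB : B.IsSmooth) :
    ∃ δ > 0, ∃ C > 0, ∃ k : ℝ → ℂ → ℝ → ℂ, ∀ lam : ℝ, 0 < lam →
      (∀ s, DifferentiableOn ℂ (fun z => k lam z s) {z | |z.im| < δ}) ∧
      (∀ z : ℂ, |z.im| < δ → Continuous (k lam z)) ∧
      (∀ z : ℂ, |z.im| < δ → ∀ s, ‖k lam z s‖ ≤ C * Real.exp (C * lam)) ∧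
      ∀ x s : ℝ, k lam x s = ((regFund' (lam ^ 2 / 4) 0 (‖B.q s - Γ.c x‖ ^ 2) *
        (2 * ⟪B.q s - Γ.c x, B.ν s⟫) : ℝ) : ℂ) := by
  obtain ⟨δ, hδ, η, hη, D, hD, g, hg, hgr, hgb⟩ := Γ.exists_complexification hΩ B
  obtain ⟨C, hC, hcker⟩ := exists_norm_cker_le (R := 2 * D ^ 2) hη
  set w : ℂ → ℝ → ℂ := fun z s => (g 0 z - B.q s 0) ^ 2 + (g 1 z - B.q s 1) ^ 2 with hw
  set N : ℂ → ℝ → ℂ := fun z s => 2 * ((B.q s 0 - g 0 z) * B.ν s 0 + (B.q s 1 - g 1 z) * B.ν s 1)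
    with hN
  have hqc : ∀ i, Continuous fun s => ((B.q s i : ℝ) : ℂ) := fun i =>
    Complex.continuous_ofReal.comp ((EuclideanSpace.proj i : E2 →L[ℝ] ℝ).continuous.comp
      B.continuous_q)
  have hνc : ∀ i, Continuous fun s => ((B.ν s i : ℝ) : ℂ) := fun i =>
    Complex.continuous_ofReal.comp ((EuclideanSpace.proj i : E2 →L[ℝ] ℝ).continuous.comp
      (hB.continuous_ν hΩ))
  have hwc : ∀ z, Continuous (w z) := fun z =>
    ((continuous_const.sub (hqc 0)).pow 2).add ((continuous_const.sub (hqc 1)).pow 2)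
  have hNc : ∀ z, Continuous (N z) := fun z =>
    continuous_const.mul ((((hqc 0).sub continuous_const).mul (hνc 0)).add
      (((hqc 1).sub continuous_const).mul (hνc 1)))
  have hwpos : ∀ z, |z.im| < δ → ∀ s, 0 < (w z s).re := fun z hz s =>
    hη.trans_le (hgb z hz s).2
  refine ⟨δ, hδ, C * (4 * D) + C + 1, by positivity,
    fun lam z s => cker (lam ^ 2 / 4) (w z s) * N z s, fun lam hlam => ⟨fun s => ?_, fun z hz => ?_,
      fun z hz s => ?_, fun x s => ?_⟩⟩
  · have hwd : DifferentiableOn ℂ (fun z => w z s) {z | |z.im| < δ} :=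
      (((hg 0).sub_const _).pow 2).add (((hg 1).sub_const _).pow 2)
    have hNd : DifferentiableOn ℂ (fun z => N z s) {z | |z.im| < δ} :=
      ((((hg 0).const_sub _).mul_const _).add (((hg 1).const_sub _).mul_const _)).const_mul 2
    refine DifferentiableOn.mul (fun z hz => ?_) hNd
    exact (differentiableAt_cker _ (hwpos z hz s)).comp_differentiableWithinAt z (hwd z hz)
  · refine Continuous.mul (continuous_iff_continuousAt.2 fun s => ?_) (hNc z)
    exact ContinuousAt.comp (g := cker (lam ^ 2 / 4)) (f := w z)
      (differentiableAt_cker _ (hwpos z hz s)).continuousAt (hwc z).continuousAt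
  · obtain ⟨h1, h2⟩ := hgb z hz s
    have hR : ‖w z s‖ ≤ 2 * D ^ 2 := by
      refine (norm_add_le _ _).trans ?_
      rw [norm_pow, norm_pow]
      have := pow_le_pow_left₀ (norm_nonneg _) (h1 0) 2
      have := pow_le_pow_left₀ (norm_nonneg _) (h1 1) 2
      linarith
    have hν1 : ∀ i, ‖((B.ν s i : ℝ) : ℂ)‖ ≤ 1 := fun i => by
      rw [Complex.norm_real]
      exact (PiLp.norm_apply_le (B.ν s) i).trans (B.ν_unit s).le
    have hN1 : ∀ i, ‖(B.q s i - g i z) * (B.ν s i : ℂ)‖ ≤ D * 1 := fun i => by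
      rw [norm_mul, norm_sub_rev]
      exact mul_le_mul (h1 i) (hν1 i) (norm_nonneg _) hD
    have hNb : ‖N z s‖ ≤ 4 * D := by
      rw [hN]
      simp only [norm_mul, Complex.norm_ofNat]
      have h3 := (norm_add_le _ _).trans (add_le_add (hN1 0) (hN1 1))
      linarith
    rw [norm_mul]
    calc _ ≤ C * Real.exp (C * lam) * (4 * D) :=
          mul_le_mul (hcker lam hlam _ h2 hR) hNb (norm_nonneg _) (by positivity)
      _ = C * (4 * D) * Real.exp (C * lam) := by ring
      _ ≤ _ := by
          have h4 : 0 ≤ C * (4 * D) := by positivity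
          refine mul_le_mul (by linarith) (Real.exp_le_exp.2 ?_) (by positivity) (by positivity)
          exact mul_le_mul_of_nonneg_right (by linarith) hlam.le
  · have hw' : w x s = ((‖B.q s - Γ.c x‖ ^ 2 : ℝ) : ℂ) := by
      rw [E2.norm_sub_sq]
      simp only [hw, hgr]
      push_cast
      ring
    have hN' : N x s = ((2 * ⟪B.q s - Γ.c x, B.ν s⟫ : ℝ) : ℂ) := by
      rw [E2.inner_eq]
      simp only [hN, hgr, PiLp.sub_apply]
      push_cast
      ring
    beta_reduce
    rw [hw', hN', cker_ofReal _ (sq_nonneg _), ← Complex.ofReal_mul]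

end InteriorCurve

namespace InteriorCurve

variable {Ω : Set E2} (Γ : InteriorCurve Ω)

lemma exists_holomorphic_extension {B : BoundaryParam Ω} (hΩ : IsPlaneDomain Ω)
    (hB : B.IsSmooth) :
    ∃ δ > 0, ∃ C > 0, ∀ lam : ℝ, 0 < lam → ∀ ψ : E2 → ℝ, IsSmoothNeumann B lam ψ →
      ∃ F : ℂ → ℂ, DifferentiableOn ℂ F {z | |z.im| < δ} ∧
        (∀ z : ℂ, |z.im| < δ →
          ‖F z‖ ≤ C * Real.exp (C * lam) * √(∫ s in (0 : ℝ)..B.len, ψ (B.q s) ^ 2)) ∧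
        ∀ x : ℝ, F x = ψ (Γ.c x) := by
  obtain ⟨δ, hδ, C, hC, k, hk⟩ := Γ.exists_complex_kernel hΩ hB
  have hm := bumpMass_pos
  obtain ⟨m, hmb⟩ : ∃ m, m = 4 * bumpMass := ⟨_, rfl⟩
  have hm0 : 0 < m := by rw [hmb]; positivity
  have hlen := B.len_pos
  set D := C * √B.len / m
  refine ⟨δ, hδ, C + D, by positivity, fun lam hlam ψ hψ => ?_⟩
  obtain ⟨hd, hc, hb, hr⟩ := hk lam hlam
  have hψc : Continuous ψ := hψ.smooth.continuous
  have hψq : Continuous fun s => ψ (B.q s) := hψc.comp B.continuous_q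
  obtain ⟨M, hM⟩ := (hΩ.isBounded.isCompact_closure).exists_bound_of_continuousOn hψc.continuousOn
  have hMq : ∀ s, ‖ψ (B.q s)‖ ≤ M := fun s =>
    hM _ (frontier_subset_closure (B.q_mem_frontier s))
  have hM0 : 0 ≤ M := (norm_nonneg _).trans (hMq 0)
  have hU : IsOpen {z : ℂ | |z.im| < δ} :=
    isOpen_lt (continuous_abs.comp Complex.continuous_im) continuous_const
  refine ⟨fun z => -(m : ℂ)⁻¹ * ∫ s in (0 : ℝ)..B.len, (ψ (B.q s) : ℂ) * k lam z s, ?_,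
    fun z hz => ?_, fun x => ?_⟩
  · refine (differentiableOn_intervalIntegral hU (M := M * (C * Real.exp (C * lam)))
      (fun s => (hd s).const_mul _) (fun z hz => ?_) (fun z hz s => ?_) _ _).const_mul _
    · exact (Complex.continuous_ofReal.comp hψq).mul (hc z hz)
    · rw [norm_mul, Complex.norm_real]
      exact mul_le_mul (hMq s) (hb z hz s) (norm_nonneg _) hM0
  · set I := ∫ s in (0 : ℝ)..B.len, ψ (B.q s) ^ 2
    have h1 : ‖∫ s in (0 : ℝ)..B.len, (ψ (B.q s) : ℂ) * k lam z s‖ ≤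
        ∫ s in (0 : ℝ)..B.len, |ψ (B.q s)| * (C * Real.exp (C * lam)) := by
      refine intervalIntegral.norm_integral_le_of_norm_le hlen.le
        (Filter.Eventually.of_forall fun s _ => ?_)
        ((hψq.abs.mul continuous_const).intervalIntegrable _ _)
      rw [norm_mul, Complex.norm_real, Real.norm_eq_abs]
      exact mul_le_mul_of_nonneg_left (hb z hz s) (abs_nonneg _)
    have h2 : ∫ s in (0 : ℝ)..B.len, |ψ (B.q s)| ≤ √B.len * √I := by
      have h3 := sq_intervalIntegral_le hψq.abs hlen.le
      simp only [sq_abs, sub_zero] at h3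
      rw [← Real.sqrt_mul hlen.le]
      exact Real.le_sqrt_of_sq_le h3
    rw [intervalIntegral.integral_mul_const] at h1
    rw [norm_mul, norm_neg, norm_inv, Complex.norm_real, Real.norm_of_nonneg hm0.le]
    calc _ ≤ m⁻¹ * (√B.len * √I * (C * Real.exp (C * lam))) := by gcongr; exact h1.trans (by gcongr)
      _ = D * Real.exp (C * lam) * √I := by
          simp only [D]
          ring
      _ ≤ _ := by
          have : 0 ≤ D := by positivity
          gcongr
          · linarith
          · linarith
  · have h1 := hψ.representation hΩ hB (Γ.mem x)
    rw [← hmb] at h1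
    have h2 : ∫ s in (0 : ℝ)..B.len, (ψ (B.q s) : ℂ) * k lam x s =
        ((∫ s in (0 : ℝ)..B.len, ψ (B.q s) * (regFund' (lam ^ 2 / 4) 0 (‖B.q s - Γ.c x‖ ^ 2) *
          (2 * ⟪B.q s - Γ.c x, B.ν s⟫)) : ℝ) : ℂ) := by
      rw [← intervalIntegral.integral_ofReal]
      simp only [hr, ← Complex.ofReal_mul]
    have h3 : (m : ℂ) ≠ 0 := Complex.ofReal_ne_zero.2 hm0.ne'
    beta_reduce
    rw [h2, ← neg_eq_iff_eq_neg.2 h1, Complex.ofReal_neg, Complex.ofReal_mul]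
    field_simp

end InteriorCurve

lemma IsSmoothNeumann.integral_sq_boundary_pos {Ω : Set E2} {B : BoundaryParam Ω} {lam : ℝ}
    {ψ : E2 → ℝ} (h : IsSmoothNeumann B lam ψ) (hΩ : IsPlaneDomain Ω) (hB : B.IsSmooth)
    (hne : ∃ x ∈ Ω, ψ x ≠ 0) : 0 < ∫ s in (0 : ℝ)..B.len, ψ (B.q s) ^ 2 := by
  have hψq : Continuous fun s => ψ (B.q s) := h.smooth.continuous.comp B.continuous_q
  by_contra hle
  obtain ⟨x, hx, hx0⟩ := hne
  have hzero : ∀ s ∈ Set.Icc 0 B.len, ψ (B.q s) = 0 := by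
    by_contra! hs
    obtain ⟨s, hs, hs0⟩ := hs
    exact hle (intervalIntegral.integral_pos B.len_pos (hψq.pow 2).continuousOn
      (fun _ _ => sq_nonneg _) ⟨s, hs, by positivity⟩)
  have h1 := h.representation hΩ hB hx
  rw [intervalIntegral.integral_congr (g := fun _ => 0) fun s hs => by
    rw [Set.uIcc_of_le B.len_pos.le] at hs
    simp [hzero s hs]] at h1
  have := bumpMass_pos
  simp_all

lemma InteriorCurve.exists_card_le {Ω : Set E2} (hΩ : IsPlaneDomain Ω) {B : BoundaryParam Ω}
    (hB : B.IsSmooth) (Γ : InteriorCurve Ω) (a : ℝ) :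
    ∃ K > 0, ∃ τ, 0 < τ ∧ τ < 1 ∧ ∀ lam : ℝ, 0 < lam → ∀ ψ : E2 → ℝ, IsSmoothNeumann B lam ψ →
      (∃ x ∈ Ω, ψ x ≠ 0) →
      (∫ s in (0 : ℝ)..B.len, ψ (B.q s) ^ 2) ≤
        Real.exp (2 * a * lam) * ∫ s in (0 : ℝ)..Γ.len, ψ (Γ.c s) ^ 2 →
      ∀ S : Finset ℝ, (∀ s ∈ S, s ∈ Set.Icc 0 Γ.len ∧ ψ (Γ.c s) = 0) →
        1 ≤ K * Real.exp (K * lam) * τ ^ S.card := by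
  obtain ⟨δ, hδ, C, hC, hF⟩ := Γ.exists_holomorphic_extension hΩ hB
  have hL := Γ.len_pos
  set τ := Real.tanh (π / (4 * (δ / 2)) * Γ.len)
  have hτ0 : 0 < τ := by
    simp only [τ, Real.tanh_eq_sinh_div_cosh]
    exact div_pos (Real.sinh_pos_iff.2 (by positivity)) (Real.cosh_pos _)
  refine ⟨|a| + C + √Γ.len * C, by positivity, τ, hτ0, Real.tanh_lt_one _,
    fun lam hlam ψ hψ hne hgood S hS => ?_⟩
  obtain ⟨F, hFd, hFb, hFr⟩ := hF lam hlam ψ hψ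
  have hI := hψ.integral_sq_boundary_pos hΩ hB hne
  set I := ∫ s in (0 : ℝ)..B.len, ψ (B.q s) ^ 2
  have hψc : Continuous fun s => ψ (Γ.c s) := hψ.smooth.continuous.comp Γ.continuous_c
  obtain ⟨x, hx, hxI⟩ := exists_mul_le_intervalIntegral (hψc.pow 2).neg hL
  simp only [Pi.neg_apply, Pi.pow_apply, intervalIntegral.integral_neg, sub_zero] at hxI
  have hbound := norm_le_tanh_pow_card (δ := δ / 2) (half_pos hδ) hx S (fun s hs => (hS s hs).1) F
    (by rwa [mul_div_cancel₀ _ two_ne_zero]) (fun z hz => hFb z (hz.trans_lt (half_lt_self hδ)))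
    (fun s hs => by rw [hFr, (hS s hs).2, Complex.ofReal_zero])
  rw [hFr, Complex.norm_real, Real.norm_eq_abs] at hbound
  have hroot : √I ≤ Real.exp (a * lam) * √Γ.len * |ψ (Γ.c x)| := by
    refine Real.sqrt_le_iff.2 ⟨by positivity, hgood.trans ?_⟩
    have hexp : Real.exp (a * lam) ^ 2 = Real.exp (2 * a * lam) := by
      rw [← Real.exp_nat_mul, Nat.cast_ofNat, mul_assoc]
    rw [mul_pow, mul_pow, Real.sq_sqrt hL.le, sq_abs, hexp, mul_assoc (Real.exp _)]
    exact mul_le_mul_of_nonneg_left (by linarith) (Real.exp_nonneg _)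
  have hI' : 0 < √I := Real.sqrt_pos.2 hI
  have hone : 1 ≤ √Γ.len * C * Real.exp ((a + C) * lam) * τ ^ S.card := by
    refine le_of_mul_le_mul_right ?_ hI'
    calc 1 * √I ≤ Real.exp (a * lam) * √Γ.len * |ψ (Γ.c x)| := by rwa [one_mul]
      _ ≤ Real.exp (a * lam) * √Γ.len * (C * Real.exp (C * lam) * √I * τ ^ S.card) := by gcongr
      _ = _ := by
          rw [add_mul, Real.exp_add]
          ring
  refine hone.trans ?_
  have : 0 ≤ √Γ.len * C := by positivity
  have := le_abs_self a
  have := abs_nonneg a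
  refine mul_le_mul_of_nonneg_right (mul_le_mul (by linarith) (Real.exp_le_exp.2 ?_)
    (Real.exp_nonneg _) (by positivity)) (by positivity)
  exact mul_le_mul_of_nonneg_right (by linarith) hlam.le

lemma exists_le_mul_of_one_le {K τ : ℝ} (hK : 0 < K) (hτ : 0 < τ) (hτ1 : τ < 1) {A : ℝ}
    (hA : 0 < A) :
    ∃ C > 0, ∀ lam : ℝ, 0 < lam → 1 ≤ A * lam ^ 2 → ∀ n : ℕ,
      1 ≤ K * Real.exp (K * lam) * τ ^ n → (n : ℝ) ≤ C * lam := by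
  have hlog : 0 < -Real.log τ := neg_pos.2 (Real.log_neg hτ hτ1)
  refine ⟨(K * √A + K) / -Real.log τ, by positivity, fun lam hlam hAl n hn => ?_⟩
  have h1 := Real.log_nonneg hn
  rw [Real.log_mul (by positivity) (by positivity), Real.log_mul hK.ne' (Real.exp_ne_zero _),
    Real.log_exp, Real.log_pow] at h1
  have h2 : 1 ≤ √A * lam := by
    refine le_of_sq_le_sq ?_ (by positivity)
    rwa [mul_pow, Real.sq_sqrt hA.le, one_pow]
  have h3 := Real.log_le_sub_one_of_pos hK
  rw [div_mul_eq_mul_div, le_div_iff₀ hlog]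
  nlinarith

/-- If the interior real-analytic curve `C` is good, then the number of intersection points
of the nodal set of a Neumann eigenfunction with `C` is at most `C'·λ`. -/
theorem nodal_intersections_with_good_interior_curve
    (Ω : Set E2) (hΩ : IsPlaneDomain Ω) (B : BoundaryParam Ω) (hB : B.IsSmooth)
    (Γ : InteriorCurve Ω)
    (good : ∃ a > (0 : ℝ), ∀ lam : ℝ, 0 < lam → ∀ φ : E2 → ℝ,
      IsNeumannEigenfunction B lam φ →
      (∫ s in (0 : ℝ)..B.len, (φ (B.q s)) ^ 2) ≤
        Real.exp (2 * a * lam) * ∫ s in (0 : ℝ)..Γ.len, (φ (Γ.c s)) ^ 2) :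
    ∃ C' > (0 : ℝ), ∀ lam : ℝ, 0 < lam → ∀ φ : E2 → ℝ,
      IsNeumannEigenfunction B lam φ →
      ({s ∈ Set.Ico (0 : ℝ) Γ.len | φ (Γ.c s) = 0}).Finite ∧
      (({s ∈ Set.Ico (0 : ℝ) Γ.len | φ (Γ.c s) = 0}).ncard : ℝ) ≤ C' * lam := by
  obtain ⟨a, -, hgood⟩ := good
  obtain ⟨K, hK, τ, hτ, hτ1, hcard⟩ := Γ.exists_card_le hΩ hB a
  obtain ⟨A, hA, hlow⟩ := hΩ.exists_forall_le hB
  obtain ⟨C, hC, hCn⟩ := exists_le_mul_of_one_le hK hτ hτ1 hA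
  refine ⟨C, hC, fun lam hlam φ hφ => ?_⟩
  obtain ⟨ψ, hψ, hψφ⟩ := hφ.exists_smooth
  have hq : ∀ s, ψ (B.q s) = φ (B.q s) := fun s =>
    hψφ _ (frontier_subset_closure (B.q_mem_frontier s))
  have hc : ∀ s, ψ (Γ.c s) = φ (Γ.c s) := fun s => hψφ _ (subset_closure (Γ.mem s))
  have hne : ∃ x ∈ Ω, ψ x ≠ 0 := by
    obtain ⟨x, hx, hx0⟩ := hφ.nontrivial
    exact ⟨x, hx, by rwa [hψφ x (subset_closure hx)]⟩
  have hg := hgood lam hlam φ hφ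
  simp only [← hq, ← hc] at hg
  have key : ∀ S : Finset ℝ, (S : Set ℝ) ⊆ {s ∈ Set.Ico (0 : ℝ) Γ.len | φ (Γ.c s) = 0} →
      (S.card : ℝ) ≤ C * lam := fun S hS =>
    hCn lam hlam (hlow lam ψ hlam hψ hne) _ (hcard lam hlam ψ hψ hne hg S fun s hs =>
      ⟨Set.Ico_subset_Icc_self (hS hs).1, (hc s).trans (hS hs).2⟩)
  have hfin : ({s ∈ Set.Ico (0 : ℝ) Γ.len | φ (Γ.c s) = 0}).Finite := by
    by_contra hinf
    obtain ⟨n, hn⟩ := exists_nat_gt (C * lam)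
    obtain ⟨S, hS, rfl⟩ := Set.Infinite.exists_subset_card_eq hinf n
    exact absurd (key S hS) hn.not_ge
  refine ⟨hfin, ?_⟩
  rw [Set.ncard_eq_toFinset_card _ hfin]
  exact key _ (by rw [hfin.coe_toFinset])
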